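/- Let SG be the doubly-infinite Sierpinski gasket graph with origin o, and let (I_n) be the internal DLA process on SG started from I_0 = {o}, built from simple random walks started at o. Then the cluster of |B_n| particles occupies a set of sites close to a ball of radius n: for all ε > 0, with probability 1, B_{n(1−ε)} ⊂ I_{|B_n|} ⊂ B_{n(1+ε)} for all sufficiently large n, where B_r is the ball of radius r centered at o in the graph metric of SG. -/

import Mathlib

open MeasureTheory Filter Topology

/-- The vertex sets `V_n` of the finite Sierpinski gasket graphs. -/
noncomputable def gasketV : ℕ → Set (ℝ × ℝ)
  | 0 => {(0, 0), (1, 0), (1/2, Real.sqrt 3 / 2)}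
  | n+1 => gasketV n ∪ ((fun p => p + ((2 : ℝ) ^ n, 0)) '' gasketV n) ∪
      ((fun p => p + ((2 : ℝ) ^ n / 2, (2 : ℝ) ^ n / 2 * Real.sqrt 3)) '' gasketV n)

/-- The edge sets `E_n` of the finite Sierpinski gasket graphs. -/
noncomputable def gasketE : ℕ → Set ((ℝ × ℝ) × (ℝ × ℝ))
  | 0 => {((0, 0), (1, 0)), ((0, 0), (1/2, Real.sqrt 3 / 2)),
      ((1, 0), (1/2, Real.sqrt 3 / 2))}
  | n+1 => gasketE n ∪
      ((fun e => (e.1 + ((2 : ℝ) ^ n, 0), e.2 + ((2 : ℝ) ^ n, 0))) '' gasketE n) ∪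
      ((fun e => (e.1 + ((2 : ℝ) ^ n / 2, (2 : ℝ) ^ n / 2 * Real.sqrt 3),
          e.2 + ((2 : ℝ) ^ n / 2, (2 : ℝ) ^ n / 2 * Real.sqrt 3))) '' gasketE n)

/-- The vertex set `V = V_∞ ∪ (-V_∞)` of the doubly-infinite Sierpinski gasket graph. -/
noncomputable def SGV : Set (ℝ × ℝ) :=
  (⋃ n, gasketV n) ∪ ((fun p => -p) '' ⋃ n, gasketV n)

/-- The edge set `E = E_∞ ∪ (-E_∞)` of the doubly-infinite Sierpinski gasket graph. -/
noncomputable def SGE : Set ((ℝ × ℝ) × (ℝ × ℝ)) :=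
  (⋃ n, gasketE n) ∪ ((fun e => (-e.1, -e.2)) '' ⋃ n, gasketE n)

/-- The doubly-infinite Sierpinski gasket graph `SG`. -/
def SG := {p : ℝ × ℝ // p ∈ SGV}

/-- Adjacency in `SG`. -/
def sgAdj (x y : SG) : Prop := (x.1, y.1) ∈ SGE ∨ (y.1, x.1) ∈ SGE

noncomputable instance : DecidableEq SG := Classical.decEq _

open Classical in
/-- Probability that the simple random walk on the graph with adjacency `adj` (moving
uniformly to one of the neighbors), started at `x`, hits the set `A` within `n` steps,
with first hitting position `y`. -/
noncomputable def hitPA {V : Type*} (adj : V → V → Prop) (A : Set V) : ℕ → V → V → ℝ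
  | 0, x, y => if x ∈ A ∧ x = y then 1 else 0
  | n+1, x, y =>
      if x ∈ A then (if x = y then 1 else 0)
      else (({z | adj x z}.ncard : ℝ))⁻¹ * ∑' z : {z // adj x z}, hitPA adj A n z.1 y

/-- The hitting distribution `H_A(x,y)`. -/
noncomputable def hitMA {V : Type*} (adj : V → V → Prop) (A : Set V) (x y : V) : ℝ :=
  ⨆ n, hitPA adj A n x y

/-- Outer boundary of a finite set of vertices. -/
def bdryA {V : Type*} (adj : V → V → Prop) (A : Finset V) : Set V :=
  {y | y ∉ A ∧ ∃ x ∈ A, adj x y}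

/-- Graph-metric balls centered at `o`. -/
def aBall {V : Type*} (adj : V → V → Prop) (o : V) : ℕ → Set V
  | 0 => {o}
  | n+1 => aBall adj o n ∪ {y | ∃ x ∈ aBall adj o n, adj x y}

/-- Graph distance from `o`. -/
noncomputable def aDist {V : Type*} (adj : V → V → Prop) (o x : V) : ℕ :=
  sInf {n : ℕ | x ∈ aBall adj o n}

/-- A connected infinite `4`-regular graph together with a level function that decreases
along some edge at every vertex other than the root. -/
structure LeveledGraph (V : Type*) where
  nbr : V → Finset V
  lev : V → ℕ
  root : V
  mem_nbr_comm : ∀ {x y}, y ∈ nbr x ↔ x ∈ nbr y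
  card_nbr : ∀ x, (nbr x).card = 4
  lev_root : lev root = 0
  exists_lower : ∀ x, x ≠ root → ∃ y ∈ nbr x, lev y + 1 = lev x
  lev_le : ∀ {x y}, y ∈ nbr x → lev y ≤ lev x + 1
  finite_lev : ∀ n, {x | lev x < n}.Finite
  infinite : Infinite V

namespace LeveledGraph

variable {V : Type*} (G : LeveledGraph V)

/-- The (unnormalised) graph Laplacian. -/
def lap (f : V → ℝ) (x : V) : ℝ := ∑ y ∈ G.nbr x, (f y - f x)

lemma lap_eq (f : V → ℝ) (x : V) : G.lap f x = ∑ y ∈ G.nbr x, f y - 4 * f x := by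
  simp [lap, Finset.sum_sub_distrib, G.card_nbr]

lemma lap_congr {f g : V → ℝ} {x : V} (hx : f x = g x) (h : ∀ y ∈ G.nbr x, f y = g y) :
    G.lap f x = G.lap g x := by
  unfold lap
  exact Finset.sum_congr rfl fun y hy => by rw [h y hy, hx]

lemma lap_sub (f g : V → ℝ) (x : V) :
    G.lap (fun x => f x - g x) x = G.lap f x - G.lap g x := by
  simp only [lap, ← Finset.sum_sub_distrib]
  exact Finset.sum_congr rfl fun y _ => by ring

lemma lap_const_mul (c : ℝ) (f : V → ℝ) (x : V) :
    G.lap (fun x => c * f x) x = c * G.lap f x := by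
  simp only [lap, Finset.mul_sum]
  exact Finset.sum_congr rfl fun y _ => by ring

lemma hitPA_succ_of_notMem {adj : V → V → Prop} (hadj : ∀ x y, adj x y ↔ y ∈ G.nbr x)
    {S : Set V} (n : ℕ) {x : V} (hx : x ∉ S) (y : V) :
    hitPA adj S (n + 1) x y = (∑ z ∈ G.nbr x, hitPA adj S n z y) / 4 := by
  have hset : {z | adj x z} = ↑(G.nbr x) := by ext z; simp [hadj]
  rw [hitPA, if_neg hx, hset, Set.ncard_coe_finset, G.card_nbr]
  have : ∑' z : {z // adj x z}, hitPA adj S n z.1 y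
      = ∑ z ∈ G.nbr x, hitPA adj S n z y := by
    rw [← Finset.tsum_subtype]
    have e : {z // adj x z} ≃ {z // z ∈ G.nbr x} := Equiv.subtypeEquivRight (hadj x)
    exact (Equiv.subtypeEquivRight (hadj x)).tsum_eq
      (fun z : {z // z ∈ G.nbr x} => hitPA adj S n z.1 y)
  rw [this]
  push_cast
  ring

lemma hitPA_of_mem {adj : V → V → Prop} {S : Set V} (n : ℕ) {x : V} (hx : x ∈ S) (y : V)
    [Decidable (x = y)] : hitPA adj S n x y = if x = y then 1 else 0 := by
  cases n <;> simp [hitPA, hx]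

lemma hitMA_of_mem {adj : V → V → Prop} {S : Set V} {x : V} (hx : x ∈ S) (y : V)
    [Decidable (x = y)] : hitMA adj S x y = if x = y then 1 else 0 := by
  have : (fun n => hitPA adj S n x y) = fun _ => if x = y then 1 else 0 := by
    funext n; exact hitPA_of_mem n hx y
  rw [hitMA]
  simp only [this, ciSup_const]

variable [DecidableEq V]

lemma mem_of_closed {K : Set V} (hK : ∀ x ∈ K, ∀ y ∈ G.nbr x, y ∈ K) {x : V} (hx : x ∈ K)
    (v : V) : v ∈ K := by
  have down : ∀ n x, x ∈ K → G.lev x = n → G.root ∈ K := by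
    intro n
    induction n with
    | zero =>
      intro x hx hn
      by_cases h : x = G.root
      · exact h ▸ hx
      · obtain ⟨y, _, hy⟩ := G.exists_lower x h
        omega
    | succ n ih =>
      intro x hx hn
      by_cases h : x = G.root
      · exact h ▸ hx
      · obtain ⟨y, hy, hy'⟩ := G.exists_lower x h
        exact ih y (hK x hx y hy) (by omega)
  have hroot := down _ x hx rfl
  have up : ∀ n v, G.lev v = n → v ∈ K := by
    intro n
    induction n with
    | zero =>
      intro v hn
      by_cases h : v = G.root
      · exact h ▸ hroot
      · obtain ⟨y, _, hy⟩ := G.exists_lower v h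
        omega
    | succ n ih =>
      intro v hn
      by_cases h : v = G.root
      · exact h ▸ hroot
      · obtain ⟨y, hy, hy'⟩ := G.exists_lower v h
        exact hK y (ih y (by omega)) v (G.mem_nbr_comm.1 hy)
  exact up _ v rfl

/-- The maximum principle on finite sets. -/
lemma max_principle {A : Finset V} {f : V → ℝ} (hA : ∀ x ∈ A, 0 ≤ G.lap f x)
    (hc : ∀ x, x ∉ A → f x ≤ 0) (x : V) : f x ≤ 0 := by
  by_contra! hx
  have hxA : x ∈ A := by
    by_contra h
    exact absurd (hc x h) (not_le.2 hx)
  obtain ⟨x₁, hx₁, hmax⟩ := A.exists_max_image f ⟨x, hxA⟩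
  have hpos : 0 < f x₁ := hx.trans_le (hmax x hxA)
  have hle : ∀ y, f y ≤ f x₁ := fun y => by
    by_cases h : y ∈ A
    · exact hmax y h
    · exact (hc y h).trans hpos.le
  have hK : ∀ v ∈ {v | f v = f x₁}, ∀ y ∈ G.nbr v, y ∈ {v | f v = f x₁} := by
    intro v hv y hy
    have hvA : v ∈ A := by
      by_contra h
      have h1 := hc v h
      have h2 : f v = f x₁ := hv
      linarith
    have hnonpos : ∀ z ∈ G.nbr v, f z - f v ≤ 0 := fun z _ => by
      have h2 : f v = f x₁ := hv
      linarith [hle z]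
    have h0 : ∑ z ∈ G.nbr v, (f z - f v) = 0 :=
      le_antisymm (Finset.sum_nonpos hnonpos) (hA v hvA)
    have h3 := (Finset.sum_eq_zero_iff_of_nonpos hnonpos).1 h0 y hy
    have h2 : f v = f x₁ := hv
    show f y = f x₁
    linarith
  have := G.infinite
  obtain ⟨v, hv⟩ := Infinite.exists_notMem_finset A
  have hv' : f v = f x₁ := G.mem_of_closed hK (x := x₁) rfl v
  linarith [hc v hv]

section Hitting

variable {adj : V → V → Prop}

lemma hitPA_nonneg (hadj : ∀ x y, adj x y ↔ y ∈ G.nbr x)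
    (S : Set V) (n : ℕ) (x y : V) : 0 ≤ hitPA adj S n x y := by
  classical
  induction n generalizing x with
  | zero => rw [hitPA]; split_ifs <;> norm_num
  | succ n ih =>
    by_cases hx : x ∈ S
    · rw [hitPA_of_mem _ hx]; split_ifs <;> norm_num
    · rw [G.hitPA_succ_of_notMem hadj n hx]
      exact div_nonneg (Finset.sum_nonneg fun z _ => ih z) (by norm_num)

lemma hitPA_le_one (hadj : ∀ x y, adj x y ↔ y ∈ G.nbr x)
    (S : Set V) (n : ℕ) (x y : V) : hitPA adj S n x y ≤ 1 := by
  classical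
  induction n generalizing x with
  | zero => rw [hitPA]; split_ifs <;> norm_num
  | succ n ih =>
    by_cases hx : x ∈ S
    · rw [hitPA_of_mem _ hx]; split_ifs <;> norm_num
    · rw [G.hitPA_succ_of_notMem hadj n hx]
      have := Finset.sum_le_sum fun z (_ : z ∈ G.nbr x) => ih z
      simp [G.card_nbr] at this
      linarith

lemma hitPA_mono (hadj : ∀ x y, adj x y ↔ y ∈ G.nbr x)
    (S : Set V) (x y : V) : Monotone fun n => hitPA adj S n x y := by
  classical
  refine monotone_nat_of_le_succ fun n => ?_
  induction n generalizing x with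
  | zero =>
    by_cases hx : x ∈ S
    · rw [hitPA_of_mem _ hx, hitPA_of_mem _ hx]
    · have h0 : hitPA adj S 0 x y = 0 := by simp [hitPA, hx]
      rw [h0]
      exact G.hitPA_nonneg hadj S _ _ _
  | succ n ih =>
    by_cases hx : x ∈ S
    · rw [hitPA_of_mem _ hx, hitPA_of_mem _ hx]
    · rw [G.hitPA_succ_of_notMem hadj n hx, G.hitPA_succ_of_notMem hadj (n + 1) hx]
      have := Finset.sum_le_sum fun z (_ : z ∈ G.nbr x) => ih z
      linarith

lemma tendsto_hitPA (hadj : ∀ x y, adj x y ↔ y ∈ G.nbr x)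
    (S : Set V) (x y : V) :
    Tendsto (fun n => hitPA adj S n x y) atTop (𝓝 (hitMA adj S x y)) :=
  tendsto_atTop_ciSup (G.hitPA_mono hadj S x y)
    ⟨1, by rintro _ ⟨n, rfl⟩; exact G.hitPA_le_one hadj S n x y⟩

lemma hitMA_nonneg (hadj : ∀ x y, adj x y ↔ y ∈ G.nbr x)
    (S : Set V) (x y : V) : 0 ≤ hitMA adj S x y :=
  ge_of_tendsto' (G.tendsto_hitPA hadj S x y) fun n => G.hitPA_nonneg hadj S n x y

lemma lap_hitMA (hadj : ∀ x y, adj x y ↔ y ∈ G.nbr x)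
    {S : Set V} {x : V} (hx : x ∉ S) (y : V) :
    G.lap (fun x => hitMA adj S x y) x = 0 := by
  have h1 := (G.tendsto_hitPA hadj S x y).comp (tendsto_add_atTop_nat 1)
  have h2 : Tendsto (fun n => (∑ z ∈ G.nbr x, hitPA adj S n z y) / 4) atTop
      (𝓝 ((∑ z ∈ G.nbr x, hitMA adj S z y) / 4)) :=
    (tendsto_finsetSum _ fun z _ => G.tendsto_hitPA hadj S z y).div_const 4
  have h3 : (fun n => hitPA adj S n x y) ∘ (fun n => n + 1)
      = fun n => (∑ z ∈ G.nbr x, hitPA adj S n z y) / 4 := by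
    funext n; exact G.hitPA_succ_of_notMem hadj n hx y
  rw [h3] at h1
  have := tendsto_nhds_unique h1 h2
  rw [lap_eq]
  linarith

end Hitting

/-- The outer boundary of a finite set, as a finite set. -/
def bd (A : Finset V) : Finset V := (A.biUnion G.nbr) \ A

lemma mem_bd {A : Finset V} {y : V} : y ∈ G.bd A ↔ y ∉ A ∧ ∃ x ∈ A, y ∈ G.nbr x := by
  simp [bd, and_comm]

lemma nbr_mem {A : Finset V} {x y : V} (hx : x ∈ A) (hy : y ∈ G.nbr x) :
    y ∈ A ∨ y ∈ G.bd A := by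
  by_cases h : y ∈ A
  · exact Or.inl h
  · exact Or.inr (G.mem_bd.2 ⟨h, x, hx, hy⟩)

/-- The expected value of `F` at the exit location from `A` of the walk started at `x`. -/
noncomputable def exitMean (adj : V → V → Prop) (A : Finset V) (F : V → ℝ) (x : V) : ℝ :=
  ∑ y ∈ G.bd A, hitMA adj (bdryA adj A) x y * F y

section Exit

variable {adj : V → V → Prop} {A : Finset V}

lemma mem_bdryA (hadj : ∀ x y, adj x y ↔ y ∈ G.nbr x)
    {y : V} : y ∈ bdryA adj A ↔ y ∈ G.bd A := by
  simp [bdryA, G.mem_bd, hadj]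

lemma exitMean_of_bd (hadj : ∀ x y, adj x y ↔ y ∈ G.nbr x)
    {x : V} (hx : x ∈ G.bd A) (F : V → ℝ) : G.exitMean adj A F x = F x := by
  have hx' : x ∈ bdryA adj A := (G.mem_bdryA hadj).2 hx
  unfold exitMean
  simp only [hitMA_of_mem hx', ite_mul, one_mul, zero_mul, Finset.sum_ite_eq, hx, if_true]

lemma lap_exitMean (hadj : ∀ x y, adj x y ↔ y ∈ G.nbr x)
    {x : V} (hx : x ∈ A) (F : V → ℝ) : G.lap (G.exitMean adj A F) x = 0 := by
  have hx' : x ∉ bdryA adj A := fun h => h.1 hx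
  have h : G.lap (G.exitMean adj A F) x
      = ∑ y ∈ G.bd A, G.lap (fun x => hitMA adj (bdryA adj A) x y) x * F y := by
    unfold lap exitMean
    simp only [← Finset.sum_sub_distrib, Finset.sum_mul]
    rw [Finset.sum_comm]
    refine Finset.sum_congr rfl fun y _ => Finset.sum_congr rfl fun z _ => by ring
  rw [h]
  exact Finset.sum_eq_zero fun y _ => by rw [G.lap_hitMA hadj hx', zero_mul]

lemma le_of_lap_nonneg {f : V → ℝ} (hf : ∀ x ∈ A, 0 ≤ G.lap f x)
    (hb : ∀ x ∈ G.bd A, f x ≤ 0) {x : V} (hx : x ∈ A) : f x ≤ 0 := by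
  have := G.max_principle (A := A) (f := fun x => if x ∈ A ∨ x ∈ G.bd A then f x else 0)
    (fun x hx => by
      rw [G.lap_congr (g := f) (by simp [hx]) fun y hy => by simp [G.nbr_mem hx hy]]
      exact hf x hx)
    (fun x hx => by
      by_cases h : x ∈ G.bd A
      · simpa [h] using hb x h
      · simp [h, hx]) x
  simpa [hx] using this

lemma le_exitMean (hadj : ∀ x y, adj x y ↔ y ∈ G.nbr x)
    {f : V → ℝ} (hf : ∀ x ∈ A, 0 ≤ G.lap f x) {x : V} (hx : x ∈ A) :
    f x ≤ G.exitMean adj A f x := by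
  have := G.le_of_lap_nonneg (A := A) (f := fun x => f x - G.exitMean adj A f x)
    (fun x hx => by
      rw [lap_sub, G.lap_exitMean hadj hx]
      linarith [hf x hx])
    (fun x hx => by simp [G.exitMean_of_bd hadj hx]) hx
  linarith

lemma exitMean_const (hadj : ∀ x y, adj x y ↔ y ∈ G.nbr x)
    {x : V} (hx : x ∈ A) (c : ℝ) : G.exitMean adj A (fun _ => c) x = c := by
  have h1 := G.le_exitMean hadj (A := A) (f := fun _ => c) (fun x _ => by simp [lap]) hx
  have h2 := G.le_exitMean hadj (A := A) (f := fun _ => -c) (fun x _ => by simp [lap]) hx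
  have h3 : G.exitMean adj A (fun _ => -c) x = - G.exitMean adj A (fun _ => c) x := by
    simp [exitMean]
  linarith

lemma exitMean_mono (hadj : ∀ x y, adj x y ↔ y ∈ G.nbr x)
    {F F' : V → ℝ} (h : ∀ y ∈ G.bd A, F y ≤ F' y) (x : V) :
    G.exitMean adj A F x ≤ G.exitMean adj A F' x :=
  Finset.sum_le_sum fun y hy => mul_le_mul_of_nonneg_left (h y hy) (G.hitMA_nonneg hadj _ _ _)

lemma exitMean_add (F F' : V → ℝ) (x : V) :
    G.exitMean adj A (fun y => F y + F' y) x
      = G.exitMean adj A F x + G.exitMean adj A F' x := by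
  simp [exitMean, mul_add, Finset.sum_add_distrib]

lemma exitMean_const_mul (c : ℝ) (F : V → ℝ) (x : V) :
    G.exitMean adj A (fun y => c * F y) x = c * G.exitMean adj A F x := by
  simp only [exitMean, Finset.mul_sum]
  exact Finset.sum_congr rfl fun y _ => by ring

end Exit

/-- The probability of hitting `z` before leaving `A`, as a solution of the Dirichlet
problem. -/
lemma exists_potential {A : Finset V} {z : V} (hz : z ∈ A) :
    ∃ p : V → ℝ, p z = 1 ∧ (∀ x, x ∉ A → p x = 0) ∧ (∀ x ∈ A, x ≠ z → G.lap p x = 0) ∧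
      (∀ x, 0 ≤ p x) ∧ (∀ x, p x ≤ 1) := by
  let ext : (A → ℝ) →ₗ[ℝ] (V → ℝ) :=
    { toFun := fun q x => if h : x ∈ A then q ⟨x, h⟩ else 0
      map_add' := fun q r => by
        funext x; by_cases h : x ∈ A <;> simp [h]
      map_smul' := fun c q => by
        funext x; by_cases h : x ∈ A <;> simp [h] }
  let Λ : (A → ℝ) →ₗ[ℝ] (A → ℝ) :=
    { toFun := fun q x => G.lap (ext q) x
      map_add' := fun q r => by
        funext x
        simp only [map_add, lap, Pi.add_apply, ← Finset.sum_add_distrib]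
        exact Finset.sum_congr rfl fun y _ => by ring
      map_smul' := fun c q => by
        funext x
        simp only [map_smul, lap, Pi.smul_apply, smul_eq_mul, RingHom.id_apply, Finset.mul_sum]
        exact Finset.sum_congr rfl fun y _ => by ring }
  have hext : ∀ q x, x ∉ A → ext q x = 0 := fun q x hx => by simp [ext, hx]
  have hextA : ∀ q (x : A), ext q x = q x := fun q x => by simp [ext]
  have key : ∀ q, (∀ x ∈ A, 0 ≤ G.lap (ext q) x) → ∀ x, ext q x ≤ 0 := fun q hq x =>
    G.max_principle hq (fun x hx => (hext q x hx).le) x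
  have hneg : ∀ q x, G.lap (ext (-q)) x = - G.lap (ext q) x := fun q x => by
    simp only [map_neg, lap, Pi.neg_apply, ← Finset.sum_neg_distrib]
    exact Finset.sum_congr rfl fun y _ => by ring
  have hinj : Function.Injective Λ := by
    rw [← LinearMap.ker_eq_bot, LinearMap.ker_eq_bot']
    intro q hq
    have h0 : ∀ x ∈ A, G.lap (ext q) x = 0 := fun x hx => congrFun hq ⟨x, hx⟩
    funext x
    have h1 := key q (fun x hx => (h0 x hx).ge) x
    have h2 := key (-q) (fun x hx => by rw [hneg, h0 x hx, neg_zero]) x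
    rw [hextA] at h1 h2
    simp only [Pi.neg_apply] at h2
    simp only [Pi.zero_apply]
    linarith
  obtain ⟨q, hq⟩ := LinearMap.injective_iff_surjective.1 hinj
    (fun x => if x = ⟨z, hz⟩ then -1 else 0)
  have hq' : ∀ x (hx : x ∈ A), G.lap (ext q) x = if x = z then -1 else 0 := fun x hx => by
    have := congrFun hq ⟨x, hx⟩
    simpa [Λ] using this
  have hnn : ∀ x, 0 ≤ ext q x := fun x => by
    have := key (-q) (fun x hx => by rw [hneg, hq' x hx]; split_ifs <;> norm_num) x
    simp only [map_neg, Pi.neg_apply] at this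
    linarith
  have hzpos : 0 < ext q z := by
    refine lt_of_le_of_ne (hnn z) fun h => ?_
    have h1 := hq' z hz
    rw [if_pos rfl, lap_eq, ← h] at h1
    have := Finset.sum_nonneg fun y (_ : y ∈ G.nbr z) => hnn y
    linarith
  have hl : ∀ x, G.lap (fun x => ext q x / ext q z) x = G.lap (ext q) x / ext q z := fun x => by
    simp only [lap, Finset.sum_div]
    exact Finset.sum_congr rfl fun y _ => by ring
  refine ⟨fun x => ext q x / ext q z, div_self hzpos.ne', fun x hx => by simp [hext q x hx],
    fun x hx hxz => by rw [hl, hq' x hx, if_neg hxz, zero_div],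
    fun x => div_nonneg (hnn x) hzpos.le, fun x => ?_⟩
  have := G.max_principle (A := A.erase z) (f := fun x => ext q x / ext q z - 1)
    (fun x hx => by
      rw [lap_sub, hl, hq' x (Finset.mem_of_mem_erase hx), if_neg (Finset.ne_of_mem_erase hx)]
      simp [lap])
    (fun x hx => by
      by_cases h : x = z
      · simp [h, hzpos.ne']
      · have : x ∉ A := fun h' => hx (Finset.mem_erase.2 ⟨h, h'⟩)
        simp [hext q x this]) x
  linarith

end LeveledGraph

namespace Gasket

/-- `(a, b)` indexes the lower corner of a unit triangle of the one-sided gasket exactly when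
the binary expansions of `a` and `b` are disjoint. -/
def isBase (a b : ℕ) : Prop := a &&& b = 0

instance (a b : ℕ) : Decidable (isBase a b) := inferInstanceAs (Decidable (_ = _))

lemma isBase_iff_half (a b : ℕ) :
    isBase a b ↔ isBase (a / 2) (b / 2) ∧ ¬(a % 2 = 1 ∧ b % 2 = 1) := by
  unfold isBase
  have h1 : (a &&& b) / 2 = a / 2 &&& b / 2 := Nat.and_div_two
  have h2 : (a &&& b) % 2 = 1 ↔ a % 2 = 1 ∧ b % 2 = 1 := Nat.and_mod_two_eq_one
  rw [← h1, ← h2]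
  omega

lemma isBase_zero_left (b : ℕ) : isBase 0 b := by simp [isBase]

lemma isBase_zero_right (a : ℕ) : isBase a 0 := by simp [isBase]

lemma isBase_iff_top (k : ℕ) : ∀ {a b : ℕ}, a + b < 2 ^ (k + 1) →
    (isBase a b ↔ (a + b < 2 ^ k ∧ isBase a b) ∨ (2 ^ k ≤ a ∧ isBase (a - 2 ^ k) b) ∨
      (2 ^ k ≤ b ∧ isBase a (b - 2 ^ k))) := by
  induction k with
  | zero =>
    intro a b h
    have ha : a < 2 := by simp at h; omega
    have hb : b < 2 := by simp at h; omega
    interval_cases a <;> interval_cases b <;> simp_all <;> decide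
  | succ k ih =>
    intro a b h
    have hp : 2 ^ (k + 1) = 2 * 2 ^ k := by ring
    have hp' : 2 ^ (k + 1 + 1) = 4 * 2 ^ k := by ring
    have h' : a / 2 + b / 2 < 2 ^ (k + 1) := by omega
    have := ih h'
    rw [isBase_iff_half a b, isBase_iff_half (a - _) b, isBase_iff_half a (b - _)]
    rw [hp] at *
    generalize 2 ^ k = p at *
    have e1 : (a - 2 * p) / 2 = a / 2 - p := by omega
    have e2 : (b - 2 * p) / 2 = b / 2 - p := by omega
    rw [e1, e2]
    have f1 : p ≤ a / 2 ↔ 2 * p ≤ a := by omega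
    have f2 : p ≤ b / 2 ↔ 2 * p ≤ b := by omega
    have f3 : 2 * p ≤ a → (a - 2 * p) % 2 = a % 2 := by omega
    have f4 : 2 * p ≤ b → (b - 2 * p) % 2 = b % 2 := by omega
    have f5 : ¬(a % 2 = 1 ∧ b % 2 = 1) → (a / 2 + b / 2 < p ↔ a + b < 2 * p) := by omega
    rw [f1, f2] at this
    clear ih e1 e2 f1 f2 hp hp' h h'
    constructor
    · rintro ⟨hb, hnot⟩
      rcases this.1 hb with h | h | h
      · exact Or.inl ⟨(f5 hnot).1 h.1, hb, hnot⟩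
      · exact Or.inr (Or.inl ⟨h.1, h.2, by rwa [f3 h.1]⟩)
      · exact Or.inr (Or.inr ⟨h.1, h.2, by rwa [f4 h.1]⟩)
    · rintro (h | h | h)
      · exact h.2
      · exact ⟨this.2 (Or.inr (Or.inl ⟨h.1, h.2.1⟩)), by rw [← f3 h.1]; exact h.2.2⟩
      · exact ⟨this.2 (Or.inr (Or.inr ⟨h.1, h.2.1⟩)), by rw [← f4 h.1]; exact h.2.2⟩

/-- `(a, b)` is a vertex of the one-sided gasket. -/
def isVert (a b : ℕ) : Prop :=
  isBase a b ∨ (1 ≤ a ∧ isBase (a - 1) b) ∨ (1 ≤ b ∧ isBase a (b - 1))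

/-- Every vertex other than the origin is a corner of exactly two triangles. -/
lemma incidence : ∀ {a b : ℕ}, a + b ≠ 0 → isVert a b →
    (isBase a b ∧ (1 ≤ a ∧ isBase (a - 1) b) ∧ ¬(1 ≤ b ∧ isBase a (b - 1))) ∨
    (isBase a b ∧ ¬(1 ≤ a ∧ isBase (a - 1) b) ∧ (1 ≤ b ∧ isBase a (b - 1))) ∨
    (¬isBase a b ∧ (1 ≤ a ∧ isBase (a - 1) b) ∧ (1 ≤ b ∧ isBase a (b - 1))) := by
  suffices H : ∀ n a b : ℕ, a + b = n → a + b ≠ 0 → isVert a b →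
    (isBase a b ∧ (1 ≤ a ∧ isBase (a - 1) b) ∧ ¬(1 ≤ b ∧ isBase a (b - 1))) ∨
    (isBase a b ∧ ¬(1 ≤ a ∧ isBase (a - 1) b) ∧ (1 ≤ b ∧ isBase a (b - 1))) ∨
    (¬isBase a b ∧ (1 ≤ a ∧ isBase (a - 1) b) ∧ (1 ≤ b ∧ isBase a (b - 1))) from
    fun {a b} h h' => H _ a b rfl h h'
  intro n
  induction n using Nat.strong_induction_on with
  | _ n ih =>
    intro a b hn h0 hv
    obtain ha | ha := Nat.mod_two_eq_zero_or_one a <;>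
    obtain hb | hb := Nat.mod_two_eq_zero_or_one b
    · have := ih (a / 2 + b / 2) (by omega) (a / 2) (b / 2) rfl (by omega)
      have k0 : isBase a b ↔ isBase (a / 2) (b / 2) := by
        rw [isBase_iff_half]; exact and_iff_left (by omega)
      have k1 : (1 ≤ a ∧ isBase (a - 1) b) ↔ (1 ≤ a / 2 ∧ isBase (a / 2 - 1) (b / 2)) := by
        rw [isBase_iff_half, show (a - 1) / 2 = a / 2 - 1 by omega]
        exact ⟨fun h => ⟨by omega, h.2.1⟩, fun h => ⟨by omega, h.2, by omega⟩⟩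
      have k2 : (1 ≤ b ∧ isBase a (b - 1)) ↔ (1 ≤ b / 2 ∧ isBase (a / 2) (b / 2 - 1)) := by
        rw [isBase_iff_half, show (b - 1) / 2 = b / 2 - 1 by omega]
        exact ⟨fun h => ⟨by omega, h.2.1⟩, fun h => ⟨by omega, h.2, by omega⟩⟩
      unfold isVert at *
      rw [k0, k1, k2] at hv ⊢
      exact this hv
    · have k0 : isBase a b ↔ isBase (a / 2) (b / 2) := by
        rw [isBase_iff_half]; exact and_iff_left (by omega)
      have k1 : ¬(1 ≤ a ∧ isBase (a - 1) b) := by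
        rw [isBase_iff_half]; omega
      have k2 : (1 ≤ b ∧ isBase a (b - 1)) ↔ isBase (a / 2) (b / 2) := by
        rw [isBase_iff_half, show (b - 1) / 2 = b / 2 by omega]
        exact ⟨fun h => h.2.1, fun h => ⟨by omega, h, by omega⟩⟩
      unfold isVert at hv
      tauto
    · have k0 : isBase a b ↔ isBase (a / 2) (b / 2) := by
        rw [isBase_iff_half]; exact and_iff_left (by omega)
      have k1 : ¬(1 ≤ b ∧ isBase a (b - 1)) := by
        rw [isBase_iff_half]; omega
      have k2 : (1 ≤ a ∧ isBase (a - 1) b) ↔ isBase (a / 2) (b / 2) := by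
        rw [isBase_iff_half, show (a - 1) / 2 = a / 2 by omega]
        exact ⟨fun h => h.2.1, fun h => ⟨by omega, h, by omega⟩⟩
      unfold isVert at hv
      tauto
    · have k0 : ¬ isBase a b := by
        rw [isBase_iff_half]; omega
      have k1 : (1 ≤ b ∧ isBase a (b - 1)) ↔ isBase (a / 2) (b / 2) := by
        rw [isBase_iff_half, show (b - 1) / 2 = b / 2 by omega]
        exact ⟨fun h => h.2.1, fun h => ⟨by omega, h, by omega⟩⟩
      have k2 : (1 ≤ a ∧ isBase (a - 1) b) ↔ isBase (a / 2) (b / 2) := by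
        rw [isBase_iff_half, show (a - 1) / 2 = a / 2 by omega]
        exact ⟨fun h => h.2.1, fun h => ⟨by omega, h, by omega⟩⟩
      unfold isVert at hv
      tauto

/-- The triangles whose lower corner has level less than `m`. -/
def tset (m : ℕ) : Finset (ℕ × ℕ) :=
  (Finset.range m ×ˢ Finset.range m).filter fun t => isBase t.1 t.2 ∧ t.1 + t.2 < m

lemma mem_tset {m : ℕ} {t : ℕ × ℕ} : t ∈ tset m ↔ isBase t.1 t.2 ∧ t.1 + t.2 < m := by
  simp only [tset, Finset.mem_filter, Finset.mem_product, Finset.mem_range]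
  constructor
  · exact fun h => h.2
  · exact fun h => ⟨by omega, h⟩

lemma tset_mono {m n : ℕ} (h : m ≤ n) : tset m ⊆ tset n := fun t ht => by
  rw [mem_tset] at *
  exact ⟨ht.1, by omega⟩

lemma tset_one : tset 1 = {(0, 0)} := by decide

lemma sum_tset {M : Type*} [AddCommMonoid M] {k m : ℕ} (h1 : 2 ^ k ≤ m) (h2 : m ≤ 2 ^ (k + 1))
    (F : ℕ × ℕ → M) :
    ∑ t ∈ tset m, F t = ∑ t ∈ tset (2 ^ k), F t
      + ∑ t ∈ tset (m - 2 ^ k), F (t.1 + 2 ^ k, t.2)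
      + ∑ t ∈ tset (m - 2 ^ k), F (t.1, t.2 + 2 ^ k) := by
  have hp : 2 ^ (k + 1) = 2 * 2 ^ k := by ring
  have hset : tset m = tset (2 ^ k)
      ∪ (tset (m - 2 ^ k)).image (fun t => (t.1 + 2 ^ k, t.2))
      ∪ (tset (m - 2 ^ k)).image (fun t => (t.1, t.2 + 2 ^ k)) := by
    ext ⟨a, b⟩
    simp only [Finset.mem_union, Finset.mem_image, mem_tset, Prod.mk.injEq, Prod.exists]
    constructor
    · rintro ⟨hb, hl⟩
      rcases (isBase_iff_top k (by omega)).1 hb with h | h | h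
      · exact Or.inl (Or.inl ⟨h.2, h.1⟩)
      · exact Or.inl (Or.inr ⟨a - 2 ^ k, b, ⟨h.2, by omega⟩, by omega, rfl⟩)
      · exact Or.inr ⟨a, b - 2 ^ k, ⟨h.2, by omega⟩, rfl, by omega⟩
    · rintro ((h | ⟨c, d, h, rfl, rfl⟩) | ⟨c, d, h, rfl, rfl⟩)
      · exact ⟨h.1, by omega⟩
      · refine ⟨(isBase_iff_top k (by omega)).2 (Or.inr (Or.inl ?_)), by omega⟩
        simpa using h.1
      · refine ⟨(isBase_iff_top k (by omega)).2 (Or.inr (Or.inr ?_)), by omega⟩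
        simpa using h.1
  rw [hset, Finset.sum_union, Finset.sum_union, Finset.sum_image, Finset.sum_image]
  · rintro ⟨a, b⟩ _ ⟨c, d⟩ _ h
    simpa using h
  · rintro ⟨a, b⟩ _ ⟨c, d⟩ _ h
    simpa using h
  · rw [Finset.disjoint_left]
    rintro ⟨a, b⟩ h h'
    simp only [Finset.mem_image, mem_tset, Prod.mk.injEq, Prod.exists] at h h'
    obtain ⟨c, d, _, rfl, rfl⟩ := h'
    omega
  · rw [Finset.disjoint_left]
    rintro ⟨a, b⟩ h h'
    simp only [Finset.mem_union, Finset.mem_image, mem_tset, Prod.mk.injEq, Prod.exists] at h h'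
    obtain ⟨c, d, hcd, rfl, rfl⟩ := h'
    rcases h with h | ⟨c', d', h, rfl, h'⟩
    · omega
    · omega

lemma card_tset_two_pow (k : ℕ) : (tset (2 ^ k)).card = 3 ^ k := by
  induction k with
  | zero => decide
  | succ k ih =>
    have hp : 2 ^ (k + 1) = 2 * 2 ^ k := by ring
    have := sum_tset (k := k) (m := 2 ^ (k + 1)) (by omega) le_rfl (fun _ => 1)
    simp only [Finset.sum_const, smul_eq_mul, mul_one] at this
    rw [this, show 2 ^ (k + 1) - 2 ^ k = 2 ^ k by omega, ih]
    ring

/-- The bilinear energy form of a triangle with prescribed corner values. -/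
def triForm (α β γ α' β' γ' : ℝ) : ℝ :=
  (α - β) * (α' - β') + (α - γ) * (α' - γ') + (β - γ) * (β' - γ')

/-- The energy form of the triangles of level less than `m`. -/
def energy (m : ℕ) (f g : ℕ → ℕ → ℝ) : ℝ :=
  ∑ t ∈ tset m, triForm (f t.1 t.2) (f (t.1 + 1) t.2) (f t.1 (t.2 + 1))
    (g t.1 t.2) (g (t.1 + 1) t.2) (g t.1 (t.2 + 1))

/-- Integration against half the number of triangles at a vertex. -/
noncomputable def mass (m : ℕ) (g : ℕ → ℕ → ℝ) : ℝ :=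
  ∑ t ∈ tset m, (g t.1 t.2 + g (t.1 + 1) t.2 + g t.1 (t.2 + 1)) / 2

/-- Translation by `2 ^ k` in the first coordinate. -/
def shl (k : ℕ) (g : ℕ → ℕ → ℝ) : ℕ → ℕ → ℝ := fun a b => g (a + 2 ^ k) b

/-- Translation by `2 ^ k` in the second coordinate. -/
def shr (k : ℕ) (g : ℕ → ℕ → ℝ) : ℕ → ℕ → ℝ := fun a b => g a (b + 2 ^ k)

/-- The function given by `f₀`, `f₁`, `f₂` on the three parts of a cell of side `2 ^ (k + 1)`. -/
def glue (k : ℕ) (f₀ f₁ f₂ : ℕ → ℕ → ℝ) : ℕ → ℕ → ℝ := fun a b =>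
  if 2 ^ k ≤ a then f₁ (a - 2 ^ k) b else if 2 ^ k ≤ b then f₂ a (b - 2 ^ k) else f₀ a b

lemma energy_congr {m : ℕ} {f f' g g' : ℕ → ℕ → ℝ} (h : ∀ a b, a + b ≤ m → f a b = f' a b)
    (h' : ∀ a b, a + b ≤ m → g a b = g' a b) :
    energy m f g = energy m f' g' := by
  refine Finset.sum_congr rfl fun t ht => ?_
  rw [mem_tset] at ht
  rw [h _ _ (by omega), h _ _ (by omega), h _ _ (by omega), h' _ _ (by omega), h' _ _ (by omega),
    h' _ _ (by omega)]

lemma energy_add (m : ℕ) (f f' g : ℕ → ℕ → ℝ) :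
    energy m (f + f') g = energy m f g + energy m f' g := by
  unfold energy
  rw [← Finset.sum_add_distrib]
  exact Finset.sum_congr rfl fun t _ => by simp only [triForm, Pi.add_apply]; ring

lemma energy_smul (m : ℕ) (c : ℝ) (f g : ℕ → ℕ → ℝ) :
    energy m (c • f) g = c * energy m f g := by
  unfold energy
  rw [Finset.mul_sum]
  exact Finset.sum_congr rfl fun t _ => by
    simp only [triForm, Pi.smul_apply, smul_eq_mul]; ring

lemma energy_const (m : ℕ) (c : ℝ) (g : ℕ → ℕ → ℝ) : energy m (fun _ _ => c) g = 0 := by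
  simp [energy, triForm]

lemma energy_nonneg (m : ℕ) (f : ℕ → ℕ → ℝ) : 0 ≤ energy m f f :=
  Finset.sum_nonneg fun t _ => by
    unfold triForm
    nlinarith [sq_nonneg (f t.1 t.2 - f (t.1 + 1) t.2), sq_nonneg (f t.1 t.2 - f t.1 (t.2 + 1)),
      sq_nonneg (f (t.1 + 1) t.2 - f t.1 (t.2 + 1))]

lemma energy_split {k m : ℕ} (h1 : 2 ^ k ≤ m) (h2 : m ≤ 2 ^ (k + 1)) (f g : ℕ → ℕ → ℝ) :
    energy m f g = energy (2 ^ k) f g + energy (m - 2 ^ k) (shl k f) (shl k g)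
      + energy (m - 2 ^ k) (shr k f) (shr k g) := by
  unfold energy
  rw [sum_tset h1 h2]
  simp only [shl, shr, fun x : ℕ => add_right_comm x 1 (2 ^ k)]

lemma mass_split {k m : ℕ} (h1 : 2 ^ k ≤ m) (h2 : m ≤ 2 ^ (k + 1)) (g : ℕ → ℕ → ℝ) :
    mass m g = mass (2 ^ k) g + mass (m - 2 ^ k) (shl k g) + mass (m - 2 ^ k) (shr k g) := by
  unfold mass
  rw [sum_tset h1 h2]
  simp only [shl, shr, fun x : ℕ => add_right_comm x 1 (2 ^ k)]

lemma energy_glue {k m : ℕ} (h1 : 2 ^ k ≤ m) (h2 : m ≤ 2 ^ (k + 1)) {f₀ f₁ f₂ : ℕ → ℕ → ℝ}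
    (h01 : f₀ (2 ^ k) 0 = f₁ 0 0) (h02 : f₀ 0 (2 ^ k) = f₂ 0 0)
    (h12 : f₁ 0 (2 ^ k) = f₂ (2 ^ k) 0) (g : ℕ → ℕ → ℝ) :
    energy m (glue k f₀ f₁ f₂) g = energy (2 ^ k) f₀ g + energy (m - 2 ^ k) f₁ (shl k g)
      + energy (m - 2 ^ k) f₂ (shr k g) := by
  have hp : 2 ^ (k + 1) = 2 * 2 ^ k := by ring
  rw [energy_split h1 h2]
  congr 1
  · congr 1
    · refine energy_congr (fun a b hab => ?_) fun _ _ _ => rfl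
      unfold glue
      split_ifs with ha hb
      · obtain rfl : a = 2 ^ k := by omega
        obtain rfl : b = 0 := by omega
        simp [h01]
      · obtain rfl : b = 2 ^ k := by omega
        obtain rfl : a = 0 := by omega
        simp [h02]
      · rfl
    · refine energy_congr (fun a b hab => ?_) fun _ _ _ => rfl
      simp [shl, glue]
  · refine energy_congr (fun a b hab => ?_) fun _ _ _ => rfl
    unfold shr glue
    split_ifs with ha hb
    · obtain rfl : a = 2 ^ k := by omega
      obtain rfl : b = 0 := by omega
      simp [h12]
    · simp
    · omega

/-- The harmonic function on the cell of side `2 ^ k` with prescribed corner values. -/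
noncomputable def harm : ℕ → ℝ → ℝ → ℝ → ℕ → ℕ → ℝ
  | 0, α, β, γ => fun a b => if 1 ≤ a then β else if 1 ≤ b then γ else α
  | k + 1, α, β, γ => glue k
      (harm k α ((2 * α + 2 * β + γ) / 5) ((2 * α + 2 * γ + β) / 5))
      (harm k ((2 * α + 2 * β + γ) / 5) β ((2 * β + 2 * γ + α) / 5))
      (harm k ((2 * α + 2 * γ + β) / 5) ((2 * β + 2 * γ + α) / 5) γ)

lemma harm_corner (k : ℕ) : ∀ α β γ : ℝ,
    harm k α β γ 0 0 = α ∧ harm k α β γ (2 ^ k) 0 = β ∧ harm k α β γ 0 (2 ^ k) = γ := by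
  induction k with
  | zero => simp [harm]
  | succ k ih =>
    intro α β γ
    have hp : 2 ^ (k + 1) = 2 ^ k + 2 ^ k := by ring
    simp [harm, glue, hp, ih]

lemma harm_ge (k : ℕ) : ∀ {α β γ c : ℝ}, c ≤ α → c ≤ β → c ≤ γ → ∀ a b,
    c ≤ harm k α β γ a b := by
  induction k with
  | zero => intro α β γ c h1 h2 h3 a b; unfold harm; split_ifs <;> assumption
  | succ k ih =>
    intro α β γ c h1 h2 h3 a b
    unfold harm glue
    split_ifs
    · apply ih <;> linarith
    · apply ih <;> linarith
    · apply ih <;> linarith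

lemma energy_harm (k : ℕ) : ∀ (α β γ : ℝ) (g : ℕ → ℕ → ℝ), energy (2 ^ k) (harm k α β γ) g
    = (3 / 5) ^ k * triForm α β γ (g 0 0) (g (2 ^ k) 0) (g 0 (2 ^ k)) := by
  induction k with
  | zero => intro α β γ g; simp [energy, tset_one, harm]
  | succ k ih =>
    intro α β γ g
    have hp : 2 ^ (k + 1) = 2 ^ k + 2 ^ k := by ring
    have hle : 2 ^ k ≤ 2 ^ (k + 1) := hp ▸ Nat.le_add_right _ _
    rw [harm, energy_glue hle le_rfl, show 2 ^ (k + 1) - 2 ^ k = 2 ^ k from hp ▸ Nat.add_sub_cancel _ _,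
      ih, ih, ih, hp]
    · simp only [triForm, shl, shr, zero_add]
      ring
    all_goals simp [harm_corner]

lemma harm_near_corner {i k : ℕ} (hik : i ≤ k) : ∀ {β γ : ℝ}, β ≤ 1 → γ ≤ 1 → β = γ →
    ∀ a b, a + b ≤ 2 ^ i → 1 - (3 / 5) ^ (k - i) * (1 - β) ≤ harm k 1 β γ a b := by
  induction k with
  | zero =>
    rintro β γ hβ hγ rfl a b -
    obtain rfl : i = 0 := by omega
    simpa using harm_ge 0 (α := 1) (β := β) (γ := β) (c := β) hβ le_rfl le_rfl a b
  | succ k ih =>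
    rintro β γ hβ hγ rfl a b hab
    obtain rfl | hlt := Nat.eq_or_lt_of_le hik
    · simpa using harm_ge (k + 1) (α := 1) (β := β) (γ := β) (c := β) hβ le_rfl le_rfl a b
    have hi : i ≤ k := by omega
    have hp : 2 ^ i ≤ 2 ^ k := Nat.pow_le_pow_right (by norm_num) hi
    set δ := (2 * 1 + 2 * β + β) / 5 with hδ
    have key := ih hi (β := δ) (γ := δ) (by linarith) (by linarith) rfl a b hab
    have e : 1 - (3 / 5) ^ (k + 1 - i) * (1 - β) = 1 - (3 / 5) ^ (k - i) * (1 - δ) := by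
      rw [show k + 1 - i = (k - i) + 1 by omega, pow_succ, hδ]; ring
    rw [e]
    unfold harm glue
    rw [← hδ]
    have hδ1 : 1 - (3 / 5) ^ (k - i) * (1 - δ) ≤ 1 := by
      have : 0 ≤ (3 / 5 : ℝ) ^ (k - i) * (1 - δ) := by
        apply mul_nonneg (by positivity); linarith
      linarith
    split_ifs with ha hb
    · obtain rfl : a = 2 ^ k := by omega
      obtain rfl : b = 0 := by omega
      simpa [harm_corner] using (by simpa [harm_corner] using key : _)
    · obtain rfl : b = 2 ^ k := by omega
      obtain rfl : a = 0 := by omega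
      simpa [harm_corner] using (by simpa [harm_corner] using key : _)
    · exact key

lemma two_pow_succ' (k : ℕ) : 2 ^ (k + 1) = 2 ^ k + 2 ^ k := by ring

lemma two_pow_succ_sub (k : ℕ) : 2 ^ (k + 1) - 2 ^ k = 2 ^ k := by
  rw [two_pow_succ']; exact Nat.add_sub_cancel _ _

lemma two_pow_le_succ (k : ℕ) : 2 ^ k ≤ 2 ^ (k + 1) := by
  rw [two_pow_succ']; exact Nat.le_add_right _ _

/-- A function whose energy against `g` is `λ g(0)` minus the integral of `g`, on a cell. -/
lemma exists_green_cell (k : ℕ) : ∃ w : ℕ → ℕ → ℝ,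
    (∀ g, energy (2 ^ k) w g = 3 ^ (k + 1) / 2 * g 0 0 - mass (2 ^ k) g) ∧
    (∀ a b, 0 ≤ w a b) ∧ w 0 0 = 5 ^ k / 2 ∧ (∀ a b, 2 ^ k ≤ a + b → w a b = 0) ∧
    ∀ i a b, a + b + 2 ^ i ≤ 2 ^ k → 5 ^ i / 2 ≤ w a b := by
  induction k with
  | zero =>
    refine ⟨harm 0 (1 / 2) 0 0, fun g => ?_, ?_, ?_, ?_, ?_⟩
    · have := energy_harm 0 (1 / 2) 0 0 g
      rw [this]
      simp [triForm, mass, tset_one]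
      ring
    · exact harm_ge 0 (by norm_num) le_rfl le_rfl
    · simp [harm]
    · intro a b h
      simp only [harm]
      split_ifs
      · rfl
      · rfl
      · simp at h; omega
    · intro i a b h
      have : 1 ≤ 2 ^ i := Nat.one_le_two_pow
      have h1 : a + b + 2 ^ i ≤ 1 := by simpa using h
      obtain rfl : a = 0 := by omega
      obtain rfl : b = 0 := by omega
      have : i = 0 := by
        by_contra hi
        have : 2 ^ 1 ≤ 2 ^ i := Nat.pow_le_pow_right (by norm_num) (by omega)
        omega
      subst this
      simp [harm]
  | succ k ih =>
    obtain ⟨w, hE, hnn, h0, hz, hlow⟩ := ih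
    set f₀ : ℕ → ℕ → ℝ := (fun _ _ => 5 ^ k / 2) + w
      + ((3 : ℝ) ^ (k + 1) / 2) • harm k ((5 / 3) ^ k) 0 0 with hf
    have hh : ∀ a b, 0 ≤ harm k ((5 / 3) ^ k) 0 0 a b :=
      harm_ge k (by positivity) le_rfl le_rfl
    have hf₀ : ∀ a b, 5 ^ k / 2 ≤ f₀ a b := fun a b => by
      have h1 := hnn a b
      have h2 := hh a b
      have h3 : 0 ≤ (3 : ℝ) ^ (k + 1) / 2 * harm k ((5 / 3) ^ k) 0 0 a b := by positivity
      simp only [hf, Pi.add_apply, Pi.smul_apply, smul_eq_mul]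
      linarith
    have e35 : (3 / 5 : ℝ) ^ k * (5 / 3) ^ k = 1 := by rw [← mul_pow]; norm_num
    have hp := two_pow_succ' k
    refine ⟨glue k f₀ w w, fun g => ?_, ?_, ?_, ?_, ?_⟩
    · rw [energy_glue (two_pow_le_succ k) le_rfl, two_pow_succ_sub, hE, hE,
        mass_split (two_pow_le_succ k) le_rfl, two_pow_succ_sub, hf, energy_add, energy_add,
        energy_smul, energy_const, energy_harm, hE]
      · simp only [shl, shr, triForm, zero_add]
        linear_combination (3 ^ (k + 1) / 2 * (2 * g 0 0 - g (2 ^ k) 0 - g 0 (2 ^ k))) * e35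
      · simp [hf, harm_corner, h0, hz]
      · simp [hf, harm_corner, h0, hz]
      · rw [hz _ _ (by simp), hz _ _ (by simp)]
    · intro a b
      unfold glue
      split_ifs
      · exact hnn _ _
      · exact hnn _ _
      · exact le_trans (by positivity) (hf₀ _ _)
    · simp [glue, hf, harm_corner, h0]
      rw [div_pow, pow_succ, pow_succ]
      field_simp
      ring
    · intro a b hab
      unfold glue
      split_ifs
      · exact hz _ _ (by omega)
      · exact hz _ _ (by omega)
      · omega
    · intro i a b hab
      by_cases hi : i ≤ k
      · unfold glue
        split_ifs
        · exact hlow _ _ _ (by omega)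
        · exact hlow _ _ _ (by omega)
        · refine le_trans ?_ (hf₀ a b)
          gcongr
          norm_num
      · have h1 : 2 ^ (k + 1) ≤ 2 ^ i := Nat.pow_le_pow_right (by norm_num) (by omega)
        have h2 : ¬ k + 1 < i := fun h => by
          have : 2 ^ (k + 1) < 2 ^ i := Nat.pow_lt_pow_right (by norm_num) h
          omega
        obtain rfl : i = k + 1 := by omega
        obtain rfl : a = 0 := by omega
        obtain rfl : b = 0 := by omega
        refine le_of_eq ?_
        simp [glue, hf, harm_corner, h0]
        rw [div_pow, pow_succ, pow_succ]
        field_simp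
        ring

/-- A function whose energy against `g` is `λ g(0)` minus the integral of `g`, on a ball. -/
lemma exists_green_ball (m : ℕ) : ∃ U : ℕ → ℕ → ℝ,
    (∀ g, energy m U g = 3 / 2 * (tset m).card * g 0 0 - mass m g) ∧
    (∀ a b, 0 ≤ U a b) ∧ (∀ i, 2 ^ i ≤ m → 5 ^ i / 2 ≤ U 0 0) ∧
    (∀ a b, m ≤ a + b → U a b = 0) ∧
    ∀ i a b, a + b + 2 ^ (i + 1) ≤ m → 5 ^ i / 2 ≤ U a b := by
  induction m using Nat.strong_induction_on with
  | _ m ih =>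
    obtain rfl | hm := Nat.eq_zero_or_pos m
    · refine ⟨0, fun g => ?_, by simp, fun i h => ?_, by simp, fun i a b h => ?_⟩
      · simp [energy, mass, show tset 0 = ∅ by decide]
      · have := Nat.one_le_two_pow (n := i); omega
      · have := Nat.one_le_two_pow (n := i + 1); omega
    obtain ⟨k, hk1, hk2⟩ : ∃ k, 2 ^ k ≤ m ∧ m < 2 ^ (k + 1) :=
      ⟨Nat.log 2 m, Nat.pow_log_le_self 2 hm.ne', Nat.lt_pow_succ_log_self (by norm_num) m⟩
    have hp := two_pow_succ' k
    have hpos : 0 < 2 ^ k := by positivity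
    obtain ⟨U, hE, hnn, h0, hz, hlow⟩ := ih (m - 2 ^ k) (by omega)
    obtain ⟨w, wE, wnn, w0, wz, wlow⟩ := exists_green_cell k
    set l : ℝ := 3 / 2 * (tset (m - 2 ^ k)).card with hl
    have hl0 : 0 ≤ l := by positivity
    set f₀ : ℕ → ℕ → ℝ := (fun _ _ => U 0 0) + w + l • harm k ((5 / 3) ^ k) 0 0 with hf
    have hh : ∀ a b, 0 ≤ harm k ((5 / 3) ^ k) 0 0 a b :=
      harm_ge k (by positivity) le_rfl le_rfl
    have hf₀ : ∀ a b, U 0 0 + w a b ≤ f₀ a b := fun a b => by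
      have h3 := mul_nonneg hl0 (hh a b)
      simp only [hf, Pi.add_apply, Pi.smul_apply, smul_eq_mul]
      linarith
    have e35 : (3 / 5 : ℝ) ^ k * (5 / 3) ^ k = 1 := by rw [← mul_pow]; norm_num
    have hcard : ((tset m).card : ℝ) = 3 ^ k + 2 * (tset (m - 2 ^ k)).card := by
      have := sum_tset hk1 hk2.le (fun _ => 1)
      simp only [Finset.sum_const, smul_eq_mul, mul_one] at this
      rw [this, card_tset_two_pow]
      push_cast; ring
    have hik : ∀ i, 2 ^ i ≤ m → i ≤ k := fun i hi => by
      by_contra h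
      have : 2 ^ (k + 1) ≤ 2 ^ i := Nat.pow_le_pow_right (by norm_num) (by omega)
      omega
    refine ⟨fun a b => if m ≤ a + b then 0 else glue k f₀ U U a b, fun g => ?_, ?_, ?_, ?_, ?_⟩
    · rw [energy_split hk1 hk2.le, mass_split hk1 hk2.le]
      have E0 : energy (2 ^ k) (fun a b => if m ≤ a + b then 0 else glue k f₀ U U a b) g
          = energy (2 ^ k) f₀ g := by
        refine energy_congr (fun a b hab => ?_) fun _ _ _ => rfl
        by_cases hc : m ≤ a + b
        · have hm0 : m - 2 ^ k = 0 := by omega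
          have hU : U 0 0 = 0 := hz _ _ (by omega)
          have hl' : l = 0 := by rw [hl, hm0]; simp [show tset 0 = ∅ by decide]
          simp [hc, hf, hU, hl', wz a b (by omega)]
        · rw [if_neg hc]
          unfold glue
          split_ifs with ha hb
          · obtain rfl : a = 2 ^ k := by omega
            obtain rfl : b = 0 := by omega
            simp [hf, harm_corner, wz]
          · obtain rfl : b = 2 ^ k := by omega
            obtain rfl : a = 0 := by omega
            simp [hf, harm_corner, wz]
          · rfl
      have E1 : energy (m - 2 ^ k)
          (shl k fun a b => if m ≤ a + b then 0 else glue k f₀ U U a b) (shl k g)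
          = energy (m - 2 ^ k) U (shl k g) := by
        refine energy_congr (fun a b hab => ?_) fun _ _ _ => rfl
        simp only [shl, glue]
        split_ifs with h1 h2
        · exact (hz _ _ (by omega)).symm
        · simp
        · omega
        · omega
      have E2 : energy (m - 2 ^ k)
          (shr k fun a b => if m ≤ a + b then 0 else glue k f₀ U U a b) (shr k g)
          = energy (m - 2 ^ k) U (shr k g) := by
        refine energy_congr (fun a b hab => ?_) fun _ _ _ => rfl
        simp only [shr, glue]
        split_ifs with h1 h2
        · exact (hz _ _ (by omega)).symm
        · omega
        · simp
        · omega
      rw [E0, E1, E2, hE, hE, hf, energy_add, energy_add, energy_smul, energy_const, wE,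
        energy_harm, hcard]
      simp only [shl, shr, triForm, zero_add]
      linear_combination (l * (2 * g 0 0 - g (2 ^ k) 0 - g 0 (2 ^ k))) * e35
    · intro a b
      beta_reduce
      unfold glue
      split_ifs
      · exact le_rfl
      · exact hnn _ _
      · exact hnn _ _
      · exact le_trans (add_nonneg (hnn _ _) (wnn _ _)) (hf₀ _ _)
    · intro i hi
      beta_reduce
      have : ¬ m ≤ 0 + 0 := by omega
      have h2 : (5 : ℝ) ^ i ≤ 5 ^ k := pow_le_pow_right₀ (by norm_num) (hik i hi)
      rw [if_neg this]
      simp only [glue, nonpos_iff_eq_zero, hpos.ne', if_false]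
      linarith [hf₀ 0 0, hnn 0 0]
    · intro a b h
      simp [h]
    · intro i a b h
      beta_reduce
      have hpi : 2 ^ (i + 1) = 2 ^ i + 2 ^ i := two_pow_succ' i
      have hpi0 : 0 < 2 ^ i := by positivity
      have : ¬ m ≤ a + b := by omega
      rw [if_neg this]
      unfold glue
      split_ifs
      · exact hlow _ _ _ (by omega)
      · exact hlow _ _ _ (by omega)
      · by_cases hc : 2 ^ i ≤ m - 2 ^ k
        · linarith [hf₀ a b, wnn a b, h0 i hc]
        · linarith [hf₀ a b, hnn 0 0, wlow i a b (by omega)]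

lemma triForm_trace (A B C L R M : ℝ) : 3 / 5 * triForm A B C A B C ≤
    triForm A L R A L R + triForm L B M L B M + triForm R M C R M C := by
  unfold triForm
  nlinarith [sq_nonneg (5 * L - 2 * A - 2 * B - C), sq_nonneg (5 * R - 2 * A - 2 * C - B),
    sq_nonneg (5 * M - 2 * B - 2 * C - A),
    sq_nonneg ((5 * L - 2 * A - 2 * B - C) - (5 * R - 2 * A - 2 * C - B)),
    sq_nonneg ((5 * L - 2 * A - 2 * B - C) - (5 * M - 2 * B - 2 * C - A)),
    sq_nonneg ((5 * R - 2 * A - 2 * C - B) - (5 * M - 2 * B - 2 * C - A))]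

lemma triForm_corners_le (k : ℕ) : ∀ f : ℕ → ℕ → ℝ,
    (3 / 5) ^ k * triForm (f 0 0) (f (2 ^ k) 0) (f 0 (2 ^ k)) (f 0 0) (f (2 ^ k) 0) (f 0 (2 ^ k))
      ≤ energy (2 ^ k) f f := by
  induction k with
  | zero => intro f; simp [energy, tset_one]
  | succ k ih =>
    intro f
    have h0 := ih f
    have h1 := ih (shl k f)
    have h2 := ih (shr k f)
    simp only [shl, shr, zero_add, ← two_pow_succ'] at h1 h2
    rw [energy_split (two_pow_le_succ k) le_rfl, two_pow_succ_sub]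
    have h3 := mul_le_mul_of_nonneg_left (triForm_trace (f 0 0) (f (2 ^ (k + 1)) 0)
      (f 0 (2 ^ (k + 1))) (f (2 ^ k) 0) (f 0 (2 ^ k)) (f (2 ^ k) (2 ^ k)))
      (by positivity : (0 : ℝ) ≤ (3 / 5) ^ k)
    rw [pow_succ]
    unfold shl shr at *
    linarith

lemma tset_succ_cases {k : ℕ} {t : ℕ × ℕ} (ht : t ∈ tset (2 ^ (k + 1))) :
    t ∈ tset (2 ^ k) ∨ (∃ s ∈ tset (2 ^ k), t = (s.1 + 2 ^ k, s.2)) ∨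
      ∃ s ∈ tset (2 ^ k), t = (s.1, s.2 + 2 ^ k) := by
  obtain ⟨a, b⟩ := t
  have hp := two_pow_succ' k
  simp only [mem_tset] at ht ⊢
  rcases (isBase_iff_top k ht.2).1 ht.1 with h | h | h
  · exact Or.inl h.symm
  · exact Or.inr (Or.inl ⟨(a - 2 ^ k, b), ⟨h.2, by simp only; omega⟩, by
      simp only [Prod.mk.injEq, and_true]; omega⟩)
  · exact Or.inr (Or.inr ⟨(a, b - 2 ^ k), ⟨h.2, by simp only; omega⟩, by
      simp only [Prod.mk.injEq, true_and]; omega⟩)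

lemma sq_sub_corner_le (k : ℕ) (f : ℕ → ℕ → ℝ) :
    (3 / 5) ^ k * (f (2 ^ k) 0 - f 0 0) ^ 2 ≤ energy (2 ^ k) f f ∧
    (3 / 5) ^ k * (f 0 (2 ^ k) - f 0 0) ^ 2 ≤ energy (2 ^ k) f f := by
  have h := triForm_corners_le k f
  constructor <;> refine le_trans (mul_le_mul_of_nonneg_left ?_ (by positivity)) h <;>
  · unfold triForm
    nlinarith [sq_nonneg (f 0 0 - f (2 ^ k) 0), sq_nonneg (f 0 0 - f 0 (2 ^ k)),
      sq_nonneg (f (2 ^ k) 0 - f 0 (2 ^ k))]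

/-- Oscillation from a corner of a cell is controlled by the energy. -/
lemma sq_sub_le (k : ℕ) : ∀ (f : ℕ → ℕ → ℝ), ∀ t ∈ tset (2 ^ k),
    (3 / 5) ^ k * (f t.1 t.2 - f 0 0) ^ 2 ≤ 25 * energy (2 ^ k) f f ∧
    (3 / 5) ^ k * (f (t.1 + 1) t.2 - f 0 0) ^ 2 ≤ 25 * energy (2 ^ k) f f ∧
    (3 / 5) ^ k * (f t.1 (t.2 + 1) - f 0 0) ^ 2 ≤ 25 * energy (2 ^ k) f f := by
  induction k with
  | zero =>
    intro f t ht
    have h0 := energy_nonneg (2 ^ 0) f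
    have := sq_sub_corner_le 0 f
    simp only [pow_zero, tset_one, Finset.mem_singleton] at ht
    subst ht
    norm_num at this h0 ⊢
    exact ⟨h0, by linarith, by linarith⟩
  | succ k ih =>
    intro f t ht
    have n0 := energy_nonneg (2 ^ k) f
    have n1 := energy_nonneg (2 ^ k) (shl k f)
    have n2 := energy_nonneg (2 ^ k) (shr k f)
    have hc := sq_sub_corner_le k f
    have comb : ∀ x y z E0 E1 E2 : ℝ, 0 ≤ E0 → 0 ≤ E1 → 0 ≤ E2 →
        (3 / 5) ^ k * (x - y) ^ 2 ≤ 25 * E1 → (3 / 5) ^ k * (y - z) ^ 2 ≤ E0 →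
        (3 / 5) ^ (k + 1) * (x - z) ^ 2 ≤ 25 * (E0 + E1 + E2) := by
      intro x y z E0 E1 E2 p0 p1 p2 h1 h0
      have h3 : (x - z) ^ 2 ≤ 3 / 2 * (x - y) ^ 2 + 3 * (y - z) ^ 2 := by
        nlinarith [sq_nonneg ((x - y) - 2 * (y - z))]
      have h4 := mul_le_mul_of_nonneg_left h3 (by positivity : (0 : ℝ) ≤ (3 / 5) ^ k)
      rw [pow_succ]
      linarith
    have single : ∀ x z E0 E1 E2 : ℝ, 0 ≤ E0 → 0 ≤ E1 → 0 ≤ E2 →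
        (3 / 5) ^ k * (x - z) ^ 2 ≤ 25 * E0 →
        (3 / 5) ^ (k + 1) * (x - z) ^ 2 ≤ 25 * (E0 + E1 + E2) := by
      intro x z E0 E1 E2 p0 p1 p2 h1
      rw [pow_succ]
      linarith
    rw [energy_split (two_pow_le_succ k) le_rfl, two_pow_succ_sub]
    rcases tset_succ_cases ht with h | ⟨s, hs, rfl⟩ | ⟨s, hs, rfl⟩
    · obtain ⟨a1, a2, a3⟩ := ih f t h
      exact ⟨single _ _ _ _ _ n0 n1 n2 a1, single _ _ _ _ _ n0 n1 n2 a2,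
        single _ _ _ _ _ n0 n1 n2 a3⟩
    · obtain ⟨a1, a2, a3⟩ := ih (shl k f) s hs
      simp only [shl, zero_add] at a1 a2 a3
      simp only [add_right_comm s.1 (2 ^ k) 1]
      exact ⟨comb _ _ _ _ _ _ n0 n1 n2 a1 hc.1, comb _ _ _ _ _ _ n0 n1 n2 a2 hc.1,
        comb _ _ _ _ _ _ n0 n1 n2 a3 hc.1⟩
    · obtain ⟨a1, a2, a3⟩ := ih (shr k f) s hs
      simp only [shr, zero_add] at a1 a2 a3
      simp only [add_right_comm s.2 (2 ^ k) 1]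
      simp only [add_right_comm _ (energy (2 ^ k) (shl k f) (shl k f))]
      exact ⟨comb _ _ _ _ _ _ n0 n2 n1 a1 hc.2, comb _ _ _ _ _ _ n0 n2 n1 a2 hc.2,
        comb _ _ _ _ _ _ n0 n2 n1 a3 hc.2⟩

/-- A bump function on a cell of side `2 ^ (j + 1)` with peak at the midpoint of a side
through the lower corner. -/
noncomputable def bumpL (j : ℕ) : ℕ → ℕ → ℝ := glue j (harm j 0 1 0) (harm j 1 0 0) 0

/-- The mirror image of `bumpL`. -/
noncomputable def bumpR (j : ℕ) : ℕ → ℕ → ℝ := glue j (harm j 0 0 1) 0 (harm j 1 0 0)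

lemma energy_bumpL (j : ℕ) : energy (2 ^ (j + 1)) (bumpL j) (bumpL j) = 4 * (3 / 5) ^ j := by
  have hp := two_pow_succ' j
  nth_rw 1 [bumpL]
  rw [energy_glue (two_pow_le_succ j) le_rfl, two_pow_succ_sub, energy_harm, energy_harm]
  · simp [energy, triForm, bumpL, glue, shl, harm_corner]
    ring
  all_goals simp [harm_corner]

lemma energy_bumpR (j : ℕ) : energy (2 ^ (j + 1)) (bumpR j) (bumpR j) = 4 * (3 / 5) ^ j := by
  have hp := two_pow_succ' j
  nth_rw 1 [bumpR]
  rw [energy_glue (two_pow_le_succ j) le_rfl, two_pow_succ_sub, energy_harm, energy_harm]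
  · simp [energy, triForm, bumpR, glue, shr, harm_corner]
    ring
  all_goals simp [harm_corner]

lemma mem_tset_succ {k : ℕ} {t : ℕ × ℕ} : t ∈ tset (2 ^ (k + 1)) ↔
    t ∈ tset (2 ^ k) ∨ (∃ s ∈ tset (2 ^ k), t = (s.1 + 2 ^ k, s.2)) ∨
      ∃ s ∈ tset (2 ^ k), t = (s.1, s.2 + 2 ^ k) := by
  refine ⟨tset_succ_cases, ?_⟩
  have hp := two_pow_succ' k
  rintro (h | ⟨s, hs, rfl⟩ | ⟨s, hs, rfl⟩)
  · exact tset_mono (two_pow_le_succ k) h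
  · rw [mem_tset] at hs ⊢
    have hl : s.1 + 2 ^ k + s.2 < 2 ^ (k + 1) := by omega
    exact ⟨(isBase_iff_top k hl).2 (Or.inr (Or.inl (by simpa using hs.1))), hl⟩
  · rw [mem_tset] at hs ⊢
    have hl : s.1 + (s.2 + 2 ^ k) < 2 ^ (k + 1) := by omega
    exact ⟨(isBase_iff_top k hl).2 (Or.inr (Or.inr (by simpa using hs.1))), hl⟩

/-- The point of the plane with coordinates `(a, b)` in the basis of the triangular lattice. -/
noncomputable def emb (a b : ℕ) : ℝ × ℝ := (a + b / 2, b / 2 * Real.sqrt 3)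

lemma emb_add_left (a b c : ℕ) : emb (a + c) b = emb a b + ((c : ℝ), 0) := by
  simp [emb]; ring

lemma emb_add_right (a b c : ℕ) :
    emb a (b + c) = emb a b + ((c : ℝ) / 2, (c : ℝ) / 2 * Real.sqrt 3) := by
  simp [emb]; constructor <;> ring

/-- `p` is a corner of the triangle with lower corner `t`. -/
def isCorner (t : ℕ × ℕ) (p : ℝ × ℝ) : Prop :=
  p = emb t.1 t.2 ∨ p = emb (t.1 + 1) t.2 ∨ p = emb t.1 (t.2 + 1)

/-- `e` is an edge of the triangle with lower corner `t`. -/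
def isEdge (t : ℕ × ℕ) (e : (ℝ × ℝ) × (ℝ × ℝ)) : Prop :=
  e = (emb t.1 t.2, emb (t.1 + 1) t.2) ∨ e = (emb t.1 t.2, emb t.1 (t.2 + 1)) ∨
    e = (emb (t.1 + 1) t.2, emb t.1 (t.2 + 1))

lemma mem_gasketV (n : ℕ) : ∀ p, p ∈ gasketV n ↔ ∃ t ∈ tset (2 ^ n), isCorner t p := by
  induction n with
  | zero =>
    intro p
    simp [gasketV, tset_one, isCorner, emb]
    ring_nf
  | succ n ih =>
    intro p
    have e1 : ∀ t : ℕ × ℕ, isCorner (t.1 + 2 ^ n, t.2) p ↔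
        ∃ q, isCorner t q ∧ q + ((2 : ℝ) ^ n, 0) = p := by
      intro t
      simp only [isCorner, add_right_comm _ (2 ^ n) 1, emb_add_left _ _ (2 ^ n), Nat.cast_pow,
        Nat.cast_ofNat]
      constructor
      · rintro (h | h | h) <;> exact ⟨_, by tauto, h.symm⟩
      · rintro ⟨q, h | h | h, rfl⟩ <;> subst h <;> simp
    have e2 : ∀ t : ℕ × ℕ, isCorner (t.1, t.2 + 2 ^ n) p ↔
        ∃ q, isCorner t q ∧ q + ((2 : ℝ) ^ n / 2, (2 : ℝ) ^ n / 2 * Real.sqrt 3) = p := by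
      intro t
      simp only [isCorner, add_right_comm _ (2 ^ n) 1, emb_add_right _ _ (2 ^ n), Nat.cast_pow,
        Nat.cast_ofNat]
      constructor
      · rintro (h | h | h) <;> exact ⟨_, by tauto, h.symm⟩
      · rintro ⟨q, h | h | h, rfl⟩ <;> subst h <;> simp
    simp only [gasketV, Set.mem_union, Set.mem_image, ih, mem_tset_succ]
    constructor
    · rintro ((⟨t, ht, h⟩ | ⟨q, ⟨t, ht, h⟩, hq⟩) | ⟨q, ⟨t, ht, h⟩, hq⟩)
      · exact ⟨t, Or.inl ht, h⟩
      · exact ⟨_, Or.inr (Or.inl ⟨t, ht, rfl⟩), (e1 t).2 ⟨q, h, hq⟩⟩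
      · exact ⟨_, Or.inr (Or.inr ⟨t, ht, rfl⟩), (e2 t).2 ⟨q, h, hq⟩⟩
    · rintro ⟨_, ht | ⟨t, ht, rfl⟩ | ⟨t, ht, rfl⟩, h⟩
      · exact Or.inl (Or.inl ⟨_, ht, h⟩)
      · obtain ⟨q, h, hq⟩ := (e1 t).1 h
        exact Or.inl (Or.inr ⟨q, ⟨t, ht, h⟩, hq⟩)
      · obtain ⟨q, h, hq⟩ := (e2 t).1 h
        exact Or.inr ⟨q, ⟨t, ht, h⟩, hq⟩

lemma mem_gasketE (n : ℕ) : ∀ e, e ∈ gasketE n ↔ ∃ t ∈ tset (2 ^ n), isEdge t e := by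
  induction n with
  | zero =>
    intro p
    simp [gasketE, tset_one, isEdge, emb]
    ring_nf
  | succ n ih =>
    intro p
    have e1 : ∀ t : ℕ × ℕ, isEdge (t.1 + 2 ^ n, t.2) p ↔
        ∃ q, isEdge t q ∧ (q.1 + ((2 : ℝ) ^ n, 0), q.2 + ((2 : ℝ) ^ n, 0)) = p := by
      intro t
      simp only [isEdge, add_right_comm _ (2 ^ n) 1, emb_add_left _ _ (2 ^ n), Nat.cast_pow,
        Nat.cast_ofNat]
      constructor
      · rintro (h | h | h)
        · exact ⟨_, Or.inl rfl, h.symm⟩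
        · exact ⟨_, Or.inr (Or.inl rfl), h.symm⟩
        · exact ⟨_, Or.inr (Or.inr rfl), h.symm⟩
      · rintro ⟨q, h | h | h, rfl⟩ <;> subst h <;> simp
    have e2 : ∀ t : ℕ × ℕ, isEdge (t.1, t.2 + 2 ^ n) p ↔
        ∃ q, isEdge t q ∧ (q.1 + ((2 : ℝ) ^ n / 2, (2 : ℝ) ^ n / 2 * Real.sqrt 3),
          q.2 + ((2 : ℝ) ^ n / 2, (2 : ℝ) ^ n / 2 * Real.sqrt 3)) = p := by
      intro t
      simp only [isEdge, add_right_comm _ (2 ^ n) 1, emb_add_right _ _ (2 ^ n), Nat.cast_pow,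
        Nat.cast_ofNat]
      constructor
      · rintro (h | h | h)
        · exact ⟨_, Or.inl rfl, h.symm⟩
        · exact ⟨_, Or.inr (Or.inl rfl), h.symm⟩
        · exact ⟨_, Or.inr (Or.inr rfl), h.symm⟩
      · rintro ⟨q, h | h | h, rfl⟩ <;> subst h <;> simp
    simp only [gasketE, Set.mem_union, Set.mem_image, ih, mem_tset_succ]
    constructor
    · rintro ((⟨t, ht, h⟩ | ⟨q, ⟨t, ht, h⟩, hq⟩) | ⟨q, ⟨t, ht, h⟩, hq⟩)
      · exact ⟨t, Or.inl ht, h⟩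
      · exact ⟨_, Or.inr (Or.inl ⟨t, ht, rfl⟩), (e1 t).2 ⟨q, h, hq⟩⟩
      · exact ⟨_, Or.inr (Or.inr ⟨t, ht, rfl⟩), (e2 t).2 ⟨q, h, hq⟩⟩
    · rintro ⟨_, ht | ⟨t, ht, rfl⟩ | ⟨t, ht, rfl⟩, h⟩
      · exact Or.inl (Or.inl ⟨_, ht, h⟩)
      · obtain ⟨q, h, hq⟩ := (e1 t).1 h
        exact Or.inl (Or.inr ⟨q, ⟨t, ht, h⟩, hq⟩)
      · obtain ⟨q, h, hq⟩ := (e2 t).1 h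
        exact Or.inr ⟨q, ⟨t, ht, h⟩, hq⟩

lemma mem_iUnion_gasketV (p : ℝ × ℝ) :
    p ∈ ⋃ n, gasketV n ↔ ∃ t : ℕ × ℕ, isBase t.1 t.2 ∧ isCorner t p := by
  simp only [Set.mem_iUnion, mem_gasketV, mem_tset]
  constructor
  · rintro ⟨n, t, ht, h⟩
    exact ⟨t, ht.1, h⟩
  · rintro ⟨t, ht, h⟩
    exact ⟨t.1 + t.2, t, ⟨ht, Nat.lt_two_pow_self⟩, h⟩

lemma mem_iUnion_gasketE (e : (ℝ × ℝ) × (ℝ × ℝ)) :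
    e ∈ ⋃ n, gasketE n ↔ ∃ t : ℕ × ℕ, isBase t.1 t.2 ∧ isEdge t e := by
  simp only [Set.mem_iUnion, mem_gasketE, mem_tset]
  constructor
  · rintro ⟨n, t, ht, h⟩
    exact ⟨t, ht.1, h⟩
  · rintro ⟨t, ht, h⟩
    exact ⟨t.1 + t.2, t, ⟨ht, Nat.lt_two_pow_self⟩, h⟩

/-- The sign attached to a side of the doubly infinite gasket. -/
def sgn (s : Bool) : ℝ := if s then 1 else -1

lemma isVert.of_base {a b : ℕ} (h : isBase a b) : isVert a b := Or.inl h

lemma isVert.of_base_left {a b : ℕ} (h : isBase a b) : isVert (a + 1) b :=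
  Or.inr (Or.inl ⟨by omega, by simpa using h⟩)

lemma isVert.of_base_right {a b : ℕ} (h : isBase a b) : isVert a (b + 1) :=
  Or.inr (Or.inr ⟨by omega, by simpa using h⟩)

lemma exists_isCorner_iff (p : ℝ × ℝ) : (∃ t : ℕ × ℕ, isBase t.1 t.2 ∧ isCorner t p) ↔
    ∃ a b, isVert a b ∧ p = emb a b := by
  constructor
  · rintro ⟨t, ht, h | h | h⟩
    · exact ⟨_, _, isVert.of_base ht, h⟩
    · exact ⟨_, _, isVert.of_base_left ht, h⟩
    · exact ⟨_, _, isVert.of_base_right ht, h⟩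
  · rintro ⟨a, b, h | h | h, hp⟩
    · exact ⟨(a, b), h, Or.inl hp⟩
    · exact ⟨(a - 1, b), h.2, Or.inr (Or.inl (by simpa [Nat.sub_add_cancel h.1] using hp))⟩
    · exact ⟨(a, b - 1), h.2, Or.inr (Or.inr (by simpa [Nat.sub_add_cancel h.1] using hp))⟩

lemma mem_SGV (p : ℝ × ℝ) : p ∈ SGV ↔ ∃ s a b, isVert a b ∧ p = sgn s • emb a b := by
  unfold SGV
  simp only [Set.mem_union, Set.mem_image, mem_iUnion_gasketV, exists_isCorner_iff]
  constructor
  · rintro (⟨a, b, h, rfl⟩ | ⟨_, ⟨a, b, h, rfl⟩, rfl⟩)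
    · exact ⟨true, a, b, h, by simp [sgn]⟩
    · exact ⟨false, a, b, h, by simp [sgn]⟩
  · rintro ⟨s, a, b, h, rfl⟩
    cases s
    · exact Or.inr ⟨_, ⟨a, b, h, rfl⟩, by simp [sgn]⟩
    · exact Or.inl ⟨a, b, h, by simp [sgn]⟩

lemma mem_SGE (e : (ℝ × ℝ) × (ℝ × ℝ)) : e ∈ SGE ↔ ∃ (s : Bool) (t : ℕ × ℕ),
    isBase t.1 t.2 ∧ ∃ e', isEdge t e' ∧ e = (sgn s • e'.1, sgn s • e'.2) := by
  unfold SGE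
  simp only [Set.mem_union, Set.mem_image, mem_iUnion_gasketE]
  constructor
  · rintro (⟨t, ht, h⟩ | ⟨e', ⟨t, ht, h⟩, rfl⟩)
    · exact ⟨true, t, ht, e, h, by simp [sgn]⟩
    · exact ⟨false, t, ht, e', h, by simp [sgn]⟩
  · rintro ⟨s, t, ht, e', h, rfl⟩
    cases s
    · exact Or.inr ⟨e', ⟨t, ht, h⟩, by simp [sgn]⟩
    · exact Or.inl ⟨t, ht, by simpa [sgn] using h⟩

lemma emb_zero : emb 0 0 = 0 := by simp [emb]

open Classical in
/-- The vertex with coordinates `(a, b)` on side `s`. -/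
noncomputable def vtx (s : Bool) (a b : ℕ) : SG :=
  if h : isVert a b then ⟨sgn s • emb a b, (mem_SGV _).2 ⟨s, a, b, h, rfl⟩⟩
  else ⟨0, (mem_SGV _).2 ⟨s, 0, 0, isVert.of_base (isBase_zero_left 0), by simp [emb_zero]⟩⟩

lemma vtx_val {s : Bool} {a b : ℕ} (h : isVert a b) : (vtx s a b).1 = sgn s • emb a b := by
  simp [vtx, h]

lemma exists_vtx (x : SG) : ∃ s a b, isVert a b ∧ x = vtx s a b := by
  obtain ⟨s, a, b, h, hx⟩ := (mem_SGV _).1 x.2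
  exact ⟨s, a, b, h, Subtype.ext (by rw [hx, vtx_val h])⟩

lemma sg_eq_iff {x y : SG} : x = y ↔ x.1 = y.1 := Subtype.ext_iff

lemma vtx_inj {s s' : Bool} {a b a' b' : ℕ} (h : isVert a b) (h' : isVert a' b') :
    vtx s a b = vtx s' a' b' ↔ a = a' ∧ b = b' ∧ (s = s' ∨ a + b = 0) := by
  rw [sg_eq_iff, vtx_val h, vtx_val h']
  constructor
  · intro he
    simp only [emb, Prod.smul_mk, smul_eq_mul, Prod.mk.injEq] at he
    obtain ⟨h1, h2⟩ := he
    have h3 : sgn s * b = sgn s' * b' := by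
      have : (Real.sqrt 3) ≠ 0 := by positivity
      apply mul_right_cancel₀ this
      linarith
    have h4 : sgn s * a = sgn s' * a' := by linarith
    cases s <;> cases s' <;> simp [sgn] at h3 h4
    · exact ⟨h4, h3, Or.inl rfl⟩
    · exact ⟨by omega, by omega, Or.inr (by omega)⟩
    · exact ⟨by omega, by omega, Or.inr (by omega)⟩
    · exact ⟨h4, h3, Or.inl rfl⟩
  · rintro ⟨rfl, rfl, rfl | h0⟩
    · rfl
    · obtain rfl : a = 0 := by omega
      obtain rfl : b = 0 := by omega
      simp [emb_zero]

lemma sgAdj_iff (x y : SG) : sgAdj x y ↔ ∃ s a b, isBase a b ∧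
    ((vtx s a b = x ∧ (vtx s (a + 1) b = y ∨ vtx s a (b + 1) = y)) ∨
     (vtx s (a + 1) b = x ∧ (vtx s a b = y ∨ vtx s a (b + 1) = y)) ∨
     (vtx s a (b + 1) = x ∧ (vtx s a b = y ∨ vtx s (a + 1) b = y))) := by
  unfold sgAdj
  simp only [mem_SGE, isEdge]
  constructor
  · rintro (⟨s, ⟨a, b⟩, ht, e', h | h | h, he⟩ | ⟨s, ⟨a, b⟩, ht, e', h | h | h, he⟩) <;>
    · refine ⟨s, a, b, ht, ?_⟩
      subst h
      simp only [Prod.mk.injEq] at he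
      simp only [sg_eq_iff, vtx_val (isVert.of_base ht), vtx_val (isVert.of_base_left ht),
        vtx_val (isVert.of_base_right ht), he]
      simp
  · rintro ⟨s, a, b, ht, H⟩
    simp only [sg_eq_iff, vtx_val (isVert.of_base ht), vtx_val (isVert.of_base_left ht),
        vtx_val (isVert.of_base_right ht)] at H
    rcases H with ⟨h, h' | h'⟩ | ⟨h, h' | h'⟩ | ⟨h, h' | h'⟩
    · exact Or.inl ⟨s, (a, b), ht, _, Or.inl rfl, by simp [← h, ← h']⟩
    · exact Or.inl ⟨s, (a, b), ht, _, Or.inr (Or.inl rfl), by simp [← h, ← h']⟩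
    · exact Or.inr ⟨s, (a, b), ht, _, Or.inl rfl, by simp [← h, ← h']⟩
    · exact Or.inl ⟨s, (a, b), ht, _, Or.inr (Or.inr rfl), by simp [← h, ← h']⟩
    · exact Or.inr ⟨s, (a, b), ht, _, Or.inr (Or.inl rfl), by simp [← h, ← h']⟩
    · exact Or.inr ⟨s, (a, b), ht, _, Or.inr (Or.inr rfl), by simp [← h, ← h']⟩

lemma sum_tset_ite {R a b : ℕ} (h : a + b < R) (F : ℕ → ℕ → ℝ) :
    ∑ t ∈ tset R, (if t.1 = a ∧ t.2 = b then F t.1 t.2 else 0) = if isBase a b then F a b else 0 := by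
  have e : ∀ t ∈ tset R, (if t.1 = a ∧ t.2 = b then F t.1 t.2 else 0)
      = if t = (a, b) then F a b else 0 := by
    rintro ⟨c, d⟩ -
    by_cases hc : c = a ∧ d = b
    · obtain ⟨rfl, rfl⟩ := hc; simp
    · have : ¬ ((c, d) = (a, b)) := by simpa using hc
      simp [hc, this]
  rw [Finset.sum_congr rfl e, Finset.sum_ite_eq']
  simp [mem_tset, h]

lemma sum_tset_ite_left {R a b : ℕ} (h : a + b < R) (F : ℕ → ℕ → ℝ) :
    ∑ t ∈ tset R, (if t.1 + 1 = a ∧ t.2 = b then F t.1 t.2 else 0)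
      = if 1 ≤ a ∧ isBase (a - 1) b then F (a - 1) b else 0 := by
  obtain _ | a := a
  · simp
  · simp only [Nat.add_right_cancel_iff, add_tsub_cancel_right]
    rw [sum_tset_ite (by omega)]
    simp

lemma sum_tset_ite_right {R a b : ℕ} (h : a + b < R) (F : ℕ → ℕ → ℝ) :
    ∑ t ∈ tset R, (if t.1 = a ∧ t.2 + 1 = b then F t.1 t.2 else 0)
      = if 1 ≤ b ∧ isBase a (b - 1) then F a (b - 1) else 0 := by
  obtain _ | b := b
  · simp
  · simp only [Nat.add_right_cancel_iff, add_tsub_cancel_right]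
    rw [sum_tset_ite (by omega)]
    simp

/-- The sum of `Φ` over the pairs of vertices forming a triangle with `x` on side `s`. -/
noncomputable def sideSum (s : Bool) (R : ℕ) (Φ : SG → SG → ℝ) (x : SG) : ℝ :=
  ∑ t ∈ tset R, ((if vtx s t.1 t.2 = x then Φ (vtx s (t.1 + 1) t.2) (vtx s t.1 (t.2 + 1)) else 0)
    + (if vtx s (t.1 + 1) t.2 = x then Φ (vtx s t.1 t.2) (vtx s t.1 (t.2 + 1)) else 0)
    + (if vtx s t.1 (t.2 + 1) = x then Φ (vtx s t.1 t.2) (vtx s (t.1 + 1) t.2) else 0))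

lemma sideSum_eq {s s₀ : Bool} {R a b : ℕ} (hv : isVert a b) (hR : a + b < R)
    (Φ : SG → SG → ℝ) : sideSum s R Φ (vtx s₀ a b) = if s = s₀ ∨ a + b = 0 then
      (if isBase a b then Φ (vtx s (a + 1) b) (vtx s a (b + 1)) else 0)
      + (if 1 ≤ a ∧ isBase (a - 1) b then Φ (vtx s (a - 1) b) (vtx s (a - 1) (b + 1)) else 0)
      + (if 1 ≤ b ∧ isBase a (b - 1) then Φ (vtx s a (b - 1)) (vtx s (a + 1) (b - 1)) else 0)
      else 0 := by
  unfold sideSum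
  have e : ∀ t ∈ tset R, isBase t.1 t.2 := fun t ht => (mem_tset.1 ht).1
  by_cases hs : s = s₀ ∨ a + b = 0
  · rw [if_pos hs, Finset.sum_add_distrib, Finset.sum_add_distrib,
      ← sum_tset_ite hR fun c d => Φ (vtx s (c + 1) d) (vtx s c (d + 1)),
      ← sum_tset_ite_left hR fun c d => Φ (vtx s c d) (vtx s c (d + 1)),
      ← sum_tset_ite_right hR fun c d => Φ (vtx s c d) (vtx s (c + 1) d)]
    congr 1
    · congr 1
      · refine Finset.sum_congr rfl fun t ht => if_congr ?_ rfl rfl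
        rw [vtx_inj (isVert.of_base (e t ht)) hv]
        constructor
        · rintro ⟨h1, h2, _⟩; exact ⟨h1, h2⟩
        · rintro ⟨h1, h2⟩; exact ⟨h1, h2, by rwa [h1, h2]⟩
      · refine Finset.sum_congr rfl fun t ht => if_congr ?_ rfl rfl
        rw [vtx_inj (isVert.of_base_left (e t ht)) hv]
        constructor
        · rintro ⟨h1, h2, _⟩; exact ⟨h1, h2⟩
        · rintro ⟨h1, h2⟩; exact ⟨h1, h2, by rwa [h1, h2]⟩
    · refine Finset.sum_congr rfl fun t ht => if_congr ?_ rfl rfl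
      rw [vtx_inj (isVert.of_base_right (e t ht)) hv]
      constructor
      · rintro ⟨h1, h2, _⟩; exact ⟨h1, h2⟩
      · rintro ⟨h1, h2⟩; exact ⟨h1, h2, by rwa [h1, h2]⟩
  · rw [if_neg hs]
    refine Finset.sum_eq_zero fun t ht => ?_
    have key : ∀ c d, isVert c d → vtx s c d ≠ vtx s₀ a b := by
      intro c d hcd h
      obtain ⟨h1, h2, h3⟩ := (vtx_inj hcd hv).1 h
      rw [h1, h2] at h3
      exact hs h3
    rw [if_neg (key _ _ (isVert.of_base (e t ht))), if_neg (key _ _ (isVert.of_base_left (e t ht))),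
      if_neg (key _ _ (isVert.of_base_right (e t ht)))]
    simp

/-- The level of a vertex, which will turn out to be its distance from the origin. -/
noncomputable def level (x : SG) : ℕ :=
  (exists_vtx x).choose_spec.choose + (exists_vtx x).choose_spec.choose_spec.choose

lemma level_vtx {s : Bool} {a b : ℕ} (h : isVert a b) : level (vtx s a b) = a + b := by
  have hs := (exists_vtx (vtx s a b)).choose_spec.choose_spec.choose_spec
  have := (vtx_inj h hs.1).1 hs.2
  unfold level
  omega

/-- The four neighbours of a vertex form two triangles with it. -/
lemma exists_nbrs (x : SG) : ∃ n₁ n₂ n₃ n₄ : SG, [n₁, n₂, n₃, n₄].Nodup ∧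
    (level x ≠ 0 → level n₃ + 1 = level x) ∧
    ∀ R, level x < R → ∀ Φ, sideSum true R Φ x + sideSum false R Φ x = Φ n₁ n₂ + Φ n₃ n₄ := by
  obtain ⟨s, a, b, hv, rfl⟩ := exists_vtx x
  rw [level_vtx hv]
  by_cases h0 : a + b = 0
  · obtain rfl : a = 0 := by omega
    obtain rfl : b = 0 := by omega
    have hb : isBase 0 0 := isBase_zero_left 0
    refine ⟨vtx true 1 0, vtx true 0 1, vtx false 1 0, vtx false 0 1, ?_, by simp, fun R hR Φ => ?_⟩
    · have h1 : isVert 1 0 := isVert.of_base_left hb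
      have h2 : isVert 0 1 := isVert.of_base_right hb
      simp [vtx_inj, h1, h2]
    · rw [sideSum_eq hv hR, sideSum_eq hv hR]
      simp [hb]
  · have hsum : ∀ R, a + b < R → ∀ Φ,
        sideSum true R Φ (vtx s a b) + sideSum false R Φ (vtx s a b)
        = (if isBase a b then Φ (vtx s (a + 1) b) (vtx s a (b + 1)) else 0)
      + (if 1 ≤ a ∧ isBase (a - 1) b then Φ (vtx s (a - 1) b) (vtx s (a - 1) (b + 1)) else 0)
      + (if 1 ≤ b ∧ isBase a (b - 1) then Φ (vtx s a (b - 1)) (vtx s (a + 1) (b - 1)) else 0) := by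
      intro R hR Φ
      rw [sideSum_eq hv hR, sideSum_eq hv hR]
      cases s
      · rw [if_neg (by rintro (h | h) <;> [cases h; exact h0 h]), if_pos (Or.inl rfl), zero_add]
      · rw [if_pos (Or.inl rfl), if_neg (c := false = true ∨ a + b = 0)
          (by rintro (h | h) <;> [cases h; exact h0 h]), add_zero]
    have k1 : isBase a b → isVert (a + 1) b ∧ isVert a (b + 1) := fun h =>
      ⟨isVert.of_base_left h, isVert.of_base_right h⟩
    have k2 : 1 ≤ a → isBase (a - 1) b → isVert (a - 1) b ∧ isVert (a - 1) (b + 1) := fun _ h =>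
      ⟨isVert.of_base h, isVert.of_base_right h⟩
    have k3 : 1 ≤ b → isBase a (b - 1) → isVert a (b - 1) ∧ isVert (a + 1) (b - 1) := fun _ h =>
      ⟨isVert.of_base h, isVert.of_base_left h⟩
    rcases incidence h0 hv with ⟨h1, h2, h3⟩ | ⟨h1, h2, h3⟩ | ⟨h1, h2, h3⟩
    · obtain ⟨v1, v2⟩ := k1 h1
      obtain ⟨v3, v4⟩ := k2 h2.1 h2.2
      refine ⟨vtx s (a + 1) b, vtx s a (b + 1), vtx s (a - 1) b, vtx s (a - 1) (b + 1), ?_, ?_,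
        fun R hR Φ => ?_⟩
      · simp [vtx_inj, v1, v2, v3, v4]
        omega
      · rw [level_vtx v3]; omega
      · rw [hsum R hR, if_pos h1, if_pos h2, if_neg h3, add_zero]
    · obtain ⟨v1, v2⟩ := k1 h1
      obtain ⟨v3, v4⟩ := k3 h3.1 h3.2
      refine ⟨vtx s (a + 1) b, vtx s a (b + 1), vtx s a (b - 1), vtx s (a + 1) (b - 1), ?_, ?_,
        fun R hR Φ => ?_⟩
      · simp [vtx_inj, v1, v2, v3, v4]
        omega
      · rw [level_vtx v3]; omega
      · rw [hsum R hR, if_pos h1, if_neg h2, if_pos h3, add_zero]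
    · obtain ⟨v1, v2⟩ := k2 h2.1 h2.2
      obtain ⟨v3, v4⟩ := k3 h3.1 h3.2
      refine ⟨vtx s (a - 1) b, vtx s (a - 1) (b + 1), vtx s a (b - 1), vtx s (a + 1) (b - 1), ?_, ?_,
        fun R hR Φ => ?_⟩
      · simp [vtx_inj, v1, v2, v3, v4]
        omega
      · rw [level_vtx v3]; omega
      · rw [hsum R hR, if_neg h1, if_pos h2, if_pos h3, zero_add]

/-- The neighbours of a vertex. -/
noncomputable def nbrs (x : SG) : Finset SG :=
  {(exists_nbrs x).choose, (exists_nbrs x).choose_spec.choose,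
    (exists_nbrs x).choose_spec.choose_spec.choose,
    (exists_nbrs x).choose_spec.choose_spec.choose_spec.choose}

lemma nbrs_spec (x : SG) : ∃ n₁ n₂ n₃ n₄ : SG, nbrs x = {n₁, n₂, n₃, n₄} ∧
    [n₁, n₂, n₃, n₄].Nodup ∧ (level x ≠ 0 → level n₃ + 1 = level x) ∧
    ∀ R, level x < R → ∀ Φ, sideSum true R Φ x + sideSum false R Φ x = Φ n₁ n₂ + Φ n₃ n₄ :=
  ⟨_, _, _, _, rfl, (exists_nbrs x).choose_spec.choose_spec.choose_spec.choose_spec⟩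

lemma card_nbrs (x : SG) : (nbrs x).card = 4 := by
  obtain ⟨a, b, c, d, h, hn, -⟩ := nbrs_spec x
  rw [h]
  have : ({a, b, c, d} : Finset SG) = [a, b, c, d].toFinset := by simp
  rw [this, List.toFinset_card_of_nodup hn]
  rfl

lemma sum_nbrs (f : SG → ℝ) (x : SG) {R : ℕ} (hR : level x < R) :
    ∑ y ∈ nbrs x, f y = sideSum true R (fun u v => f u + f v) x
      + sideSum false R (fun u v => f u + f v) x := by
  obtain ⟨a, b, c, d, h, hn, -, hs⟩ := nbrs_spec x
  have : ({a, b, c, d} : Finset SG) = [a, b, c, d].toFinset := by simp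
  rw [hs R hR, h, this, List.sum_toFinset _ hn]
  simp [add_assoc]

lemma sideSum_nonneg {s : Bool} {R : ℕ} {Φ : SG → SG → ℝ} (hΦ : ∀ u v, 0 ≤ Φ u v) (x : SG) :
    0 ≤ sideSum s R Φ x := by
  refine Finset.sum_nonneg fun t _ => ?_
  refine add_nonneg (add_nonneg ?_ ?_) ?_ <;> split_ifs <;> first | exact hΦ _ _ | exact le_rfl

lemma sideSum_ne_zero {s : Bool} {R : ℕ} {Φ : SG → SG → ℝ} (hΦ : ∀ u v, 0 ≤ Φ u v) (x : SG) :
    sideSum s R Φ x ≠ 0 ↔ ∃ a b, isBase a b ∧ a + b < R ∧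
      ((vtx s a b = x ∧ Φ (vtx s (a + 1) b) (vtx s a (b + 1)) ≠ 0) ∨
       (vtx s (a + 1) b = x ∧ Φ (vtx s a b) (vtx s a (b + 1)) ≠ 0) ∨
       (vtx s a (b + 1) = x ∧ Φ (vtx s a b) (vtx s (a + 1) b) ≠ 0)) := by
  have h0 : ∀ (p : Prop) [Decidable p] u v, 0 ≤ if p then Φ u v else 0 := by
    intro p _ u v; split_ifs; exacts [hΦ _ _, le_rfl]
  unfold sideSum
  rw [Ne, Finset.sum_eq_zero_iff_of_nonneg fun t _ =>
    add_nonneg (add_nonneg (h0 _ _ _) (h0 _ _ _)) (h0 _ _ _)]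
  push Not
  constructor
  · rintro ⟨⟨a, b⟩, ht, h⟩
    rw [mem_tset] at ht
    refine ⟨a, b, ht.1, ht.2, ?_⟩
    contrapose! h
    obtain ⟨h1, h2, h3⟩ := h
    simp +contextual [h1, h2, h3]
  · rintro ⟨a, b, hb, hR, h⟩
    refine ⟨(a, b), mem_tset.2 ⟨hb, hR⟩, ?_⟩
    intro hz
    have e1 := h0 (vtx s a b = x) (vtx s (a + 1) b) (vtx s a (b + 1))
    have e2 := h0 (vtx s (a + 1) b = x) (vtx s a b) (vtx s a (b + 1))
    have e3 := h0 (vtx s a (b + 1) = x) (vtx s a b) (vtx s (a + 1) b)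
    rcases h with ⟨h, h'⟩ | ⟨h, h'⟩ | ⟨h, h'⟩
    · rw [if_pos h] at e1 hz
      exact h' (by linarith)
    · rw [if_pos h] at e2 hz
      exact h' (by linarith)
    · rw [if_pos h] at e3 hz
      exact h' (by linarith)

lemma sgAdj_iff_mem_nbrs (x z : SG) : sgAdj x z ↔ z ∈ nbrs x := by
  have hΦ : ∀ u v : SG, (0 : ℝ) ≤ (if u = z then 1 else 0) + (if v = z then 1 else 0) := by
    intro u v; positivity
  have hΦ' : ∀ u v : SG, (if u = z then (1 : ℝ) else 0) + (if v = z then 1 else 0) ≠ 0 ↔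
      u = z ∨ v = z := by
    intro u v; split_ifs <;> simp [*]
  have key : z ∈ nbrs x ↔ ∑ y ∈ nbrs x, (if y = z then (1 : ℝ) else 0) ≠ 0 := by simp
  rw [key, sum_nbrs _ x (Nat.lt_succ_self _), Ne, add_eq_zero_iff_of_nonneg (sideSum_nonneg hΦ _)
    (sideSum_nonneg hΦ _), not_and_or]
  have h1 := fun s => sideSum_ne_zero (s := s) (R := (level x).succ) hΦ x
  simp only [hΦ'] at h1
  rw [← Ne, ← Ne, h1, h1, sgAdj_iff]
  constructor
  · rintro ⟨s, a, b, hb, h⟩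
    have hR : a + b < (level x).succ := by
      rcases h with ⟨rfl, -⟩ | ⟨rfl, -⟩ | ⟨rfl, -⟩
      · rw [level_vtx (isVert.of_base hb)]; omega
      · rw [level_vtx (isVert.of_base_left hb)]; omega
      · rw [level_vtx (isVert.of_base_right hb)]; omega
    cases s
    · exact Or.inr ⟨a, b, hb, hR, h⟩
    · exact Or.inl ⟨a, b, hb, hR, h⟩
  · rintro (⟨a, b, hb, -, h⟩ | ⟨a, b, hb, -, h⟩)
    exacts [⟨_, a, b, hb, h⟩, ⟨_, a, b, hb, h⟩]

/-- The origin. -/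
noncomputable def origin : SG := vtx true 0 0

lemma isVert_zero : isVert 0 0 := isVert.of_base (isBase_zero_left 0)

lemma level_origin : level origin = 0 := level_vtx isVert_zero

lemma eq_origin {x : SG} (h : level x = 0) : x = origin := by
  obtain ⟨s, a, b, hv, rfl⟩ := exists_vtx x
  rw [level_vtx hv] at h
  exact (vtx_inj hv isVert_zero).2 ⟨by omega, by omega, Or.inr h⟩

lemma vtx_zero (s : Bool) : vtx s 0 0 = origin := eq_origin (level_vtx isVert_zero)

lemma eq_origin_of_val {o : SG} (ho : o.1 = (0, 0)) : o = origin := by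
  rw [sg_eq_iff, ho, origin, vtx_val isVert_zero, emb_zero]
  simp

lemma level_le_of_sgAdj {x y : SG} (h : sgAdj x y) : level y ≤ level x + 1 := by
  obtain ⟨s, a, b, hb, h⟩ := (sgAdj_iff x y).1 h
  have e1 := level_vtx (s := s) (isVert.of_base hb)
  have e2 := level_vtx (s := s) (isVert.of_base_left hb)
  have e3 := level_vtx (s := s) (isVert.of_base_right hb)
  rcases h with ⟨rfl, rfl | rfl⟩ | ⟨rfl, rfl | rfl⟩ | ⟨rfl, rfl | rfl⟩ <;> omega

/-- The Sierpinski gasket graph as a leveled graph. -/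
noncomputable def graph : LeveledGraph SG where
  nbr := nbrs
  lev := level
  root := origin
  mem_nbr_comm {x y} := by
    rw [← sgAdj_iff_mem_nbrs, ← sgAdj_iff_mem_nbrs]; exact Or.comm
  card_nbr := card_nbrs
  lev_root := level_origin
  exists_lower x hx := by
    obtain ⟨a, b, c, d, h, -, hl, -⟩ := nbrs_spec x
    exact ⟨c, by simp [h], hl fun h0 => hx (eq_origin h0)⟩
  lev_le {x y} h := level_le_of_sgAdj ((sgAdj_iff_mem_nbrs x y).2 h)
  finite_lev n := by
    refine ((Set.toFinite (Set.univ : Set Bool)).prod ((Set.finite_Iio n).prod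
      (Set.finite_Iio n))).image (fun t => vtx t.1 t.2.1 t.2.2) |>.subset ?_
    intro x hx
    obtain ⟨s, a, b, hv, rfl⟩ := exists_vtx x
    have hx' : level (vtx s a b) < n := hx
    rw [level_vtx hv] at hx'
    exact ⟨(s, a, b), by simp; omega, rfl⟩
  infinite := by
    refine Infinite.of_injective (fun a : ℕ => vtx true a 0) fun a b h => ?_
    exact ((vtx_inj (isVert.of_base (isBase_zero_right a))
      (isVert.of_base (isBase_zero_right b))).1 h).1

lemma adj_iff (x y : SG) : sgAdj x y ↔ y ∈ graph.nbr x := sgAdj_iff_mem_nbrs x y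

/-- The total energy form of the triangles of level less than `R` on both sides. -/
noncomputable def energy₂ (R : ℕ) (f g : SG → ℝ) : ℝ :=
  energy R (fun a b => f (vtx true a b)) (fun a b => g (vtx true a b))
    + energy R (fun a b => f (vtx false a b)) (fun a b => g (vtx false a b))

/-- The total mass of both sides. -/
noncomputable def mass₂ (R : ℕ) (g : SG → ℝ) : ℝ :=
  mass R (fun a b => g (vtx true a b)) + mass R (fun a b => g (vtx false a b))

lemma energy_single (s : Bool) (R : ℕ) (f : SG → ℝ) (x : SG) :
    energy R (fun a b => f (vtx s a b)) (fun a b => if vtx s a b = x then 1 else 0)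
      = sideSum s R (fun u v => 2 * f x - f u - f v) x := by
  refine Finset.sum_congr rfl fun t _ => ?_
  have e : ∀ (u : SG) (c : ℝ), (if u = x then 2 * f x - c else 0)
      = (2 * f u - c) * if u = x then 1 else 0 := by
    intro u c; split_ifs with h <;> simp [h]
  simp only [sub_sub, e, triForm]
  ring

lemma mass_single (s : Bool) (R : ℕ) (x : SG) :
    mass R (fun a b => if vtx s a b = x then 1 else 0) = sideSum s R (fun _ _ => 1 / 2) x := by
  refine Finset.sum_congr rfl fun t _ => ?_
  simp only [div_eq_mul_inv, add_mul, ite_mul, one_mul, zero_mul]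

lemma energy₂_single {R : ℕ} {x : SG} (h : level x < R) (f : SG → ℝ) :
    energy₂ R f (fun y => if y = x then 1 else 0) = - graph.lap f x := by
  obtain ⟨a, b, c, d, hn, hd, -, hs⟩ := nbrs_spec x
  rw [energy₂, energy_single, energy_single, hs R h, graph.lap_eq]
  have : ∑ y ∈ graph.nbr x, f y = f a + f b + f c + f d := by
    have e : ({a, b, c, d} : Finset SG) = [a, b, c, d].toFinset := by simp
    rw [show graph.nbr x = _ from hn, e, List.sum_toFinset _ hd]
    simp [add_assoc]
  rw [this]; ring

lemma mass₂_single {R : ℕ} {x : SG} (h : level x < R) :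
    mass₂ R (fun y => if y = x then 1 else 0) = 1 := by
  obtain ⟨a, b, c, d, hn, hd, -, hs⟩ := nbrs_spec x
  rw [mass₂, mass_single, mass_single, hs R h]
  norm_num

lemma mass_sum {ι : Type*} (s : Finset ι) (R : ℕ) (g : ι → ℕ → ℕ → ℝ) :
    mass R (fun a b => ∑ i ∈ s, g i a b) = ∑ i ∈ s, mass R (g i) := by
  unfold mass
  rw [Finset.sum_comm]
  refine Finset.sum_congr rfl fun t _ => ?_
  rw [← Finset.sum_div, Finset.sum_add_distrib, Finset.sum_add_distrib]

lemma mass_mul (R : ℕ) (c : ℝ) (g : ℕ → ℕ → ℝ) :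
    mass R (fun a b => c * g a b) = c * mass R g := by
  unfold mass
  rw [Finset.mul_sum]
  exact Finset.sum_congr rfl fun t _ => by ring

lemma energy_comm (R : ℕ) (f g : ℕ → ℕ → ℝ) : energy R f g = energy R g f :=
  Finset.sum_congr rfl fun t _ => by unfold triForm; ring

lemma energy_sum_right {ι : Type*} (s : Finset ι) (R : ℕ) (f : ℕ → ℕ → ℝ) (g : ι → ℕ → ℕ → ℝ) :
    energy R f (fun a b => ∑ i ∈ s, g i a b) = ∑ i ∈ s, energy R f (g i) := by
  unfold energy
  rw [Finset.sum_comm]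
  refine Finset.sum_congr rfl fun t _ => ?_
  simp only [triForm, Finset.sum_add_distrib, ← Finset.mul_sum, Finset.sum_sub_distrib]

lemma energy_mul_right (R : ℕ) (c : ℝ) (f g : ℕ → ℕ → ℝ) :
    energy R f (fun a b => c * g a b) = c * energy R f g := by
  unfold energy
  rw [Finset.mul_sum]
  exact Finset.sum_congr rfl fun t _ => by unfold triForm; ring

lemma eq_sum_single {S : Finset SG} {g : SG → ℝ} (hg : ∀ x ∉ S, g x = 0) :
    g = fun y => ∑ x ∈ S, g x * if y = x then 1 else 0 := by
  funext y
  simp only [mul_ite, mul_one, mul_zero, Finset.sum_ite_eq]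
  split_ifs with h
  exacts [rfl, hg y h]

/-- Summation by parts. -/
lemma energy₂_eq {R : ℕ} {S : Finset SG} (hS : ∀ x ∈ S, level x < R) {g : SG → ℝ}
    (hg : ∀ x ∉ S, g x = 0) (f : SG → ℝ) :
    energy₂ R f g = - ∑ x ∈ S, g x * graph.lap f x := by
  have h := fun s : Bool => energy_sum_right S R (fun a b => f (vtx s a b))
    (fun x a b => g x * if vtx s a b = x then 1 else 0)
  have e : energy₂ R f g = ∑ x ∈ S, g x * energy₂ R f (fun y => if y = x then 1 else 0) := by
    conv_lhs => rw [eq_sum_single hg]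
    simp only [energy₂, h, energy_mul_right, mul_add, Finset.sum_add_distrib]
  rw [e, ← Finset.sum_neg_distrib]
  exact Finset.sum_congr rfl fun x hx => by rw [energy₂_single (hS x hx)]; ring

lemma mass₂_eq {R : ℕ} {S : Finset SG} (hS : ∀ x ∈ S, level x < R) {g : SG → ℝ}
    (hg : ∀ x ∉ S, g x = 0) : mass₂ R g = ∑ x ∈ S, g x := by
  have h := fun s : Bool => mass_sum S R (fun x a b => g x * if vtx s a b = x then 1 else 0)
  have e : mass₂ R g = ∑ x ∈ S, g x * mass₂ R (fun y => if y = x then 1 else 0) := by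
    conv_lhs => rw [eq_sum_single hg]
    simp only [mass₂, h, mass_mul, mul_add, Finset.sum_add_distrib]
  rw [e]
  exact Finset.sum_congr rfl fun x hx => by rw [mass₂_single (hS x hx), mul_one]

end Gasket

namespace LeveledGraph

variable {V : Type*} (G : LeveledGraph V) {adj : V → V → Prop}

lemma eq_root_of_lev {x : V} (h : G.lev x = 0) : x = G.root := by
  by_contra hx
  obtain ⟨y, -, hy⟩ := G.exists_lower x hx
  omega

lemma aBall_eq (hadj : ∀ x y, adj x y ↔ y ∈ G.nbr x) (n : ℕ) :
    aBall adj G.root n = {x | G.lev x ≤ n} := by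
  induction n with
  | zero =>
    ext x
    simp only [aBall, Set.mem_singleton_iff, Set.mem_ofPred_eq, Nat.le_zero]
    exact ⟨fun h => h ▸ G.lev_root, G.eq_root_of_lev⟩
  | succ n ih =>
    ext x
    simp only [aBall, ih, Set.mem_union, Set.mem_ofPred_eq, hadj]
    constructor
    · rintro (h | ⟨y, hy, h⟩)
      · omega
      · have := G.lev_le h; omega
    · intro h
      by_cases hx : x = G.root
      · left; rw [hx, G.lev_root]; omega
      · obtain ⟨y, hy, h'⟩ := G.exists_lower x hx
        exact Or.inr ⟨y, by omega, G.mem_nbr_comm.1 hy⟩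

lemma aDist_eq (hadj : ∀ x y, adj x y ↔ y ∈ G.nbr x) (x : V) : aDist adj G.root x = G.lev x := by
  simp only [aDist, G.aBall_eq hadj, Set.mem_ofPred_eq]
  exact csInf_Ici

/-- The vertices of level less than `n`. -/
noncomputable def ball (n : ℕ) : Finset V := (G.finite_lev n).toFinset

@[simp] lemma mem_ball {n : ℕ} {x : V} : x ∈ G.ball n ↔ G.lev x < n := by simp [ball]

end LeveledGraph

namespace Gasket

lemma mem_ball {n : ℕ} {x : SG} : x ∈ graph.ball n ↔ level x < n := graph.mem_ball

/-- The extension of a function of coordinates to both sides of the graph. -/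
noncomputable def lift (U : ℕ → ℕ → ℝ) (x : SG) : ℝ :=
  U (exists_vtx x).choose_spec.choose (exists_vtx x).choose_spec.choose_spec.choose

lemma lift_vtx {s : Bool} {a b : ℕ} (h : isVert a b) (U : ℕ → ℕ → ℝ) :
    lift U (vtx s a b) = U a b := by
  have hs := (exists_vtx (vtx s a b)).choose_spec.choose_spec.choose_spec
  have := (vtx_inj h hs.1).1 hs.2
  exact congrArg₂ U this.1.symm this.2.1.symm

lemma energy_congr_vert {m : ℕ} {f f' g g' : ℕ → ℕ → ℝ}
    (h : ∀ a b, isVert a b → f a b = f' a b) (h' : ∀ a b, isVert a b → g a b = g' a b) :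
    energy m f g = energy m f' g' := by
  refine Finset.sum_congr rfl fun t ht => ?_
  have hb := (mem_tset.1 ht).1
  have h1 := isVert.of_base hb
  have h2 := isVert.of_base_left hb
  have h3 := isVert.of_base_right hb
  rw [h _ _ h1, h _ _ h2, h _ _ h3, h' _ _ h1, h' _ _ h2, h' _ _ h3]

lemma energy₂_comm (R : ℕ) (f g : SG → ℝ) : energy₂ R f g = energy₂ R g f := by
  rw [energy₂, energy₂, energy_comm, energy_comm R (fun a b => f (vtx false a b))]

lemma energy_le_energy₂ (s : Bool) (R : ℕ) (f : SG → ℝ) :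
    energy R (fun a b => f (vtx s a b)) (fun a b => f (vtx s a b)) ≤ energy₂ R f f := by
  have h1 := energy_nonneg R fun a b => f (vtx true a b)
  have h2 := energy_nonneg R fun a b => f (vtx false a b)
  unfold energy₂
  cases s <;> linarith

/-- A vertex is a corner of some triangle of no larger level. -/
lemma isVert.exists_corner {a b : ℕ} (h : isVert a b) : ∃ t : ℕ × ℕ, isBase t.1 t.2 ∧
    t.1 + t.2 ≤ a + b ∧ ((a = t.1 ∧ b = t.2) ∨ (a = t.1 + 1 ∧ b = t.2) ∨ (a = t.1 ∧ b = t.2 + 1)) := by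
  rcases h with h | ⟨h1, h⟩ | ⟨h1, h⟩
  · exact ⟨(a, b), h, le_rfl, by simp⟩
  · exact ⟨(a - 1, b), h, by dsimp only; omega, by dsimp only; omega⟩
  · exact ⟨(a, b - 1), h, by dsimp only; omega, by dsimp only; omega⟩

lemma sq_sub_vert_le {k a b : ℕ} (hv : isVert a b) (hab : a + b < 2 ^ k) (f : ℕ → ℕ → ℝ) :
    (3 / 5) ^ k * (f a b - f 0 0) ^ 2 ≤ 25 * energy (2 ^ k) f f := by
  obtain ⟨t, ht, hle, h⟩ := hv.exists_corner
  obtain ⟨h1, h2, h3⟩ := sq_sub_le k f t (mem_tset.2 ⟨ht, by omega⟩)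
  rcases h with ⟨rfl, rfl⟩ | ⟨rfl, rfl⟩ | ⟨rfl, rfl⟩ <;> assumption

lemma three_card_tset_le (n : ℕ) : 3 * ((tset n).card : ℝ) ≤ (graph.ball (n + 1)).card := by
  classical
  have e : mass₂ (n + 1) (fun x => if level x < n + 1 then 1 else 0) = (graph.ball (n + 1)).card := by
    rw [mass₂_eq (S := graph.ball (n + 1)) (fun x hx => mem_ball.1 hx)
      (fun x hx => if_neg fun h => hx (mem_ball.2 h))]
    rw [Finset.sum_congr rfl fun x hx => if_pos (mem_ball.1 hx)]
    simp
  have h : ∀ s, 3 / 2 * ((tset n).card : ℝ) ≤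
      mass (n + 1) fun a b => if level (vtx s a b) < n + 1 then 1 else 0 := by
    intro s
    unfold mass
    rw [mul_comm, ← nsmul_eq_mul]
    refine (Finset.card_nsmul_le_sum (tset n) (fun t =>
      ((if level (vtx s t.1 t.2) < n + 1 then (1 : ℝ) else 0)
        + (if level (vtx s (t.1 + 1) t.2) < n + 1 then 1 else 0)
        + if level (vtx s t.1 (t.2 + 1)) < n + 1 then 1 else 0) / 2) _ fun t ht => ?_).trans
      (Finset.sum_le_sum_of_subset_of_nonneg (tset_mono (Nat.le_succ n)) fun t _ _ => ?_)
    · rw [mem_tset] at ht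
      rw [level_vtx (isVert.of_base ht.1), level_vtx (isVert.of_base_left ht.1),
        level_vtx (isVert.of_base_right ht.1), if_pos (by omega), if_pos (by omega),
        if_pos (by omega)]
      norm_num
    · positivity
  rw [← e, mass₂]
  linarith [h true, h false]

/-- Potentials whose mean over the ball is much smaller than their value at the origin. -/
lemma exists_potential_deficit {n i k : ℕ} {z : SG} (hz : level z + 2 ^ (i + 1) ≤ n)
    (hk : n ≤ 2 ^ k) : ∃ p : SG → ℝ, p z = 1 ∧ (∀ x, 0 ≤ p x) ∧ (∀ x, p x ≤ 1) ∧
      (∀ x, x ∉ graph.ball n → p x = 0) ∧ (∀ x, x ≠ z → 0 ≤ graph.lap p x) ∧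
      (3 / 5) ^ k * 5 ^ i / 104 ≤
        (graph.ball (n + 1)).card * p origin - ∑ x ∈ graph.ball n, p x := by
  have hpos : 0 < 2 ^ (i + 1) := by positivity
  have hzn : level z < n := by omega
  have hzS : z ∈ graph.ball n := mem_ball.2 hzn
  obtain ⟨p, hp1, hp0, hph, hpn, hple⟩ := graph.exists_potential hzS
  refine ⟨p, hp1, hpn, hple, hp0, fun x hx => ?_, ?_⟩
  · by_cases hxS : x ∈ graph.ball n
    · rw [hph x hxS hx]
    · unfold LeveledGraph.lap
      exact Finset.sum_nonneg fun y _ => by rw [hp0 x hxS]; simpa using hpn y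
  obtain ⟨U, hU, -, -, hUb, hUi⟩ := exists_green_ball n
  have hsum : ∀ g : SG → ℝ, ∑ x ∈ graph.ball n, g x * graph.lap p x = g z * graph.lap p z := by
    intro g
    exact Finset.sum_eq_single_of_mem z hzS fun x hx hxz => by rw [hph x hx hxz, mul_zero]
  have hlt : ∀ x ∈ graph.ball n, level x < n := fun x hx => mem_ball.1 hx
  obtain ⟨s, a, b, hv, rfl⟩ := exists_vtx z
  rw [level_vtx hv] at hz hzn
  set κ := - graph.lap p (vtx s a b) with hκ
  have hlift0 : ∀ x ∉ graph.ball n, lift U x = 0 := by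
    intro x hx
    obtain ⟨s', a', b', hv', rfl⟩ := exists_vtx x
    rw [mem_ball, level_vtx hv', not_lt] at hx
    rw [lift_vtx hv', hUb _ _ hx]
  have hA : energy₂ n p (lift U) = U a b * κ := by
    rw [energy₂_eq hlt hlift0, hsum, lift_vtx hv]; ring
  have hB : energy₂ n p (lift U) = 3 * (tset n).card * p origin - ∑ x ∈ graph.ball n, p x := by
    rw [energy₂_comm, ← mass₂_eq hlt hp0]
    have h1 : ∀ s, energy n (fun a b => lift U (vtx s a b)) (fun a b => p (vtx s a b))
        = 3 / 2 * (tset n).card * p origin - mass n fun a b => p (vtx s a b) := by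
      intro s
      rw [energy_congr_vert (f' := U) (fun a b h => lift_vtx h U) (fun _ _ _ => rfl), hU, vtx_zero]
    rw [energy₂, h1, h1, mass₂]; ring
  have hlt' : ∀ x ∈ graph.ball n, level x < 2 ^ k := fun x hx => (hlt x hx).trans_le hk
  have hC : energy₂ (2 ^ k) p p = κ := by
    rw [energy₂_eq hlt' hp0, hsum, hp1]; ring
  have hD : (3 / 5 : ℝ) ^ k ≤ 52 * κ := by
    have h1 := sq_sub_vert_le (k := k) hv (by omega) fun a b => p (vtx s a b)
    have h2 := (sq_sub_corner_le k fun a b => p (vtx s a b)).1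
    have h3 := energy_le_energy₂ s (2 ^ k) p
    have h4 : p (vtx s (2 ^ k) 0) = 0 := hp0 _ fun h => by
      rw [mem_ball, level_vtx (isVert.of_base (isBase_zero_right _))] at h
      omega
    rw [hC] at h3
    simp only [hp1, h4] at h1 h2
    have h5 : (0 : ℝ) < (3 / 5) ^ k := by positivity
    nlinarith [mul_nonneg h5.le (sq_nonneg (2 * p (vtx s 0 0) - 1))]
  have hE := hUi i a b hz
  have hκ0 : 0 ≤ κ := by
    have : (0 : ℝ) < (3 / 5) ^ k := by positivity
    linarith
  have hF : 3 * ((tset n).card : ℝ) * p origin ≤ (graph.ball (n + 1)).card * p origin :=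
    mul_le_mul_of_nonneg_right (three_card_tset_le n) (hpn _)
  have hG : (3 / 5 : ℝ) ^ k / 52 * (5 ^ i / 2) ≤ κ * U a b :=
    mul_le_mul (by linarith) hE (by positivity) hκ0
  calc (3 / 5 : ℝ) ^ k * 5 ^ i / 104 = (3 / 5 : ℝ) ^ k / 52 * (5 ^ i / 2) := by ring
    _ ≤ _ := by linarith

end Gasket

/-- The internal DLA dynamics. -/
structure IsIDLA {V : Type*} [DecidableEq V] (adj : V → V → Prop) (o : V) {Ω : Type*}
    [MeasurableSpace Ω] (P : Measure Ω) (I : ℕ → Ω → Finset V) (Y : ℕ → Ω → V) : Prop where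
  zero : ∀ ω, I 0 ω = {o}
  step : ∀ n ω, I (n + 1) ω = insert (Y (n + 1) ω) (I n ω)
  bdry : ∀ n ω, Y (n + 1) ω ∈ bdryA adj (I n ω)
  law : ∀ (n : ℕ) (A : Finset V), ∀ y ∈ bdryA adj A,
    P {ω | I n ω = A ∧ Y (n + 1) ω = y}
      = ENNReal.ofReal (hitMA adj (bdryA adj A) o y) * P {ω | I n ω = A}

namespace LeveledGraph

lemma countable {V : Type*} (G : LeveledGraph V) : Countable V := by
  rw [← Set.countable_univ_iff]
  refine (Set.countable_iUnion fun n => (G.finite_lev n).countable).mono fun x _ => ?_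
  exact Set.mem_iUnion.2 ⟨G.lev x + 1, Nat.lt_succ_self _⟩

variable {V : Type*} [DecidableEq V] (G : LeveledGraph V) {adj : V → V → Prop} {Ω : Type*}
  [MeasurableSpace Ω] {P : Measure Ω}
  {I : ℕ → Ω → Finset V} {Y : ℕ → Ω → V}

lemma root_mem_cluster (h : IsIDLA adj G.root P I Y) (n : ℕ) (ω : Ω) : G.root ∈ I n ω := by
  induction n with
  | zero => simp [h.zero]
  | succ n ih => rw [h.step]; exact Finset.mem_insert_of_mem ih

lemma card_cluster (h : IsIDLA adj G.root P I Y) (n : ℕ) (ω : Ω) : (I n ω).card = n + 1 := by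
  induction n with
  | zero => simp [h.zero]
  | succ n ih => rw [h.step, Finset.card_insert_of_notMem (h.bdry n ω).1, ih]

/-- The cluster meets every level up to its maximal one. -/
lemma exists_mem_cluster_lev (hadj : ∀ x y, adj x y ↔ y ∈ G.nbr x) (h : IsIDLA adj G.root P I Y)
    (n : ℕ) (ω : Ω) {x : V} (hx : x ∈ I n ω) {l : ℕ} (hl : l ≤ G.lev x) :
    ∃ y ∈ I n ω, G.lev y = l := by
  induction n generalizing x with
  | zero =>
    rw [h.zero, Finset.mem_singleton] at hx
    refine ⟨G.root, by simp [h.zero], ?_⟩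
    rw [hx, G.lev_root] at hl
    rw [G.lev_root]; omega
  | succ n ih =>
    rw [h.step] at hx ⊢
    rcases Finset.mem_insert.1 hx with rfl | hx
    · rcases hl.eq_or_lt with rfl | hl
      · exact ⟨_, Finset.mem_insert_self _ _, rfl⟩
      · obtain ⟨-, z, hz, hzy⟩ := h.bdry n ω
        have := G.lev_le ((hadj _ _).1 hzy)
        obtain ⟨y, hy, hy'⟩ := ih hz (by omega)
        exact ⟨y, Finset.mem_insert_of_mem hy, hy'⟩
    · obtain ⟨y, hy, hy'⟩ := ih hx hl
      exact ⟨y, Finset.mem_insert_of_mem hy, hy'⟩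

lemma measure_cluster_succ_le (hadj : ∀ x y, adj x y ↔ y ∈ G.nbr x)
    (h : IsIDLA adj G.root P I Y) (n : ℕ) (B : Finset V) :
    P {ω | I (n + 1) ω = B} ≤ ∑' A : Finset V, ∑ y ∈ G.bd A,
      if insert y A = B then P {ω | I n ω = A ∧ Y (n + 1) ω = y} else 0 := by
  have := G.countable
  have hsub : {ω | I (n + 1) ω = B} ⊆ ⋃ A : Finset V, ⋃ y ∈ (G.bd A).filter (insert · A = B),
      {ω | I n ω = A ∧ Y (n + 1) ω = y} := by
    intro ω hω
    have hω' : I (n + 1) ω = B := hω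
    refine Set.mem_iUnion.2 ⟨I n ω, Set.mem_iUnion₂.2 ⟨Y (n + 1) ω, ?_, rfl, rfl⟩⟩
    rw [Finset.mem_filter, ← G.mem_bdryA hadj]
    exact ⟨h.bdry n ω, by rw [← h.step, hω']⟩
  refine (measure_mono hsub).trans ((measure_iUnion_le _).trans (ENNReal.tsum_le_tsum fun A => ?_))
  rw [← Finset.sum_filter]
  exact measure_biUnion_finset_le _ _

lemma tsum_measure_mul_succ_le (hadj : ∀ x y, adj x y ↔ y ∈ G.nbr x)
    (h : IsIDLA adj G.root P I Y) (n : ℕ) {φ ψ : Finset V → ℝ} (hφ : ∀ A, 0 ≤ φ A)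
    (hle : ∀ A, G.root ∈ A → G.exitMean adj A (fun y => φ (insert y A)) G.root ≤ ψ A) :
    ∑' B : Finset V, P {ω | I (n + 1) ω = B} * ENNReal.ofReal (φ B)
      ≤ ∑' A : Finset V, P {ω | I n ω = A} * ENNReal.ofReal (ψ A) := by
  calc ∑' B : Finset V, P {ω | I (n + 1) ω = B} * ENNReal.ofReal (φ B)
      ≤ ∑' B : Finset V, ∑' A : Finset V, ∑ y ∈ G.bd A,
          if insert y A = B then P {ω | I n ω = A ∧ Y (n + 1) ω = y} * ENNReal.ofReal (φ B)
          else 0 := by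
        refine ENNReal.tsum_le_tsum fun B => ?_
        refine (mul_le_mul_left (G.measure_cluster_succ_le hadj h n B) _).trans_eq ?_
        simp only [← ENNReal.tsum_mul_right, Finset.sum_mul, ite_mul, zero_mul]
    _ = ∑' A : Finset V, ∑ y ∈ G.bd A,
          P {ω | I n ω = A ∧ Y (n + 1) ω = y} * ENNReal.ofReal (φ (insert y A)) := by
        rw [ENNReal.tsum_comm]
        refine tsum_congr fun A => ?_
        rw [Summable.tsum_finsetSum fun _ _ => ENNReal.summable]
        refine Finset.sum_congr rfl fun y _ => ?_
        rw [tsum_eq_single (insert y A) fun B hB => if_neg fun h => hB h.symm, if_pos rfl]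
    _ ≤ _ := by
        refine ENNReal.tsum_le_tsum fun A => ?_
        by_cases hA : G.root ∈ A
        · calc ∑ y ∈ G.bd A, P {ω | I n ω = A ∧ Y (n + 1) ω = y} * ENNReal.ofReal (φ (insert y A))
              = P {ω | I n ω = A} * ENNReal.ofReal
                  (G.exitMean adj A (fun y => φ (insert y A)) G.root) := by
                rw [exitMean, ENNReal.ofReal_sum_of_nonneg fun y _ =>
                  mul_nonneg (G.hitMA_nonneg hadj _ _ _) (hφ _), Finset.mul_sum]
                refine Finset.sum_congr rfl fun y hy => ?_
                rw [h.law n A y ((G.mem_bdryA hadj).2 hy),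
                  ENNReal.ofReal_mul (G.hitMA_nonneg hadj _ _ _)]
                ring
            _ ≤ _ := mul_le_mul_right (ENNReal.ofReal_le_ofReal (hle A hA)) _
        · have hem : {ω | I n ω = A} = ∅ := by
            ext ω
            simp only [Set.mem_ofPred_eq, Set.mem_empty_iff_false, iff_false]
            rintro rfl
            exact hA (G.root_mem_cluster h n ω)
          refine le_of_eq_of_le (Finset.sum_eq_zero fun y _ => ?_) zero_le
          rw [measure_mono_null (fun ω hω => hω.1) (by rw [hem]; simp : P {ω | I n ω = A} = 0),
            zero_mul]

/-- Bad clusters are unlikely if a small supermartingale is large on them. -/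
lemma measure_bad_le [IsProbabilityMeasure P] (hadj : ∀ x y, adj x y ↔ y ∈ G.nbr x)
    (h : IsIDLA adj G.root P I Y) (T : ℕ) {Φ : ℕ → Finset V → ℝ} (hΦ : ∀ t A, 0 ≤ Φ t A)
    (hle : ∀ t A, G.root ∈ A → G.exitMean adj A (fun y => Φ (t + 1) (insert y A)) G.root ≤ Φ t A)
    {Bad : Finset V → Prop} (hbad : ∀ A, G.root ∈ A → A.card = T + 1 → Bad A → 1 ≤ Φ T A) :
    P {ω | Bad (I T ω)} ≤ ENNReal.ofReal (Φ 0 {G.root}) := by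
  classical
  have := G.countable
  have hW : ∀ t, ∑' A : Finset V, P {ω | I t ω = A} * ENNReal.ofReal (Φ t A)
      ≤ ENNReal.ofReal (Φ 0 {G.root}) := by
    intro t
    induction t with
    | zero =>
      rw [tsum_eq_single {G.root}]
      · exact mul_le_of_le_one_left' prob_le_one
      · intro A hA
        have : {ω | I 0 ω = A} = ∅ := by
          ext ω; simp [h.zero, hA.symm]
        simp [this]
    | succ t ih => exact (G.tsum_measure_mul_succ_le hadj h t (hΦ _) (hle t)).trans ih
  refine le_trans ?_ (hW T)
  have hsub : {ω | Bad (I T ω)} ⊆ ⋃ A : Finset V, {ω | I T ω = A ∧ Bad A} := fun ω hω =>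
    Set.mem_iUnion.2 ⟨I T ω, rfl, hω⟩
  refine (measure_mono hsub).trans ((measure_iUnion_le _).trans (ENNReal.tsum_le_tsum fun A => ?_))
  by_cases hA : ∃ ω, I T ω = A ∧ Bad A
  · obtain ⟨ω, rfl, hB⟩ := hA
    refine le_trans (measure_mono fun ω' hω' => hω'.1) (le_mul_of_one_le_right' ?_)
    exact ENNReal.one_le_ofReal.2
      (hbad _ (G.root_mem_cluster h T ω) (G.card_cluster h T ω) hB)
  · have : {ω | I T ω = A ∧ Bad A} = ∅ := by
      ext ω
      simp only [Set.mem_ofPred_eq, Set.mem_empty_iff_false, iff_false]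
      exact fun hω => hA ⟨ω, hω⟩
    simp [this]

end LeveledGraph

lemma Real.exp_neg_le_quadratic {x : ℝ} (h0 : 0 ≤ x) (h1 : x ≤ 1) :
    Real.exp (-x) ≤ 1 - x + x ^ 2 := by
  have h := Real.abs_exp_sub_one_sub_id_le (x := -x) (by rw [abs_neg, abs_of_nonneg h0]; exact h1)
  have := (abs_le.1 h).2
  nlinarith

namespace LeveledGraph

variable {V : Type*} [DecidableEq V] (G : LeveledGraph V)
  {adj : V → V → Prop} {Ω : Type*}
  [MeasurableSpace Ω] {P : Measure Ω}
  {I : ℕ → Ω → Finset V} {Y : ℕ → Ω → V}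

/-- A function that is subharmonic except at `z` controls the probability that `z` is missing. -/
lemma measure_notMem_le [IsProbabilityMeasure P] (hadj : ∀ x y, adj x y ↔ y ∈ G.nbr x)
    (h : IsIDLA adj G.root P I Y) {T : ℕ} (hT : 0 < T) {z : V} {p : V → ℝ} (hp0 : ∀ x, 0 ≤ p x)
    (hp1 : ∀ x, p x ≤ 1) {S : Finset V} (hpS : ∀ x, x ∉ S → p x = 0)
    (hp : ∀ x, x ≠ z → 0 ≤ G.lap p x) {s : ℝ} (hs0 : 0 ≤ s)
    (hs : s ≤ T * p G.root - ∑ x ∈ S, p x) :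
    P {ω | z ∉ I T ω} ≤ ENNReal.ofReal (Real.exp (-(s ^ 2 / (4 * T)))) := by
  have hT' : (0 : ℝ) < T := Nat.cast_pos.2 hT
  set l : ℝ := s / (2 * T) with hl
  have hl0 : 0 ≤ l := by positivity
  have hsT : s ≤ T := by
    have h1 : 0 ≤ ∑ x ∈ S, p x := Finset.sum_nonneg fun x _ => hp0 x
    nlinarith [hp1 G.root]
  have hl1 : l ≤ 1 := by rw [hl, div_le_one (by positivity)]; linarith
  have hmain := G.measure_bad_le hadj h T
    (Φ := fun t A => Real.exp (-(s ^ 2 / (4 * T))) * if z ∈ A then 0 else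
      Real.exp (l * (t * p G.root - ∑ x ∈ A, p x) - l ^ 2 * t))
    (fun t A => by positivity) (fun t A hA => ?_) (Bad := fun A => z ∉ A)
    (fun A _ _ hz => ?_)
  · refine hmain.trans (ENNReal.ofReal_le_ofReal (mul_le_of_le_one_right (by positivity) ?_))
    split_ifs
    · exact zero_le_one
    · rw [Real.exp_le_one_iff]
      simpa using mul_nonneg hl0 (hp0 _)
  · rw [exitMean_const_mul]
    refine mul_le_mul_of_nonneg_left ?_ (by positivity)
    by_cases hz : z ∈ A
    · rw [if_pos hz]
      refine (G.exitMean_mono hadj (F' := fun _ => 0) (fun y hy => ?_) _).trans_eq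
        (G.exitMean_const hadj hA 0)
      rw [if_pos (Finset.mem_insert_of_mem hz)]
    · rw [if_neg hz]
      set E := Real.exp (l * (t * p G.root - ∑ x ∈ A, p x) - l ^ 2 * t) with hE
      set c := E * Real.exp (l * p G.root - l ^ 2) with hc
      have hc0 : 0 < c := by positivity
      have hsub : p G.root ≤ G.exitMean adj A p G.root :=
        G.le_exitMean hadj (fun x hx => hp x (by rintro rfl; exact hz hx)) hA
      calc _ ≤ G.exitMean adj A (fun y => c * (1 + l ^ 2) + (-(c * l)) * p y) G.root := by
            refine G.exitMean_mono hadj (fun y hy => ?_) _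
            have hyA : y ∉ A := (G.mem_bd.1 hy).1
            have h1 : Real.exp (-(l * p y)) ≤ 1 - l * p y + (l * p y) ^ 2 :=
              Real.exp_neg_le_quadratic (mul_nonneg hl0 (hp0 y)) (mul_le_one₀ hl1 (hp0 y) (hp1 y))
            have h2 : (l * p y) ^ 2 ≤ l ^ 2 :=
              pow_le_pow_left₀ (mul_nonneg hl0 (hp0 y)) (mul_le_of_le_one_right hl0 (hp1 y)) 2
            have h3 : Real.exp (l * (((t + 1 : ℕ) : ℝ) * p G.root - ∑ x ∈ insert y A, p x)
                - l ^ 2 * ((t + 1 : ℕ) : ℝ)) = c * Real.exp (-(l * p y)) := by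
              rw [Finset.sum_insert hyA, hc, hE, ← Real.exp_add, ← Real.exp_add]
              congr 1
              push_cast; ring
            have h4 : c * Real.exp (-(l * p y)) ≤ c * (1 + l ^ 2) + (-(c * l)) * p y := by
              nlinarith
            split_ifs
            · exact le_trans (by positivity) h4
            · rw [h3]; exact h4
        _ = c * (1 + l ^ 2) - c * l * G.exitMean adj A p G.root := by
            rw [exitMean_add, G.exitMean_const_mul (-(c * l)) p, G.exitMean_const hadj hA]; ring
        _ ≤ c * (1 + (l ^ 2 - l * p G.root)) := by
            nlinarith [mul_le_mul_of_nonneg_left hsub (mul_nonneg hc0.le hl0)]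
        _ ≤ c * Real.exp (l ^ 2 - l * p G.root) := by
            refine mul_le_mul_of_nonneg_left ?_ hc0.le
            linarith [Real.add_one_le_exp (l ^ 2 - l * p G.root)]
        _ = E := by
            rw [hc, mul_assoc, ← Real.exp_add]
            simp
  · rw [if_neg hz, ← Real.exp_add]
    refine Real.one_le_exp ?_
    have h1 : ∑ x ∈ A, p x ≤ ∑ x ∈ S, p x := by
      rw [← Finset.sum_filter_add_sum_filter_not A (· ∈ S),
        Finset.sum_eq_zero (s := A.filter (¬ · ∈ S)) fun x hx => hpS x (Finset.mem_filter.1 hx).2,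
        add_zero]
      exact Finset.sum_le_sum_of_subset_of_nonneg (fun x hx => (Finset.mem_filter.1 hx).2)
        fun x _ _ => hp0 x
    have h2 : l * s ≤ l * (T * p G.root - ∑ x ∈ A, p x) :=
      mul_le_mul_of_nonneg_left (by linarith) hl0
    have h3 : l * s - l ^ 2 * T = s ^ 2 / (4 * T) := by rw [hl]; field_simp; ring
    linarith

end LeveledGraph

lemma MeasureTheory.ae_eventually_notMem_of_le_ofReal {Ω : Type*} [MeasurableSpace Ω]
    {P : Measure Ω} {E : ℕ → Set Ω} {f : ℕ → ℝ} (hf : Summable f) (hf0 : ∀ n, 0 ≤ f n) {N : ℕ}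
    (h : ∀ n, N ≤ n → P (E n) ≤ ENNReal.ofReal (f n)) : ∀ᵐ ω ∂P, ∀ᶠ n in atTop, ω ∉ E n := by
  have h1 : ∑' n, P (E (n + N)) ≠ ⊤ := by
    have hs : Summable fun n => f (n + N) := (summable_nat_add_iff N).2 hf
    refine ne_top_of_le_ne_top ?_ (ENNReal.tsum_le_tsum fun n => h (n + N) (by omega))
    rw [← ENNReal.ofReal_tsum_of_nonneg (fun n => hf0 _) hs]
    exact ENNReal.ofReal_ne_top
  filter_upwards [ae_eventually_notMem h1] with ω hω
  rw [eventually_atTop] at hω ⊢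
  obtain ⟨M, hM⟩ := hω
  refine ⟨M + N, fun n hn => ?_⟩
  have := hM (n - N) (by omega)
  rwa [Nat.sub_add_cancel (by omega)] at this

namespace Gasket

lemma card_ball_le (m : ℕ) : (graph.ball m).card ≤ 2 * m ^ 2 := by
  have hsub : graph.ball m ⊆ ((Finset.univ : Finset Bool) ×ˢ Finset.range m ×ˢ Finset.range m).image
      fun t => vtx t.1 t.2.1 t.2.2 := by
    intro x hx
    obtain ⟨s, a, b, hv, rfl⟩ := exists_vtx x
    rw [mem_ball, level_vtx hv] at hx
    exact Finset.mem_image.2 ⟨(s, a, b), by simp; omega, rfl⟩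
  refine (Finset.card_le_card hsub).trans (Finset.card_image_le.trans_eq ?_)
  simp [pow_two]

variable {Ω : Type*} [MeasurableSpace Ω] {P : Measure Ω} {I : ℕ → Ω → Finset SG} {Y : ℕ → Ω → SG}

lemma measure_notMem_ball_le [IsProbabilityMeasure P] (h : IsIDLA sgAdj origin P I Y) (D : ℕ) :
    ∃ c > 0, ∀ n k, 2 ^ k ≤ n → n < 2 ^ (k + 1) → D ≤ k → ∀ z, level z + 2 ^ (k - D + 1) ≤ n →
      P {ω | z ∉ I (graph.ball (n + 1)).card ω} ≤ ENNReal.ofReal (Real.exp (-(c * n))) := by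
  refine ⟨(3 / (520 * 5 ^ D)) ^ 2 / 64, by positivity, fun n k hkn hnk hD z hz => ?_⟩
  obtain ⟨p, hpz, hp0, hp1, hpS, hp, hs⟩ := exists_potential_deficit hz hnk.le
  have hT : 0 < (graph.ball (n + 1)).card :=
    Finset.card_pos.2 ⟨origin, by rw [mem_ball, level_origin]; omega⟩
  refine (graph.measure_notMem_le adj_iff h hT hp0 hp1 hpS hp (by positivity) hs).trans
    (ENNReal.ofReal_le_ofReal (Real.exp_le_exp.2 (neg_le_neg ?_)))
  have hT1 : ((graph.ball (n + 1)).card : ℝ) ≤ 8 * 4 ^ k := by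
    have h1 := card_ball_le (n + 1)
    have h2 : (n + 1) ^ 2 ≤ (2 ^ (k + 1)) ^ 2 := Nat.pow_le_pow_left hnk 2
    have h3 : (2 ^ (k + 1)) ^ 2 = 4 * 4 ^ k := by
      rw [← pow_mul, mul_comm, pow_mul, pow_succ]; norm_num; ring
    have : (graph.ball (n + 1)).card ≤ 8 * 4 ^ k := by omega
    exact_mod_cast this
  have hT0 : (0 : ℝ) < (graph.ball (n + 1)).card := Nat.cast_pos.2 hT
  have hs1 : (3 / 5 : ℝ) ^ (k + 1) * 5 ^ (k - D) / 104 = 3 / (520 * 5 ^ D) * 3 ^ k := by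
    have : (5 : ℝ) ^ k = 5 ^ (k - D) * 5 ^ D := by rw [← pow_add]; congr 1; omega
    rw [div_pow, pow_succ 5, pow_succ, this]
    field_simp
    norm_num
  rw [hs1, le_div_iff₀ (by positivity)]
  have hn : (n : ℝ) ≤ 2 * 2 ^ k := by exact_mod_cast (by rw [← pow_succ']; exact hnk.le)
  set e : ℝ := 3 / (520 * 5 ^ D)
  have h9 : (2 : ℝ) ^ k * 4 ^ k ≤ (3 ^ k) ^ 2 := by
    rw [← mul_pow, ← pow_mul, mul_comm k, pow_mul]
    exact pow_le_pow_left₀ (by norm_num) (by norm_num) k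
  calc e ^ 2 / 64 * n * (4 * (graph.ball (n + 1)).card)
      ≤ e ^ 2 / 64 * (2 * 2 ^ k) * (4 * (8 * 4 ^ k)) := by gcongr
    _ = e ^ 2 * (2 ^ k * 4 ^ k) := by ring
    _ ≤ e ^ 2 * (3 ^ k) ^ 2 := by gcongr
    _ = _ := by ring

/-- The inner bound: almost surely, the cluster eventually contains a large ball. -/
lemma ae_eventually_ball_subset [IsProbabilityMeasure P] (h : IsIDLA sgAdj origin P I Y) (D : ℕ) :
    ∀ᵐ ω ∂P, ∀ᶠ n : ℕ in atTop, ∀ z, level z + 2 ^ (Nat.log 2 n - D + 1) ≤ n →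
      z ∈ I (graph.ball (n + 1)).card ω := by
  obtain ⟨c, hc, hle⟩ := measure_notMem_ball_le h D
  have hsum : Summable fun n : ℕ => 2 * ((n : ℝ) ^ 2 * Real.exp (-c * n)) :=
    (Real.summable_pow_mul_exp_neg_nat_mul 2 hc).mul_left 2
  have := ae_eventually_notMem_of_le_ofReal (P := P) (N := 2 ^ D)
    (E := fun n => {ω | ∃ z, level z + 2 ^ (Nat.log 2 n - D + 1) ≤ n ∧
      z ∉ I (graph.ball (n + 1)).card ω}) hsum (fun n => by positivity) fun n hn => ?_
  · filter_upwards [this] with ω hω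
    filter_upwards [hω] with n hn z hz
    by_contra hzI
    exact hn ⟨z, hz, hzI⟩
  have hn0 : n ≠ 0 := by
    rintro rfl
    exact absurd hn (by simp)
  have hsub : {ω | ∃ z, level z + 2 ^ (Nat.log 2 n - D + 1) ≤ n ∧
      z ∉ I (graph.ball (n + 1)).card ω} ⊆
      ⋃ z ∈ (graph.ball n).filter (fun z => level z + 2 ^ (Nat.log 2 n - D + 1) ≤ n),
        {ω | z ∉ I (graph.ball (n + 1)).card ω} := by
    rintro ω ⟨z, hz, hzI⟩
    have : 0 < 2 ^ (Nat.log 2 n - D + 1) := by positivity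
    refine Set.mem_iUnion₂.2 ⟨z, ?_, hzI⟩
    rw [Finset.mem_filter, mem_ball]
    exact ⟨by omega, hz⟩
  refine (measure_mono hsub).trans ((measure_biUnion_finset_le _ _).trans ?_)
  refine (Finset.sum_le_card_nsmul _ _ (ENNReal.ofReal (Real.exp (-(c * n)))) fun z hz => ?_).trans ?_
  · exact hle n _ (Nat.pow_log_le_self 2 hn0) (Nat.lt_pow_succ_log_self (by norm_num) n)
      (Nat.le_log_of_pow_le (by norm_num) hn) z (Finset.mem_filter.1 hz).2
  · rw [nsmul_eq_mul, ← ENNReal.ofReal_natCast, ← ENNReal.ofReal_mul (by positivity)]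
    refine ENNReal.ofReal_le_ofReal ?_
    have h1 := (Finset.card_filter_le (graph.ball n)
      (fun z => level z + 2 ^ (Nat.log 2 n - D + 1) ≤ n)).trans (card_ball_le n)
    have h2 : ((((graph.ball n).filter
      (fun z => level z + 2 ^ (Nat.log 2 n - D + 1) ≤ n)).card : ℕ) : ℝ) ≤ 2 * n ^ 2 := by
      exact_mod_cast h1
    rw [neg_mul, ← mul_assoc]
    exact mul_le_mul_of_nonneg_right h2 (by positivity)

end Gasket

namespace Gasket

lemma isBase.add_lt : ∀ {J a b : ℕ}, isBase a b → a < 2 ^ J → b < 2 ^ J → a + b < 2 ^ J := by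
  intro J
  induction J with
  | zero => intro a b _ ha hb; simp at *; omega
  | succ J ih =>
    intro a b h ha hb
    rw [isBase_iff_half] at h
    have := ih h.1 (by omega) (by omega)
    omega

lemma isBase_add_iff : ∀ {J a b c d : ℕ}, c < 2 ^ J → d < 2 ^ J →
    (isBase (2 ^ J * a + c) (2 ^ J * b + d) ↔ isBase a b ∧ isBase c d) := by
  intro J
  induction J with
  | zero =>
    intro a b c d hc hd
    have : isBase 0 0 := isBase_zero_left 0
    simp at hc hd
    subst hc hd
    simp [this]
  | succ J ih =>
    intro a b c d hc hd
    have hp : 2 ^ (J + 1) = 2 * 2 ^ J := by ring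
    have e : ∀ a c : ℕ, (2 ^ (J + 1) * a + c) / 2 = 2 ^ J * a + c / 2 ∧
        (2 ^ (J + 1) * a + c) % 2 = c % 2 := by
      intro a c
      rw [hp, mul_assoc]; omega
    rw [isBase_iff_half, (e a c).1, (e a c).2, (e b d).1, (e b d).2, ih (by omega) (by omega),
      isBase_iff_half c d, and_assoc]

/-- Division of the lower corner of a triangle by `2 ^ J`. -/
lemma isBase.exists_cell {a b : ℕ} (h : isBase a b) (J : ℕ) : ∃ w v c d, a = 2 ^ J * w + c ∧
    b = 2 ^ J * v + d ∧ c + d < 2 ^ J ∧ isBase w v ∧ isBase c d := by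
  have hp : 0 < 2 ^ J := by positivity
  refine ⟨a / 2 ^ J, b / 2 ^ J, a % 2 ^ J, b % 2 ^ J, (Nat.div_add_mod _ _).symm,
    (Nat.div_add_mod _ _).symm, ?_⟩
  rw [← Nat.div_add_mod a (2 ^ J), ← Nat.div_add_mod b (2 ^ J),
    isBase_add_iff (Nat.mod_lt _ hp) (Nat.mod_lt _ hp)] at h
  exact ⟨h.2.add_lt (Nat.mod_lt _ hp) (Nat.mod_lt _ hp), h⟩

lemma isBase.exists_half_cell {J a b l : ℕ} (h : isBase a b) (hl : 2 ^ (J + 1) ∣ l)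
    (hab : a + b = l + 2 ^ J) : ∃ w v, isBase w v ∧ 2 ^ (J + 1) * (w + v) = l ∧
      ((a = 2 ^ (J + 1) * w + 2 ^ J ∧ b = 2 ^ (J + 1) * v) ∨
        (a = 2 ^ (J + 1) * w ∧ b = 2 ^ (J + 1) * v + 2 ^ J)) := by
  obtain ⟨w, v, c, d, rfl, rfl, hcd, hwv, hb⟩ := h.exists_cell (J + 1)
  obtain ⟨u, rfl⟩ := hl
  have hp : 2 ^ (J + 1) = 2 ^ J + 2 ^ J := two_pow_succ' J
  have h0 : 0 < 2 ^ J := by positivity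
  have e : c + d = 2 ^ J := by
    have h1 : (2 ^ (J + 1) * (w + v) + (c + d)) % 2 ^ (J + 1) = c + d := by
      rw [Nat.mul_add_mod, Nat.mod_eq_of_lt hcd]
    have h2 : (2 ^ (J + 1) * u + 2 ^ J) % 2 ^ (J + 1) = 2 ^ J := by
      rw [Nat.mul_add_mod, Nat.mod_eq_of_lt (by omega)]
    rw [← h1, ← h2]
    congr 1
    rw [mul_add]; omega
  refine ⟨w, v, hwv, ?_, ?_⟩
  · rw [mul_add]; omega
  · rcases (isBase_iff_top J (by omega)).1 hb with h | h | h
    · omega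
    · exact Or.inl (by omega)
    · exact Or.inr (by omega)

/-- The function on a cell of side `M` with lower corner `(a₀, b₀)`, extended by zero. -/
def onCell (M a₀ b₀ : ℕ) (f : ℕ → ℕ → ℝ) (a b : ℕ) : ℝ :=
  if a₀ ≤ a ∧ b₀ ≤ b ∧ a + b ≤ a₀ + b₀ + M then f (a - a₀) (b - b₀) else 0

lemma onCell_eq_zero {J w v : ℕ} {f : ℕ → ℕ → ℝ} (h0 : f 0 0 = 0) (h1 : f (2 ^ J) 0 = 0)
    (h2 : f 0 (2 ^ J) = 0) {w' v' c d : ℕ} (hne : ¬ (w' = w ∧ v' = v)) (hcd : c + d < 2 ^ J)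
    {a b : ℕ} (hab : (a = 2 ^ J * w' + c ∧ b = 2 ^ J * v' + d) ∨
      (a = 2 ^ J * w' + c + 1 ∧ b = 2 ^ J * v' + d) ∨ (a = 2 ^ J * w' + c ∧ b = 2 ^ J * v' + d + 1)) :
    onCell (2 ^ J) (2 ^ J * w) (2 ^ J * v) f a b = 0 := by
  unfold onCell
  split_ifs with h
  swap; · rfl
  obtain ⟨ha, hb, hle⟩ := h
  generalize 2 ^ J = M at *
  have mlt : ∀ x y : ℕ, x < y → M * x + M ≤ M * y := fun x y hxy => by
    rw [← Nat.mul_succ]; exact Nat.mul_le_mul_left _ hxy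
  have m2 : ∀ x y : ℕ, x + 1 < y → M * x + M + M ≤ M * y := fun x y hxy => by
    rw [← Nat.mul_succ, ← Nat.mul_succ]; exact Nat.mul_le_mul_left _ hxy
  have m1 : ∀ x y : ℕ, x + 1 = y → M * x + M = M * y := fun x y hxy => by
    rw [← hxy, Nat.mul_succ]
  have key : (a - M * w = 0 ∧ b - M * v = 0) ∨ (a - M * w = M ∧ b - M * v = 0) ∨
      (a - M * w = 0 ∧ b - M * v = M) := by
    have t1 : w' + 1 < w ∨ w' + 1 = w ∨ w' = w ∨ w + 1 = w' ∨ w + 1 < w' := by omega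
    have t2 : v' + 1 < v ∨ v' + 1 = v ∨ v' = v ∨ v + 1 = v' ∨ v + 1 < v' := by omega
    have g1 := m1 w' w
    have g2 := m1 w w'
    have g3 := m2 w' w
    have g4 := m2 w w'
    have k1 := m1 v' v
    have k2 := m1 v v'
    have k3 := m2 v' v
    have k4 := m2 v v'
    rcases t1 with t | t | t | t | t <;> rcases t2 with t' | t' | t' | t' | t' <;>
      simp only [t, t', forall_const] at g1 g2 g3 g4 k1 k2 k3 k4 <;>
      first | omega | (subst t t'; omega)
  rcases key with ⟨e1, e2⟩ | ⟨e1, e2⟩ | ⟨e1, e2⟩ <;> rw [e1, e2] <;> assumption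

lemma triForm_self_nonneg (α β γ : ℝ) : 0 ≤ triForm α β γ α β γ := by
  unfold triForm
  nlinarith [sq_nonneg (α - β), sq_nonneg (α - γ), sq_nonneg (β - γ)]

/-- The shift of the triangles of a cell. -/
lemma sum_shift_le {J w v : ℕ} (hwv : isBase w v) {R : ℕ} (hR : 2 ^ J * w + 2 ^ J * v + 2 ^ J ≤ R)
    {F : ℕ × ℕ → ℝ} (hF : ∀ t, 0 ≤ F t) :
    ∑ t ∈ tset (2 ^ J), F (2 ^ J * w + t.1, 2 ^ J * v + t.2) ≤ ∑ t ∈ tset R, F t := by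
  rw [← Finset.sum_image (s := tset (2 ^ J)) (g := fun t => (2 ^ J * w + t.1, 2 ^ J * v + t.2))
    (f := F)]
  · refine Finset.sum_le_sum_of_subset_of_nonneg (fun t ht => ?_) fun t _ _ => hF t
    obtain ⟨u, hu, rfl⟩ := Finset.mem_image.1 ht
    rw [mem_tset] at hu ⊢
    dsimp only
    exact ⟨(isBase_add_iff (by omega) (by omega)).2 ⟨hwv, hu.1⟩, by omega⟩
  · rintro ⟨a, b⟩ _ ⟨c, d⟩ _ h
    simpa using h

lemma energy_onCell_le {J w v : ℕ} {f : ℕ → ℕ → ℝ} (h0 : f 0 0 = 0) (h1 : f (2 ^ J) 0 = 0)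
    (h2 : f 0 (2 ^ J) = 0) (R : ℕ) :
    energy R (onCell (2 ^ J) (2 ^ J * w) (2 ^ J * v) f) (onCell (2 ^ J) (2 ^ J * w) (2 ^ J * v) f)
      ≤ energy (2 ^ J) f f := by
  set W := onCell (2 ^ J) (2 ^ J * w) (2 ^ J * v) f with hW
  set F : ℕ × ℕ → ℝ := fun t => triForm (W t.1 t.2) (W (t.1 + 1) t.2) (W t.1 (t.2 + 1))
    (W t.1 t.2) (W (t.1 + 1) t.2) (W t.1 (t.2 + 1)) with hFdef
  have hF : ∀ t, 0 ≤ F t := fun t => triForm_self_nonneg _ _ _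
  set φ : ℕ × ℕ → ℕ × ℕ := fun t => (2 ^ J * w + t.1, 2 ^ J * v + t.2) with hφ
  have hz : ∀ t ∈ tset R, t ∉ (tset (2 ^ J)).image φ → F t = 0 := by
    rintro ⟨a, b⟩ ht hn
    obtain ⟨w', v', c, d, ha, hb, hcd, -, hb'⟩ := (mem_tset.1 ht).1.exists_cell J
    dsimp only at ha hb
    have hne : ¬ (w' = w ∧ v' = v) := by
      rintro ⟨rfl, rfl⟩
      exact hn (Finset.mem_image.2 ⟨(c, d), mem_tset.2 ⟨hb', hcd⟩, by simp [hφ, ha, hb]⟩)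
    have z1 : W a b = 0 := onCell_eq_zero h0 h1 h2 hne hcd (Or.inl ⟨ha, hb⟩)
    have z2 : W (a + 1) b = 0 := onCell_eq_zero h0 h1 h2 hne hcd (Or.inr (Or.inl ⟨by omega, hb⟩))
    have z3 : W a (b + 1) = 0 := onCell_eq_zero h0 h1 h2 hne hcd (Or.inr (Or.inr ⟨ha, by omega⟩))
    simp [hFdef, z1, z2, z3, triForm]
  calc energy R W W = ∑ t ∈ (tset R).filter (· ∈ (tset (2 ^ J)).image φ), F t := by
        rw [Finset.sum_filter]
        refine Finset.sum_congr rfl fun t ht => ?_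
        split_ifs with h
        · rfl
        · exact hz t ht h
    _ ≤ ∑ t ∈ (tset (2 ^ J)).image φ, F t :=
        Finset.sum_le_sum_of_subset_of_nonneg (fun t ht => (Finset.mem_filter.1 ht).2)
          fun t _ _ => hF t
    _ = ∑ t ∈ tset (2 ^ J), F (φ t) := by
        refine Finset.sum_image ?_
        rintro ⟨a, b⟩ _ ⟨c, d⟩ _ h
        simpa [hφ] using h
    _ = energy (2 ^ J) f f := by
        refine Finset.sum_congr rfl fun t ht => ?_
        have hlt := (mem_tset.1 ht).2
        have e : ∀ c d, c + d ≤ 2 ^ J → W (2 ^ J * w + c) (2 ^ J * v + d) = f c d := by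
          intro c d hcd
          rw [hW, onCell, if_pos ⟨by omega, by omega, by omega⟩]
          congr 1 <;> omega
        simp only [hFdef, hφ, add_assoc]
        rw [e _ _ (by omega), e _ _ (by omega), e _ _ (by omega)]

lemma energy_sub_smul (R : ℕ) (c : ℝ) (f g : ℕ → ℕ → ℝ) :
    energy R (fun a b => f a b - c * g a b) (fun a b => f a b - c * g a b)
      = energy R f f - 2 * c * energy R f g + c ^ 2 * energy R g g := by
  unfold energy
  rw [Finset.mul_sum, Finset.mul_sum, ← Finset.sum_sub_distrib, ← Finset.sum_add_distrib]
  exact Finset.sum_congr rfl fun t _ => by unfold triForm; ring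

lemma energy₂_sub_smul_nonneg (R : ℕ) (c : ℝ) (f g : SG → ℝ) :
    0 ≤ energy₂ R f f - 2 * c * energy₂ R f g + c ^ 2 * energy₂ R g g := by
  have h : ∀ s, 0 ≤ energy R (fun a b => f (vtx s a b)) (fun a b => f (vtx s a b))
      - 2 * c * energy R (fun a b => f (vtx s a b)) (fun a b => g (vtx s a b))
      + c ^ 2 * energy R (fun a b => g (vtx s a b)) (fun a b => g (vtx s a b)) := by
    intro s
    rw [← energy_sub_smul]
    exact energy_nonneg _ _
  unfold energy₂
  linarith [h true, h false]

/-- A side on which a vertex lies. -/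
noncomputable def side (x : SG) : Bool := (exists_vtx x).choose

lemma side_vtx {s : Bool} {a b : ℕ} (h : isVert a b) (h0 : a + b ≠ 0) : side (vtx s a b) = s := by
  have hs := (exists_vtx (vtx s a b)).choose_spec.choose_spec.choose_spec
  have := (vtx_inj h hs.1).1 hs.2
  exact (this.2.2.resolve_right h0).symm

/-- A function of coordinates on one side, extended by zero to the other side. -/
noncomputable def liftSide (s : Bool) (W : ℕ → ℕ → ℝ) (x : SG) : ℝ :=
  if side x = s then lift W x else 0

lemma liftSide_vtx {s s' : Bool} {W : ℕ → ℕ → ℝ} (hW : W 0 0 = 0) {a b : ℕ} (h : isVert a b) :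
    liftSide s W (vtx s' a b) = if s' = s then W a b else 0 := by
  unfold liftSide
  rw [lift_vtx h]
  by_cases h0 : a + b = 0
  · obtain ⟨rfl, rfl⟩ : a = 0 ∧ b = 0 := by omega
    simp [hW]
  · rw [side_vtx h h0]

lemma energy₂_liftSide {s : Bool} {W : ℕ → ℕ → ℝ} (hW : W 0 0 = 0) (R : ℕ) :
    energy₂ R (liftSide s W) (liftSide s W) = energy R W W := by
  have e : ∀ s', energy R (fun a b => liftSide s W (vtx s' a b))
      (fun a b => liftSide s W (vtx s' a b)) = if s' = s then energy R W W else 0 := by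
    intro s'
    split_ifs with h
    · exact energy_congr_vert (fun a b hv => by rw [liftSide_vtx hW hv, if_pos h])
        (fun a b hv => by rw [liftSide_vtx hW hv, if_pos h])
    · rw [energy_congr_vert (f' := fun _ _ => 0) (g' := fun _ _ => 0)
        (fun a b hv => by rw [liftSide_vtx hW hv, if_neg h])
        (fun a b hv => by rw [liftSide_vtx hW hv, if_neg h]), energy_const]
  rw [energy₂, e, e]
  cases s <;> simp

lemma sq_sub_shift_le {i w v R : ℕ} (h : isBase w v) (hR : 2 ^ i * w + 2 ^ i * v + 2 ^ i ≤ R)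
    (f : ℕ → ℕ → ℝ) {t : ℕ × ℕ} (ht : t ∈ tset (2 ^ i)) :
    (3 / 5) ^ i * (f (2 ^ i * w + t.1) (2 ^ i * v + t.2) - f (2 ^ i * w) (2 ^ i * v)) ^ 2
      ≤ 25 * energy R f f := by
  have h1 := (sq_sub_le i (fun a b => f (2 ^ i * w + a) (2 ^ i * v + b)) t ht).1
  have h2 := sum_shift_le h hR (F := fun t => triForm (f t.1 t.2) (f (t.1 + 1) t.2)
    (f t.1 (t.2 + 1)) (f t.1 t.2) (f (t.1 + 1) t.2) (f t.1 (t.2 + 1)))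
    fun t => triForm_self_nonneg _ _ _
  simp only [add_zero] at h1
  have h3 : energy (2 ^ i) (fun a b => f (2 ^ i * w + a) (2 ^ i * v + b))
      (fun a b => f (2 ^ i * w + a) (2 ^ i * v + b)) ≤ energy R f f := h2
  linarith

/-- A function of small energy supported in the cell of side `2 ^ (j + 1)` around a vertex
`(a, b)` in the middle of its lower sides, which is large near `(a, b)`. -/
lemma exists_cell_bump {i j l a b : ℕ} (hij : i ≤ j) (hl : 2 ^ (j + 1) ∣ l) (h : isBase a b)
    (hab : a + b = l + 2 ^ j) : ∃ W : ℕ → ℕ → ℝ,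
      (∀ c d, W c d ≠ 0 → l < c + d ∧ c + d ≤ l + 2 ^ (j + 1)) ∧
      (∀ R, energy R W W ≤ 4 * (3 / 5) ^ j) ∧
      (∀ c d, c + d < 2 ^ i → 1 - (3 / 5) ^ (j - i) ≤ W (a + c) (b + d)) := by
  obtain ⟨w, v, hwv, hlev, hcase⟩ := h.exists_half_cell hl hab
  have hp := two_pow_succ' j
  have hpos : 0 < 2 ^ j := by positivity
  have hile : 2 ^ i ≤ 2 ^ j := Nat.pow_le_pow_right (by norm_num) hij
  have key : ∀ f : ℕ → ℕ → ℝ, f 0 0 = 0 → f (2 ^ (j + 1)) 0 = 0 → f 0 (2 ^ (j + 1)) = 0 →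
      energy (2 ^ (j + 1)) f f = 4 * (3 / 5) ^ j →
      (∀ c d, onCell (2 ^ (j + 1)) (2 ^ (j + 1) * w) (2 ^ (j + 1) * v) f c d ≠ 0 →
        l < c + d ∧ c + d ≤ l + 2 ^ (j + 1)) ∧ ∀ R,
      energy R (onCell (2 ^ (j + 1)) (2 ^ (j + 1) * w) (2 ^ (j + 1) * v) f)
        (onCell (2 ^ (j + 1)) (2 ^ (j + 1) * w) (2 ^ (j + 1) * v) f) ≤ 4 * (3 / 5) ^ j := by
    intro f h0 h1 h2 h3
    refine ⟨fun c d hne => ?_, fun R => (energy_onCell_le h0 h1 h2 R).trans h3.le⟩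
    unfold onCell at hne
    split_ifs at hne with hc
    · rw [mul_add] at hlev
      refine ⟨?_, by omega⟩
      by_contra hlt
      rw [show c - 2 ^ (j + 1) * w = 0 by omega, show d - 2 ^ (j + 1) * v = 0 by omega] at hne
      exact hne h0
    · exact absurd rfl hne
  have hnear : ∀ c d, c + d < 2 ^ i → 1 - (3 / 5 : ℝ) ^ (j - i) ≤ harm j 1 0 0 c d := by
    intro c d hcd
    simpa using harm_near_corner hij zero_le_one zero_le_one rfl c d hcd.le
  rcases hcase with ⟨rfl, rfl⟩ | ⟨rfl, rfl⟩
  · obtain ⟨k1, k2⟩ := key (bumpL j) (by simp [bumpL, glue, harm_corner])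
      (by simp [bumpL, glue, hp, harm_corner]) (by simp [bumpL, glue, hp]) (energy_bumpL j)
    refine ⟨_, k1, k2, fun c d hcd => ?_⟩
    have e : onCell (2 ^ (j + 1)) (2 ^ (j + 1) * w) (2 ^ (j + 1) * v) (bumpL j)
        (2 ^ (j + 1) * w + 2 ^ j + c) (2 ^ (j + 1) * v + d) = harm j 1 0 0 c d := by
      rw [onCell, if_pos ⟨by omega, by omega, by omega⟩, bumpL, glue, if_pos (by omega)]
      congr 1 <;> omega
    rw [e]
    exact hnear c d hcd
  · obtain ⟨k1, k2⟩ := key (bumpR j) (by simp [bumpR, glue, harm_corner])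
      (by simp [bumpR, glue, hp]) (by simp [bumpR, glue, hp, harm_corner]) (energy_bumpR j)
    refine ⟨_, k1, k2, fun c d hcd => ?_⟩
    have e : onCell (2 ^ (j + 1)) (2 ^ (j + 1) * w) (2 ^ (j + 1) * v) (bumpR j)
        (2 ^ (j + 1) * w + c) (2 ^ (j + 1) * v + 2 ^ j + d) = harm j 1 0 0 c d := by
      rw [onCell, if_pos ⟨by omega, by omega, by omega⟩, bumpR, glue, if_neg (by omega),
        if_pos (by omega)]
      congr 1 <;> omega
    rw [e]
    exact hnear c d hcd

lemma isBase.exists_eq_mul {i l a b : ℕ} (h : isBase a b) (hl : 2 ^ (i + 15) ∣ l)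
    (hab : a + b = l + 2 ^ (i + 14)) : ∃ w v, isBase w v ∧ a = 2 ^ i * w ∧ b = 2 ^ i * v := by
  have hpos : 0 < 2 ^ i := by positivity
  have e14 : 2 ^ (i + 14) = 2 ^ i * 16384 := by rw [pow_add]; norm_num
  have e15 : 2 ^ (i + 14 + 1) = 2 ^ i * 32768 := by rw [add_assoc, pow_add]; norm_num
  obtain ⟨w, v, -, -, hc⟩ := h.exists_half_cell hl hab
  obtain ⟨w, v, rfl, rfl⟩ : ∃ w v, a = 2 ^ i * w ∧ b = 2 ^ i * v := by
    rw [e15, e14] at hc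
    rcases hc with ⟨h1, h2⟩ | ⟨h1, h2⟩
    · exact ⟨32768 * w + 16384, 32768 * v, by rw [h1]; ring, by rw [h2]; ring⟩
    · exact ⟨32768 * w, 32768 * v + 16384, by rw [h1]; ring, by rw [h2]; ring⟩
  have := (isBase_add_iff (J := i) (a := w) (b := v) hpos hpos).1 (by simpa using h)
  exact ⟨w, v, this.1, rfl, rfl⟩

lemma half_le_of_mul_sq_le {c q κ : ℝ} (hc : 0 < c) (h : c * (1 - q) ^ 2 ≤ 25 * κ)
    (hκ : κ ≤ (25 / 16) ^ 2 * (4 * (c * (3 / 5) ^ 14))) : 1 / 2 ≤ q := by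
  have h1 : c * (1 - q) ^ 2 ≤ c * (1 / 4) := by
    have : (3 / 5 : ℝ) ^ 14 ≤ 1 / 1000 := by norm_num
    nlinarith
  have h2 := le_of_mul_le_mul_left h1 hc
  nlinarith [sq_nonneg (1 - q)]

/-- A vertex in the middle of a shell is hit with large probability from any vertex near it,
before the shell is left. -/
lemma exists_potential_local {i l : ℕ} (s : Bool) {a b : ℕ} (hl : 2 ^ (i + 15) ∣ l)
    (h : isBase a b) (hab : a + b = l + 2 ^ (i + 14)) {t : ℕ × ℕ} (ht : t ∈ tset (2 ^ i)) :
    ∃ p : SG → ℝ, (∀ x, 0 ≤ p x) ∧ (∀ x, p x ≤ 1) ∧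
      (∀ x, p x ≠ 0 → l < level x ∧ level x < l + 2 ^ (i + 16)) ∧
      (∀ x, x ≠ vtx s (a + t.1) (b + t.2) → 0 ≤ graph.lap p x) ∧ 1 / 2 ≤ p (vtx s a b) := by
  obtain ⟨W, hW1, hW2, hW3⟩ := exists_cell_bump (i := i) (j := i + 14) (by omega) hl h hab
  have hpos : 0 < 2 ^ i := by positivity
  have e14 : 2 ^ (i + 14) = 2 ^ i * 16384 := by rw [pow_add]; norm_num
  have e15 : 2 ^ (i + 15) = 2 ^ i * 32768 := by rw [pow_add]; norm_num
  have e16 : 2 ^ (i + 16) = 2 ^ i * 65536 := by rw [pow_add]; norm_num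
  have ht' := mem_tset.1 ht
  -- the cell of side `2 ^ i` at `(a, b)`
  obtain ⟨w, v, hwv, rfl, rfl⟩ := h.exists_eq_mul hl hab
  have hyb : isBase (2 ^ i * w + t.1) (2 ^ i * v + t.2) :=
    (isBase_add_iff (by omega) (by omega)).2 ⟨hwv, ht'.1⟩
  set y := vtx s (2 ^ i * w + t.1) (2 ^ i * v + t.2) with hy
  have hlevy : level y = l + 2 ^ (i + 14) + (t.1 + t.2) := by
    rw [hy, level_vtx (isVert.of_base hyb)]; omega
  set S := (graph.ball (l + 2 ^ (i + 16))).filter fun x => l < level x with hS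
  have hmemS : ∀ x, x ∈ S ↔ l < level x ∧ level x < l + 2 ^ (i + 16) := by
    intro x
    rw [hS, Finset.mem_filter, mem_ball, and_comm]
  have hyS : y ∈ S := (hmemS y).2 ⟨by omega, by omega⟩
  obtain ⟨p, hp1, hp0, hph, hpn, hple⟩ := graph.exists_potential hyS
  refine ⟨p, hpn, hple, fun x hx => (hmemS x).1 (by_contra fun h => hx (hp0 x h)),
    fun x hx => ?_, ?_⟩
  · by_cases hxS : x ∈ S
    · rw [hph x hxS hx]
    · unfold LeveledGraph.lap
      exact Finset.sum_nonneg fun z _ => by rw [hp0 x hxS]; simpa using hpn z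
  set R := l + 2 ^ (i + 16) with hR
  have hlt : ∀ x ∈ S, level x < R := fun x hx => ((hmemS x).1 hx).2
  have hW0 : W 0 0 = 0 := by
    by_contra h0
    have := (hW1 0 0 h0).1
    omega
  set κ := - graph.lap p y with hκ
  have hsum : ∀ g : SG → ℝ, ∑ x ∈ S, g x * graph.lap p x = g y * graph.lap p y := by
    intro g
    exact Finset.sum_eq_single_of_mem y hyS fun x hx hxz => by rw [hph x hx hxz, mul_zero]
  have hθ0 : ∀ x ∉ S, liftSide s W x = 0 := by
    intro x hx
    obtain ⟨s', a', b', hv', rfl⟩ := exists_vtx x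
    rw [hmemS, level_vtx hv'] at hx
    rw [liftSide_vtx hW0 hv']
    split_ifs
    · by_contra hne
      have := hW1 _ _ hne
      have e : 2 ^ (i + 14 + 1) = 2 ^ i * 32768 := e15
      omega
    · rfl
  have hA : energy₂ R p p = κ := by rw [energy₂_eq hlt hp0, hsum, hp1]; ring
  have hθy : liftSide s W y = W (2 ^ i * w + t.1) (2 ^ i * v + t.2) := by
    rw [hy, liftSide_vtx hW0 (isVert.of_base hyb), if_pos rfl]
  set θ := W (2 ^ i * w + t.1) (2 ^ i * v + t.2) with hθ
  have hB : energy₂ R p (liftSide s W) = θ * κ := by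
    rw [energy₂_eq hlt hθ0, hsum, hθy]; ring
  have hθge : (16 / 25 : ℝ) ≤ θ := by
    have := hW3 t.1 t.2 ht'.2
    rw [show i + 14 - i = 14 by omega] at this
    have h2 : (3 / 5 : ℝ) ^ 14 ≤ 9 / 25 := by norm_num
    linarith
  have hC := hW2 R
  rw [← energy₂_liftSide (s := s) hW0 R] at hC
  have hq := energy₂_sub_smul_nonneg R (1 / θ) p (liftSide s W)
  have hθpos : 0 < θ := by linarith
  rw [hA, hB] at hq
  have hκle : κ ≤ (1 / θ) ^ 2 * energy₂ R (liftSide s W) (liftSide s W) := by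
    have : 2 * (1 / θ) * (θ * κ) = 2 * κ := by field_simp
    linarith
  have hinv : (1 / θ) ^ 2 ≤ (25 / 16) ^ 2 := by
    refine pow_le_pow_left₀ (by positivity) ?_ 2
    rw [div_le_div_iff₀ hθpos (by norm_num)]
    linarith
  have h5 : (0 : ℝ) < (3 / 5) ^ i := by positivity
  have hκle2 : κ ≤ (25 / 16) ^ 2 * (4 * ((3 / 5) ^ i * (3 / 5) ^ 14)) := by
    rw [pow_add] at hC
    exact hκle.trans (mul_le_mul hinv hC
      (by rw [energy₂_liftSide hW0]; exact energy_nonneg _ _) (by positivity))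
  have hD := sq_sub_shift_le hwv (i := i) (R := R) (by omega) (fun a b => p (vtx s a b)) ht
  have hE := energy_le_energy₂ s R p
  have hp1' : p (vtx s (2 ^ i * w + t.1) (2 ^ i * v + t.2)) = 1 := hp1
  simp only [hp1'] at hD
  rw [hA] at hE
  exact half_le_of_mul_sq_le h5 (hD.trans (by linarith)) hκle2

end Gasket

namespace LeveledGraph

variable {V : Type*} [DecidableEq V] (G : LeveledGraph V)

/-- The maximum principle in the part of `A` up to level `m`. -/
lemma le_of_lap_nonneg_lower {A : Finset V} {m : ℕ} {f : V → ℝ} (hf : ∀ x ∈ A, 0 ≤ G.lap f x)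
    (hb : ∀ x ∈ G.bd A, G.lev x ≤ m → f x ≤ 0)
    (hK : ∀ x ∈ A, G.lev x = m → (∃ y ∈ G.nbr x, G.lev y = m + 1) → f x ≤ 0) {x : V}
    (hx : x ∈ A) (hxm : G.lev x ≤ m) : f x ≤ 0 := by
  classical
  have := G.max_principle
    (A := A.filter fun x => G.lev x ≤ m ∧ ∀ y ∈ G.nbr x, G.lev y ≤ m)
    (f := fun x => if (x ∈ A ∨ x ∈ G.bd A) ∧ G.lev x ≤ m then f x else 0)
    (fun x hx => by
      rw [Finset.mem_filter] at hx
      rw [G.lap_congr (g := f) (by simp [hx.1, hx.2.1])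
        fun y hy => by simp [G.nbr_mem hx.1 hy, hx.2.2 y hy]]
      exact hf x hx.1)
    (fun x hx => by
      rw [Finset.mem_filter] at hx
      by_cases h : (x ∈ A ∨ x ∈ G.bd A) ∧ G.lev x ≤ m
      · rw [if_pos h]
        obtain ⟨h1 | h1, h2⟩ := h
        · push Not at hx
          obtain ⟨y, hy, hlt⟩ := hx h1 h2
          have := G.lev_le hy
          exact hK x h1 (by omega) ⟨y, hy, by omega⟩
        · exact hb x h1 h2
      · rw [if_neg h]) x
  simpa [hx, hxm] using this

end LeveledGraph

namespace Gasket

lemma exists_eq_vtx_of_level_succ {x y : SG} (hy : y ∈ graph.nbr x) (h : level y = level x + 1) :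
    ∃ s a b, isBase a b ∧ x = vtx s a b := by
  obtain ⟨s, a, b, hb, h'⟩ := (sgAdj_iff x y).1 ((adj_iff x y).2 hy)
  have e1 := level_vtx (s := s) (isVert.of_base hb)
  have e2 := level_vtx (s := s) (isVert.of_base_left hb)
  have e3 := level_vtx (s := s) (isVert.of_base_right hb)
  rcases h' with ⟨rfl, -⟩ | ⟨rfl, rfl | rfl⟩ | ⟨rfl, rfl | rfl⟩
  · exact ⟨s, a, b, hb, rfl⟩
  all_goals omega

/-- A walk that crosses a sparsely occupied shell is likely to settle there. -/
lemma half_exitMean_le {i l : ℕ} (hl : 2 ^ (i + 15) ∣ l) {A : Finset SG} (ho : origin ∈ A)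
    (hA : (A.filter fun x => l ≤ level x).card < 3 ^ i) :
    1 / 2 * graph.exitMean sgAdj A (fun y => if l + 2 ^ (i + 16) ≤ level y then 1 else 0) origin
      ≤ graph.exitMean sgAdj A
        (fun y => if l ≤ level y ∧ level y < l + 2 ^ (i + 16) then 1 else 0) origin := by
  set H : SG → ℝ := fun y => if l + 2 ^ (i + 16) ≤ level y then 1 else 0 with hH
  set F : SG → ℝ := fun y => if l ≤ level y ∧ level y < l + 2 ^ (i + 16) then 1 else 0 with hF
  have hpow : 2 ^ (i + 14) < 2 ^ (i + 16) := Nat.pow_lt_pow_right (by norm_num) (by omega)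
  have key : ∀ x ∈ A, level x = l + 2 ^ (i + 14) → (∃ y ∈ graph.nbr x,
      level y = l + 2 ^ (i + 14) + 1) → 1 / 2 ≤ graph.exitMean sgAdj A F x := by
    rintro x hx hlev ⟨y, hy, hylev⟩
    obtain ⟨s, a, b, hb, rfl⟩ := exists_eq_vtx_of_level_succ hy (by omega)
    rw [level_vtx (isVert.of_base hb)] at hlev
    have hbase : ∀ t ∈ tset (2 ^ i), isBase (a + t.1) (b + t.2) := by
      intro t ht
      obtain ⟨w, v, hwv, rfl, rfl⟩ := hb.exists_eq_mul hl hlev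
      have ht' := mem_tset.1 ht
      exact (isBase_add_iff (by omega) (by omega)).2 ⟨hwv, ht'.1⟩
    obtain ⟨t, ht, htA⟩ : ∃ t ∈ tset (2 ^ i), vtx s (a + t.1) (b + t.2) ∉ A := by
      by_contra! hcon
      refine absurd hA (not_lt.2 ?_)
      rw [← card_tset_two_pow i]
      refine Finset.card_le_card_of_injOn (fun t => vtx s (a + t.1) (b + t.2)) ?_ ?_
      · intro t ht
        rw [Finset.mem_coe, Finset.mem_filter, level_vtx (isVert.of_base (hbase t ht))]
        have : 0 < 2 ^ (i + 14) := by positivity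
        exact ⟨hcon t ht, by omega⟩
      · intro t ht t' ht' he
        have := (vtx_inj (isVert.of_base (hbase t ht)) (isVert.of_base (hbase t' ht'))).1 he
        ext <;> omega
    obtain ⟨p, hp0, hp1, hps, hpl, hpv⟩ := exists_potential_local s hl hb hlev ht
    calc (1 / 2 : ℝ) ≤ p (vtx s a b) := hpv
      _ ≤ graph.exitMean sgAdj A p (vtx s a b) :=
        graph.le_exitMean adj_iff (fun z hz => hpl z fun h => htA (h ▸ hz)) hx
      _ ≤ graph.exitMean sgAdj A F (vtx s a b) := by
        refine graph.exitMean_mono adj_iff (fun z _ => ?_) _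
        by_cases hz : p z = 0
        · rw [hz, hF]; dsimp only; split_ifs <;> norm_num
        · have := hps z hz
          rw [hF]; dsimp only
          rw [if_pos ⟨this.1.le, this.2⟩]
          exact hp1 z
  have hle1 : ∀ x ∈ A, graph.exitMean sgAdj A H x ≤ 1 := by
    intro x hx
    rw [← graph.exitMean_const adj_iff hx (1 : ℝ)]
    refine graph.exitMean_mono adj_iff (fun z _ => ?_) _
    rw [hH]; dsimp only; split_ifs <;> norm_num
  have h := graph.le_of_lap_nonneg_lower (A := A) (m := l + 2 ^ (i + 14))
    (f := fun x => 1 / 2 * graph.exitMean sgAdj A H x - graph.exitMean sgAdj A F x)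
    (fun x hx => by
      rw [graph.lap_sub, graph.lap_const_mul, graph.lap_exitMean adj_iff hx,
        graph.lap_exitMean adj_iff hx]; simp)
    (fun x hx hxm => by
      have hxm' : level x ≤ l + 2 ^ (i + 14) := hxm
      rw [graph.exitMean_of_bd adj_iff hx, graph.exitMean_of_bd adj_iff hx, hH, hF]
      dsimp only
      rw [if_neg (by omega)]
      split_ifs <;> norm_num)
    (fun x hx hxm hy => by
      have h1 := key x hx hxm hy
      have h2 := hle1 x hx
      linarith) ho (by rw [show graph.lev origin = 0 from level_origin]; exact Nat.zero_le _)
  linarith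

/-- The number of vertices of `A` at distance at least `l` from the origin. -/
noncomputable def far (A : Finset SG) (l : ℕ) : ℕ := (A.filter fun x => l ≤ level x).card

lemma far_anti (A : Finset SG) {l l' : ℕ} (h : l ≤ l') : far A l' ≤ far A l :=
  Finset.card_le_card fun x hx => by
    rw [Finset.mem_filter] at hx ⊢
    exact ⟨hx.1, h.trans hx.2⟩

lemma far_insert {A : Finset SG} {y : SG} (hy : y ∉ A) (l : ℕ) :
    far (insert y A) l = far A l + if l ≤ level y then 1 else 0 := by
  unfold far
  rw [Finset.filter_insert]
  split_ifs with h
  · exact Finset.card_insert_of_notMem fun h' => hy (Finset.mem_filter.1 h').1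
  · rfl

/-- The weight of a cluster whose exponential growth makes it a supermartingale. -/
noncomputable def weight (N l l' : ℕ) (A : Finset SG) : ℝ :=
  if far A l < N then (6 / 5) ^ (6 * far A l') * (5 / 6) ^ (5 * far A l) else 0

lemma weight_nonneg (N l l' : ℕ) (A : Finset SG) : 0 ≤ weight N l l' A := by
  unfold weight
  split_ifs
  · positivity
  · exact le_rfl

lemma weight_insert_le {N l l' : ℕ} (hll : l ≤ l') {A : Finset SG} (hA : far A l < N) {y : SG}
    (hy : y ∉ A) : weight N l l' (insert y A) ≤ weight N l l' A *
      (1 + (1 / 5 * (if l' ≤ level y then 1 else 0)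
        + (-(2 / 5)) * (if l ≤ level y ∧ level y < l' then 1 else 0))) := by
  have hw : weight N l l' A = (6 / 5) ^ (6 * far A l') * (5 / 6) ^ (5 * far A l) := if_pos hA
  have hle : weight N l l' (insert y A) ≤ (6 / 5) ^ (6 * far (insert y A) l')
      * (5 / 6) ^ (5 * far (insert y A) l) := by
    unfold weight
    split_ifs
    · exact le_rfl
    · positivity
  refine hle.trans ?_
  have hw0 := weight_nonneg N l l' A
  rw [far_insert hy, far_insert hy, mul_add, mul_add, pow_add, pow_add]
  rw [hw] at hw0 ⊢
  generalize (6 / 5 : ℝ) ^ (6 * far A l') = u at *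
  generalize (5 / 6 : ℝ) ^ (5 * far A l) = v at *
  by_cases c1 : l ≤ level y
  · by_cases c2 : l' ≤ level y
    · have c3 : ¬ (l ≤ level y ∧ level y < l') := by omega
      rw [if_pos c1, if_pos c2, if_pos c2, if_neg c3]
      norm_num
      nlinarith
    · have c3 : l ≤ level y ∧ level y < l' := by omega
      rw [if_pos c1, if_neg c2, if_neg c2, if_pos c3]
      norm_num
      nlinarith
  · have c2 : ¬ l' ≤ level y := by omega
    have c3 : ¬ (l ≤ level y ∧ level y < l') := by omega
    rw [if_neg c1, if_neg c2, if_neg c2, if_neg c3]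
    norm_num

lemma exitMean_weight_le {i l : ℕ} (hl : 2 ^ (i + 15) ∣ l) {A : Finset SG} (ho : origin ∈ A) :
    graph.exitMean sgAdj A (fun y => weight (3 ^ i) l (l + 2 ^ (i + 16)) (insert y A)) origin
      ≤ weight (3 ^ i) l (l + 2 ^ (i + 16)) A := by
  by_cases hA : far A l < 3 ^ i
  · have hc := half_exitMean_le hl ho hA
    set H : SG → ℝ := fun y => if l + 2 ^ (i + 16) ≤ level y then 1 else 0 with hH
    set F : SG → ℝ := fun y => if l ≤ level y ∧ level y < l + 2 ^ (i + 16) then 1 else 0 with hF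
    have hw0 := weight_nonneg (3 ^ i) l (l + 2 ^ (i + 16)) A
    refine (graph.exitMean_mono adj_iff (fun y hy =>
      weight_insert_le (Nat.le_add_right _ _) hA (graph.mem_bd.1 hy).1) _).trans ?_
    generalize weight (3 ^ i) l (l + 2 ^ (i + 16)) A = w at *
    rw [graph.exitMean_const_mul w fun y => 1 + (1 / 5 * H y + (-(2 / 5)) * F y),
      graph.exitMean_add (fun _ => 1) fun y => 1 / 5 * H y + (-(2 / 5)) * F y,
      graph.exitMean_add (fun y => 1 / 5 * H y) fun y => (-(2 / 5)) * F y,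
      graph.exitMean_const_mul (1 / 5) H, graph.exitMean_const_mul (-(2 / 5)) F,
      graph.exitMean_const adj_iff ho]
    nlinarith
  · rw [weight, if_neg hA, ← graph.exitMean_const adj_iff ho (0 : ℝ)]
    refine graph.exitMean_mono adj_iff (fun y hy => le_of_eq (if_neg ?_)) _
    rw [far_insert (graph.mem_bd.1 hy).1]
    omega

lemma exp_le_pow_mul_pow {m n : ℕ} (h : n ≤ m) :
    Real.exp (((m : ℝ) - n) / 6) ≤ (6 / 5) ^ m * (5 / 6) ^ n := by
  obtain ⟨d, rfl⟩ := Nat.exists_eq_add_of_le h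
  have hq : Real.exp (1 / 6) ≤ 6 / 5 := by
    have := Real.exp_bound_div_one_sub_of_interval' (x := 1 / 6) (by norm_num) (by norm_num)
    norm_num at this ⊢
    exact this.le
  calc Real.exp ((((n + d : ℕ) : ℝ) - n) / 6) = Real.exp (1 / 6) ^ d := by
        rw [← Real.exp_nat_mul]
        congr 1
        push_cast
        ring
    _ ≤ (6 / 5) ^ d := pow_le_pow_left₀ (Real.exp_nonneg _) hq d
    _ = (6 / 5) ^ d * ((6 / 5) * (5 / 6)) ^ n := by norm_num
    _ = _ := by rw [mul_pow, pow_add]; ring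

section

variable {Ω : Type*} [MeasurableSpace Ω] {P : Measure Ω} [IsProbabilityMeasure P]
  {I : ℕ → Ω → Finset SG} {Y : ℕ → Ω → SG}

/-- It is unlikely that most particles cross a sparsely occupied shell. -/
lemma measure_cross_shell_le (h : IsIDLA sgAdj origin P I Y) (T : ℕ) {i l : ℕ}
    (hl : 2 ^ (i + 15) ∣ l) {y : ℝ} (hy : y ≤ 3 ^ i) :
    P {ω | (far (I T ω) l : ℝ) < y ∧ 11 / 12 * y ≤ far (I T ω) (l + 2 ^ (i + 16))}
      ≤ ENNReal.ofReal (Real.exp (-(1 / 12 * y))) := by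
  have hpos : 0 < 2 ^ (i + 16) := by positivity
  refine (graph.measure_bad_le adj_iff h T
    (Φ := fun _ A => Real.exp (-(1 / 12 * y)) * weight (3 ^ i) l (l + 2 ^ (i + 16)) A)
    (Bad := fun A => (far A l : ℝ) < y ∧ 11 / 12 * y ≤ far A (l + 2 ^ (i + 16)))
    (fun _ A => mul_nonneg (Real.exp_nonneg _) (weight_nonneg _ _ _ _)) (fun _ A hA => ?_)
    fun A _ _ hbad => ?_).trans (ENNReal.ofReal_le_ofReal ?_)
  · rw [graph.exitMean_const_mul (Real.exp (-(1 / 12 * y)))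
      fun y => weight (3 ^ i) l (l + 2 ^ (i + 16)) (insert y A)]
    exact mul_le_mul_of_nonneg_left (exitMean_weight_le hl hA) (Real.exp_nonneg _)
  · have hlt : far A l < 3 ^ i := by
      have := hbad.1.trans_le hy
      exact_mod_cast this
    rw [weight, if_pos hlt]
    generalize l + 2 ^ (i + 16) = l' at *
    have hy0 : 0 < y := (Nat.cast_nonneg _).trans_lt hbad.1
    have hle : 5 * far A l ≤ 6 * far A l' := by
      have : (5 * far A l : ℝ) ≤ 6 * far A l' := by linarith [hbad.1, hbad.2]
      exact_mod_cast this
    refine le_trans ?_ (mul_le_mul_of_nonneg_left (exp_le_pow_mul_pow hle) (Real.exp_nonneg _))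
    rw [← Real.exp_add, Real.one_le_exp_iff]
    push_cast
    linarith [hbad.1, hbad.2]
  · refine mul_le_of_le_one_right (Real.exp_nonneg _) ?_
    have : far {origin} (l + 2 ^ (i + 16)) = 0 := by
      rw [far, Finset.card_eq_zero, Finset.filter_eq_empty_iff]
      intro x hx
      rw [Finset.mem_singleton.1 hx, level_origin]
      omega
    unfold weight
    split_ifs
    · rw [show (graph.root) = origin from rfl, this, mul_zero, pow_zero, one_mul]
      exact pow_le_one₀ (by norm_num) (by norm_num)
    · norm_num

end
end Gasket

namespace MeasureTheory

lemma measure_le_ofReal_add {Ω : Type*} [MeasurableSpace Ω] {P : Measure Ω} {A B C : Set Ω}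
    {b c : ℝ} (h : A ⊆ B ∪ C) (hb : P B ≤ ENNReal.ofReal b) (hc : P C ≤ ENNReal.ofReal c)
    (hb0 : 0 ≤ b) (hc0 : 0 ≤ c) : P A ≤ ENNReal.ofReal (b + c) := by
  rw [ENNReal.ofReal_add hb0 hc0]
  exact (measure_mono h).trans ((measure_union_le _ _).trans (add_le_add hb hc))

end MeasureTheory

namespace Gasket

variable {Ω : Type*} [MeasurableSpace Ω] {P : Measure Ω} {I : ℕ → Ω → Finset SG} {Y : ℕ → Ω → SG}

/-- A sparsely occupied region cannot reach far, since the cluster is connected. -/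
lemma level_lt_of_far_lt (h : IsIDLA sgAdj origin P I Y) {T l N : ℕ} {ω : Ω}
    (hN : far (I T ω) l < N) {x : SG} (hx : x ∈ I T ω) : level x < l + N := by
  by_contra! hle
  refine absurd hN (not_lt.2 ?_)
  have hex : ∀ m : ℕ, m < N → ∃ y ∈ I T ω, level y = l + m := fun m hm =>
    graph.exists_mem_cluster_lev adj_iff h T ω hx
      (show l + m ≤ level x by omega)
  have : Nonempty SG := ⟨origin⟩
  choose! f hf hlev using hex
  rw [← Finset.card_range N]
  refine Finset.card_le_card_of_injOn f (fun m hm => ?_) fun m hm m' hm' he => ?_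
  · have hm' : m < N := by simpa using hm
    rw [Finset.mem_coe, Finset.mem_filter, hlev m hm']
    exact ⟨hf m hm', by omega⟩
  · have h1 := hlev m (by simpa using hm)
    have h2 := hlev m' (by simpa using hm')
    rw [he] at h1
    omega

variable [IsProbabilityMeasure P]

lemma measure_cross_shells_le (h : IsIDLA sgAdj origin P I Y) (T : ℕ) {i l : ℕ}
    (hl : 2 ^ (i + 15) ∣ l) {y : ℝ} (hy0 : 0 ≤ y) (hy : y ≤ 3 ^ i) (m : ℕ) (hm : m ≤ 13) :
    P {ω | (far (I T ω) l : ℝ) < y ∧ (11 / 12) ^ m * y ≤ far (I T ω) (l + m * 2 ^ (i + 16))}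
      ≤ ENNReal.ofReal (m * Real.exp (-(1 / 36 * y))) := by
  induction m with
  | zero =>
    have : {ω | (far (I T ω) l : ℝ) < y ∧ (11 / 12) ^ 0 * y ≤ far (I T ω) (l + 0 * 2 ^ (i + 16))}
        = ∅ := by
      ext ω
      simp
    rw [this, measure_empty]
    exact zero_le
  | succ m ih =>
    have hdvd : 2 ^ (i + 15) ∣ l + m * 2 ^ (i + 16) :=
      Dvd.dvd.add hl (Dvd.dvd.mul_left (pow_dvd_pow 2 (by omega)) m)
    have hpow : (11 / 12 : ℝ) ^ m ≤ 1 := pow_le_one₀ (by norm_num) (by norm_num)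
    have hpow' : (1 / 3 : ℝ) ≤ (11 / 12) ^ m :=
      le_trans (by norm_num) (pow_le_pow_of_le_one (by norm_num) (by norm_num)
        (show m ≤ 12 by omega))
    have h1 := measure_cross_shell_le h T hdvd (y := (11 / 12) ^ m * y)
      ((mul_le_of_le_one_left hy0 hpow).trans hy)
    have h2 : Real.exp (-(1 / 12 * ((11 / 12) ^ m * y))) ≤ Real.exp (-(1 / 36 * y)) := by
      rw [Real.exp_le_exp]
      nlinarith
    have h3 := measure_le_ofReal_add
      (A := {ω | (far (I T ω) l : ℝ) < y ∧
        (11 / 12) ^ (m + 1) * y ≤ far (I T ω) (l + (m + 1) * 2 ^ (i + 16))})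
      (fun ω hω => ?_) (ih (by omega)) (h1.trans (ENNReal.ofReal_le_ofReal h2))
      (by positivity) (by positivity)
    · refine h3.trans (le_of_eq ?_)
      push_cast
      ring_nf
    · obtain ⟨g1, g2⟩ := hω
      rw [add_one_mul, ← add_assoc] at g2
      by_cases c : (11 / 12) ^ m * y ≤ far (I T ω) (l + m * 2 ^ (i + 16))
      · exact Or.inl ⟨g1, c⟩
      · exact Or.inr ⟨not_le.1 c, by rw [← mul_assoc, ← pow_succ']; exact g2⟩

/-- It is unlikely that the number of far particles decays slowly across scales. -/
lemma measure_cross_scales_le (h : IsIDLA sgAdj origin P I Y) (T i d : ℕ) {l : ℕ}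
    (hl : 2 ^ (i + d + 15) ∣ l) :
    P {ω | far (I T ω) l < 3 ^ (i + d) ∧ 3 ^ i ≤ far (I T ω) (l + 13 * 2 ^ (i + d + 17))}
      ≤ ENNReal.ofReal (d * (13 * Real.exp (-(1 / 12 * 3 ^ i)))) := by
  induction d generalizing l with
  | zero =>
    have : {ω | far (I T ω) l < 3 ^ (i + 0) ∧ 3 ^ i ≤ far (I T ω) (l + 13 * 2 ^ (i + 0 + 17))}
        = ∅ := by
      ext ω
      simp only [Set.mem_ofPred_eq, Set.mem_empty_iff_false, iff_false, not_and, not_le, add_zero]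
      exact fun h => (far_anti _ (by omega)).trans_lt h
    rw [this, measure_empty]
    exact zero_le
  | succ d ih =>
    have e : i + (d + 1) = i + d + 1 := by ring
    rw [e] at hl ⊢
    have hdvd : 2 ^ (i + d + 15) ∣ l + 13 * 2 ^ (i + d + 1 + 16) :=
      Dvd.dvd.add ((pow_dvd_pow 2 (by omega)).trans hl)
        (Dvd.dvd.mul_left (pow_dvd_pow 2 (by omega)) 13)
    have h1 := measure_cross_shells_le h T hl (y := 3 ^ (i + d + 1)) (by positivity) le_rfl
      13 le_rfl
    have hexp : Real.exp (-(1 / 36 * 3 ^ (i + d + 1))) ≤ Real.exp (-(1 / 12 * 3 ^ i)) := by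
      have : (3 : ℝ) ^ i ≤ 3 ^ (i + d) := pow_le_pow_right₀ (by norm_num) (by omega)
      rw [Real.exp_le_exp, pow_succ]
      linarith
    have h3 := measure_le_ofReal_add
      (A := {ω | far (I T ω) l < 3 ^ (i + d + 1) ∧
        3 ^ i ≤ far (I T ω) (l + 13 * 2 ^ (i + d + 1 + 17))})
      (fun ω hω => ?_) (ih hdvd) (h1.trans (ENNReal.ofReal_le_ofReal
        (mul_le_mul_of_nonneg_left hexp (by positivity)))) (by positivity) (by positivity)
    · refine h3.trans (le_of_eq ?_)
      push_cast
      ring_nf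
    · obtain ⟨g1, g2⟩ := hω
      by_cases c : far (I T ω) (l + 13 * 2 ^ (i + d + 1 + 16)) < 3 ^ (i + d)
      · refine Or.inl ⟨c, g2.trans (far_anti _ (le_of_eq ?_))⟩
        ring
      · refine Or.inr ⟨by exact_mod_cast g1, ?_⟩
        have c' : (3 : ℝ) ^ (i + d) ≤ far (I T ω) (l + 13 * 2 ^ (i + d + 1 + 16)) := by
          exact_mod_cast not_lt.1 c
        refine le_trans ?_ c'
        rw [pow_succ (3 : ℝ) (i + d), mul_left_comm]
        exact mul_le_of_le_one_right (by positivity) (by norm_num)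

end Gasket

namespace Gasket

lemma card_annulus_le (n i : ℕ) :
    ((graph.ball (n + 1)).filter fun x => n < level x + 2 ^ i).card
      ≤ 12 * (n / 2 ^ i + 1) * 3 ^ i := by
  have hp : 0 < 2 ^ i := by positivity
  set q := n / 2 ^ i
  have hq : 2 ^ i * q + n % 2 ^ i = n := Nat.div_add_mod n _
  have hr : n % 2 ^ i < 2 ^ i := Nat.mod_lt _ hp
  have hsub : ((graph.ball (n + 1)).filter fun x => n < level x + 2 ^ i) ⊆
      ((Finset.univ : Finset Bool) ×ˢ ({(0, 0), (1, 0), (0, 1)} : Finset (ℕ × ℕ)) ×ˢ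
        Finset.range (q + 1) ×ˢ Finset.range 2 ×ˢ tset (2 ^ i)).image
      fun t => vtx t.1 (2 ^ i * t.2.2.1 + t.2.2.2.2.1 + t.2.1.1)
        (2 ^ i * (q - t.2.2.2.1 - t.2.2.1) + t.2.2.2.2.2 + t.2.1.2) := by
    intro x hx
    obtain ⟨s, a, b, hv, rfl⟩ := exists_vtx x
    rw [Finset.mem_filter, mem_ball, level_vtx hv] at hx
    obtain ⟨⟨a', b'⟩, hbase, hle, hcase⟩ := hv.exists_corner
    dsimp only at hbase hle hcase
    obtain ⟨w, v, c, d, rfl, rfl, hcd, hwv, hcd'⟩ := hbase.exists_cell i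
    have hδ : ∃ δ ∈ ({(0, 0), (1, 0), (0, 1)} : Finset (ℕ × ℕ)),
        a = 2 ^ i * w + c + δ.1 ∧ b = 2 ^ i * v + d + δ.2 ∧ δ.1 + δ.2 ≤ 1 := by
      rcases hcase with h | h | h
      · exact ⟨(0, 0), by simp, by simp; omega⟩
      · exact ⟨(1, 0), by simp, by simp; omega⟩
      · exact ⟨(0, 1), by simp, by simp; omega⟩
    obtain ⟨δ, hδ, ha, hb, hδ1⟩ := hδ
    have hadd : 2 ^ i * (w + v) = 2 ^ i * w + 2 ^ i * v := mul_add _ _ _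
    have h1 : w + v ≤ q := by
      by_contra! hlt
      have : 2 ^ i * (q + 1) ≤ 2 ^ i * (w + v) := Nat.mul_le_mul_left _ hlt
      rw [mul_add_one] at this
      omega
    have h2 : q < w + v + 2 := by
      by_contra! hlt
      have : 2 ^ i * (w + v + 2) ≤ 2 ^ i * q := Nat.mul_le_mul_left _ hlt
      rw [mul_add] at this
      omega
    refine Finset.mem_image.2 ⟨(s, δ, w, q - (w + v), c, d), ?_, ?_⟩
    · simp only [Finset.mem_product, Finset.mem_univ, Finset.mem_range, true_and]
      exact ⟨hδ, by omega, by omega, mem_tset.2 ⟨hcd', hcd⟩⟩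
    · dsimp only
      rw [show q - (q - (w + v)) - w = v by omega, ← ha, ← hb]
  refine (Finset.card_le_card hsub).trans (Finset.card_image_le.trans (le_of_eq ?_))
  simp only [Finset.card_product, Finset.card_univ, Fintype.card_bool, Finset.card_range,
    card_tset_two_pow]
  rw [show ({(0, 0), (1, 0), (0, 1)} : Finset (ℕ × ℕ)).card = 3 by decide]
  ring

/-- If a set with one more point than a ball contains a slightly smaller ball, then few of its
points are far away. -/
lemma far_le_of_ball_subset {A : Finset SG} {n m l : ℕ}
    (hA : A.card = (graph.ball (n + 1)).card + 1)
    (hsub : ∀ z, level z + m ≤ n → z ∈ A) (hl : n < l + m) :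
    far A l ≤ ((graph.ball (n + 1)).filter fun x => n < level x + m).card + 1 := by
  have h1 := Finset.card_filter_add_card_filter_not (s := A) (fun x => l ≤ level x)
  have h2 := Finset.card_filter_add_card_filter_not (s := graph.ball (n + 1))
    (fun x => n < level x + m)
  have h3 : ((graph.ball (n + 1)).filter fun x => ¬ n < level x + m).card
      ≤ (A.filter fun x => ¬ l ≤ level x).card := by
    refine Finset.card_le_card fun x hx => ?_
    have hx := (Finset.mem_filter.1 hx).2
    exact Finset.mem_filter.2 ⟨hsub x (by omega), by omega⟩
  rw [far]
  omega

end Gasket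

lemma exists_pow_ratio (F : ℕ) : ∃ D, F ≤ D ∧ 37 * 2 ^ D * 3 ^ F < 3 ^ D := by
  have h : Tendsto (fun D : ℕ => (3 / 2 : ℝ) ^ D) atTop atTop :=
    tendsto_pow_atTop_atTop_of_one_lt (by norm_num)
  obtain ⟨D, hD, hFD⟩ := ((h.eventually_gt_atTop (37 * 3 ^ F)).and (eventually_ge_atTop F)).exists
  refine ⟨D, hFD, ?_⟩
  rw [div_pow, lt_div_iff₀ (by positivity)] at hD
  have : 37 * 3 ^ F * 2 ^ D < 3 ^ D := by exact_mod_cast hD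
  linarith

lemma mul_exp_neg_le {n m : ℕ} (h : n ≤ 16 * 16 ^ m) :
    (n : ℝ) * Real.exp (-(1 / 12 * 3 ^ m))
      ≤ 16 ^ 3 * 12 ^ 9 * (Nat.factorial 9) * (1 / (n : ℝ) ^ 2) := by
  rcases Nat.eq_zero_or_pos n with rfl | hn
  · simp
  have hn' : (0 : ℝ) < n := by exact_mod_cast hn
  have h1 : (n : ℝ) ≤ 16 * (3 ^ m) ^ 3 := by
    have : (16 : ℝ) ^ m ≤ (3 ^ m) ^ 3 := by
      rw [← pow_mul, mul_comm, pow_mul]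
      exact pow_le_pow_left₀ (by norm_num) (by norm_num) m
    have h' : (n : ℝ) ≤ 16 * 16 ^ m := by exact_mod_cast h
    linarith
  have h2 := Real.pow_div_factorial_le_exp (1 / 12 * 3 ^ m : ℝ) (by positivity) 9
  rw [div_le_iff₀ (by positivity)] at h2
  have h3 : (n : ℝ) ^ 3 ≤ (16 * (3 ^ m) ^ 3) ^ 3 := pow_le_pow_left₀ hn'.le h1 3
  rw [Real.exp_neg, ← div_eq_mul_inv, mul_one_div, div_le_div_iff₀ (Real.exp_pos _) (by positivity)]
  generalize Real.exp (1 / 12 * 3 ^ m) = e at *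
  generalize (3 : ℝ) ^ m = y at *
  generalize ((Nat.factorial 9 : ℕ) : ℝ) = f at *
  calc (n : ℝ) * n ^ 2 = n ^ 3 := by ring
    _ ≤ (16 * y ^ 3) ^ 3 := h3
    _ = 16 ^ 3 * 12 ^ 9 * (1 / 12 * y) ^ 9 := by ring
    _ ≤ 16 ^ 3 * 12 ^ 9 * (e * f) := by gcongr
    _ = _ := by ring

namespace Gasket

variable {Ω : Type*} [MeasurableSpace Ω] {P : Measure Ω} {I : ℕ → Ω → Finset SG} {Y : ℕ → Ω → SG}

lemma far_lt_of_ball_subset {A : Finset SG} {n k D F l : ℕ} (hD : 37 * 2 ^ D * 3 ^ F < 3 ^ D)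
    (hFD : F ≤ D) (hDk : D ≤ k) (hk : n < 2 ^ (k + 1))
    (hA : A.card = (graph.ball (n + 1)).card + 1)
    (hsub : ∀ z, level z + 2 ^ (k - D + 1) ≤ n → z ∈ A) (hl : n < l) : far A l < 3 ^ (k - F) := by
  have h1 := far_le_of_ball_subset hA hsub (hl.trans_le (Nat.le_add_right _ _))
  have h2 := card_annulus_le n (k - D + 1)
  have h3 : n / 2 ^ (k - D + 1) < 2 ^ D := by
    rw [Nat.div_lt_iff_lt_mul (by positivity), ← pow_add]
    rwa [show D + (k - D + 1) = k + 1 by omega]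
  have h4 : 12 * (n / 2 ^ (k - D + 1) + 1) * 3 ^ (k - D + 1) ≤ 12 * 2 ^ D * 3 ^ (k - D + 1) :=
    Nat.mul_le_mul_right _ (by omega)
  have h5 : 3 ^ (k - F) * 3 ^ F = 3 ^ (k - D) * 3 ^ D := by
    rw [← pow_add, ← pow_add]
    congr 1
    omega
  have h6 : 37 * 2 ^ D * 3 ^ (k - D) < 3 ^ (k - F) := by
    have hp : 0 < 3 ^ F := by positivity
    refine lt_of_mul_lt_mul_right ?_ hp.le
    rw [h5, mul_right_comm, mul_comm]
    exact Nat.mul_lt_mul_of_pos_left hD (by positivity)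
  have h7 : 0 < 2 ^ D * 3 ^ (k - D) := by positivity
  have h8 : 12 * 2 ^ D * 3 ^ (k - D + 1) = 36 * (2 ^ D * 3 ^ (k - D)) := by ring
  rw [mul_assoc] at h6
  omega

/-- The outer bound: almost surely, the cluster is eventually contained in a slightly larger
ball. -/
lemma ae_eventually_subset_ball [IsProbabilityMeasure P] (h : IsIDLA sgAdj origin P I Y) (G : ℕ) :
    ∀ᵐ ω ∂P, ∀ᶠ n : ℕ in atTop, ∀ z ∈ I (graph.ball (n + 1)).card ω,
      level z ≤ n + 2 ^ (Nat.log 2 n - G + 1) := by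
  obtain ⟨F, hF⟩ : ∃ F, F = G + 21 := ⟨_, rfl⟩
  obtain ⟨D, hFD, hD⟩ := exists_pow_ratio F
  set l : ℕ → ℕ := fun n => 2 ^ (Nat.log 2 n - F + 15) * (n / 2 ^ (Nat.log 2 n - F + 15) + 1)
    with hl
  have hln : ∀ n, n < l n ∧ l n ≤ n + 2 ^ (Nat.log 2 n - F + 15) := fun n => by
    have h1 := Nat.div_add_mod n (2 ^ (Nat.log 2 n - F + 15))
    have h2 := Nat.mod_lt n (show 0 < 2 ^ (Nat.log 2 n - F + 15) by positivity)
    simp only [hl, mul_add_one]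
    omega
  have hsum : Summable fun n : ℕ =>
      13 * (16 ^ 3 * 12 ^ 9 * (Nat.factorial 9 : ℝ) * (1 / (n : ℝ) ^ 2)) :=
    ((Real.summable_one_div_nat_pow.2 one_lt_two).mul_left _).mul_left _
  have key := ae_eventually_notMem_of_le_ofReal (P := P) (N := 2 ^ (2 * F))
    (E := fun n => {ω | far (I (graph.ball (n + 1)).card ω) (l n) < 3 ^ (Nat.log 2 n - F) ∧
      3 ^ (Nat.log 2 n / 4) ≤
        far (I (graph.ball (n + 1)).card ω) (l n + 13 * 2 ^ (Nat.log 2 n - F + 17))})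
    hsum (fun n => by positivity) fun n hn => ?_
  · filter_upwards [key, ae_eventually_ball_subset h D] with ω h1 h2
    filter_upwards [h1, h2, eventually_ge_atTop (2 ^ (D + 2 * F))] with n h1 h2 hn z hz
    have hk : D + 2 * F ≤ Nat.log 2 n := Nat.le_log_of_pow_le (by norm_num) hn
    have hnk := Nat.lt_pow_succ_log_self (b := 2) (by norm_num) n
    have h3 := far_lt_of_ball_subset hD hFD (by omega) hnk
      (graph.card_cluster h (graph.ball (n + 1)).card ω) h2 (hln n).1
    have h4 := level_lt_of_far_lt h (not_le.1 fun h4 => h1 ⟨h3, h4⟩) hz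
    have h5 := (hln n).2
    generalize Nat.log 2 n = k at *
    have h6 : 3 ^ (k / 4) ≤ 2 ^ (k - G) := calc
      3 ^ (k / 4) ≤ 4 ^ (k / 4) := Nat.pow_le_pow_left (by norm_num) _
      _ = 2 ^ (2 * (k / 4)) := by rw [pow_mul]; norm_num
      _ ≤ 2 ^ (k - G) := Nat.pow_le_pow_right (by norm_num) (by omega)
    have h7 : 2 ^ (k - G) = 2 ^ 21 * 2 ^ (k - F) := by
      rw [← pow_add]
      congr 1
      omega
    rw [pow_succ 2 (k - G)]
    rw [pow_add] at h4 h5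
    omega
  · have hk : 2 * F ≤ Nat.log 2 n := Nat.le_log_of_pow_le (by norm_num) hn
    have hnk := Nat.lt_pow_succ_log_self (b := 2) (by norm_num) n
    have hkn := (Nat.log_lt_self 2 (show n ≠ 0 by rintro rfl; exact absurd hn (by simp))).le
    have hdvd : 2 ^ (Nat.log 2 n - F + 15) ∣ l n := Dvd.intro _ rfl
    generalize Nat.log 2 n = k at *
    obtain ⟨d, hd⟩ : ∃ d, k - F = k / 4 + d := ⟨k - F - k / 4, by omega⟩
    rw [hd] at hdvd ⊢
    refine (measure_cross_scales_le h _ (k / 4) d hdvd).trans (ENNReal.ofReal_le_ofReal ?_)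
    have h1 : n ≤ 16 * 16 ^ (k / 4) := by
      refine hnk.le.trans ?_
      have : 16 * 16 ^ (k / 4) = 2 ^ (4 * (k / 4) + 4) := by
        rw [pow_add, pow_mul]
        norm_num
        ring
      rw [this]
      exact Nat.pow_le_pow_right (by norm_num) (by omega)
    have h2 : (d : ℝ) ≤ n := by exact_mod_cast (show d ≤ n by omega)
    rw [mul_left_comm]
    exact mul_le_mul_of_nonneg_left
      ((mul_le_mul_of_nonneg_right h2 (Real.exp_pos _).le).trans (mul_exp_neg_le h1)) (by norm_num)

end Gasket

namespace Gasket

lemma exists_two_pow_log_sub_le {ε : ℝ} (hε : 0 < ε) : ∃ D : ℕ, ∀ n : ℕ, 2 ^ D ≤ n →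
    ((2 ^ (Nat.log 2 n - D + 1) : ℕ) : ℝ) ≤ n * ε := by
  obtain ⟨D, hD⟩ := pow_unbounded_of_one_lt (2 / ε) (one_lt_two : (1 : ℝ) < 2)
  refine ⟨D, fun n hn => ?_⟩
  rw [div_lt_iff₀ hε] at hD
  have hk : D ≤ Nat.log 2 n := Nat.le_log_of_pow_le (by norm_num) hn
  have h1 : 2 ^ (Nat.log 2 n - D) * 2 ^ D ≤ n := by
    rw [← pow_add, Nat.sub_add_cancel hk]
    exact Nat.pow_log_le_self 2 (by rintro rfl; exact absurd hn (by simp))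
  have h2 : (2 : ℝ) ^ (Nat.log 2 n - D) * 2 ^ D ≤ n := by exact_mod_cast h1
  push_cast
  rw [pow_succ]
  calc (2 : ℝ) ^ (Nat.log 2 n - D) * 2 ≤ 2 ^ (Nat.log 2 n - D) * (2 ^ D * ε) := by gcongr
    _ = 2 ^ (Nat.log 2 n - D) * 2 ^ D * ε := by ring
    _ ≤ n * ε := by gcongr

lemma ncard_aBall (n : ℕ) : (aBall sgAdj origin n).ncard = (graph.ball (n + 1)).card := by
  rw [← Set.ncard_coe_finset]
  congr 1
  refine (graph.aBall_eq adj_iff n).trans ?_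
  ext x
  rw [Finset.mem_coe, mem_ball, Nat.lt_succ_iff]
  rfl

lemma aDist_eq_level (x : SG) : aDist sgAdj origin x = level x := graph.aDist_eq adj_iff x

end Gasket

/-- **Internal DLA on the Sierpinski gasket graph (Chen–Huss–Sava-Huss–Teplyaev): the
limit shape is a ball.**  The cluster of `|B_n|` particles occupies a set of sites close
to a ball of radius `n`: for all `ε > 0`, with probability one,
`B_{n(1-ε)} ⊆ I_{|B_n|} ⊆ B_{n(1+ε)}` for all large `n`. -/
theorem internal_dla_sierpinski_gasket_limit_shape
    (o : SG) (ho : o.1 = (0, 0))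
    {Ω : Type*} [MeasurableSpace Ω] (P : Measure Ω) [IsProbabilityMeasure P]
    (I : ℕ → Ω → Finset SG) (Y : ℕ → Ω → SG)
    -- dynamics of the internal DLA chain: `Y (n+1)` is the first exit location from
    -- `I n` of a simple random walk on `SG` started at `o`, independent of the past
    (h0 : ∀ ω, I 0 ω = {o})
    (hstep : ∀ n ω, I (n+1) ω = insert (Y (n+1) ω) (I n ω))
    (hbd : ∀ n ω, Y (n+1) ω ∈ bdryA sgAdj (I n ω))
    (hlaw : ∀ (n : ℕ) (A : Finset SG), ∀ y ∈ bdryA sgAdj A,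
      P {ω | I n ω = A ∧ Y (n+1) ω = y}
        = ENNReal.ofReal (hitMA sgAdj (bdryA sgAdj A) o y) * P {ω | I n ω = A}) :
    ∀ ε : ℝ, 0 < ε → ∀ᵐ ω ∂P, ∀ᶠ n : ℕ in atTop,
      {x : SG | (aDist sgAdj o x : ℝ) ≤ (n : ℝ) * (1 - ε)} ⊆
        ↑(I ((aBall sgAdj o n).ncard) ω) ∧
      (↑(I ((aBall sgAdj o n).ncard) ω) : Set SG) ⊆
        {x : SG | (aDist sgAdj o x : ℝ) ≤ (n : ℝ) * (1 + ε)} := by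
  intro ε hε
  obtain rfl := Gasket.eq_origin_of_val ho
  have h : IsIDLA sgAdj Gasket.origin P I Y := ⟨h0, hstep, hbd, hlaw⟩
  obtain ⟨D, hD⟩ := Gasket.exists_two_pow_log_sub_le hε
  filter_upwards [Gasket.ae_eventually_ball_subset h D, Gasket.ae_eventually_subset_ball h D]
    with ω hin hout
  filter_upwards [hin, hout, eventually_ge_atTop (2 ^ D)] with n hin hout hn
  have hε' := hD n hn
  rw [Gasket.ncard_aBall]
  refine ⟨fun x hx => hin x ?_, fun x hx => ?_⟩
  · rw [Set.mem_ofPred_eq, Gasket.aDist_eq_level] at hx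
    have : ((Gasket.level x + 2 ^ (Nat.log 2 n - D + 1) : ℕ) : ℝ) ≤ n := by
      rw [Nat.cast_add]
      linarith
    exact_mod_cast this
  · rw [Set.mem_ofPred_eq, Gasket.aDist_eq_level]
    have : ((Gasket.level x : ℕ) : ℝ) ≤ ((n + 2 ^ (Nat.log 2 n - D + 1) : ℕ) : ℝ) :=
      Nat.cast_le.2 (hout x hx)
    rw [Nat.cast_add] at this
    linarith
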